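/- A nontrivial orientation-preserving recurrent homeomorphism of the 2-sphere S² has exactly two fixed points. -/

import Mathlib

open Filter Topology Metric

/-- `f` is recurrent with respect to the metric `m`: some sequence of iterates
`f^[n k]` with `n k → ∞` converges uniformly to the identity. -/
def RecurrentWith {X : Type*} (m : MetricSpace X) (f : X → X) : Prop :=
  ∃ n : ℕ → ℕ, Filter.Tendsto n Filter.atTop Filter.atTop ∧
    ∀ ε > 0, ∀ᶠ k in Filter.atTop, ∀ x, @dist X m.toDist (f^[n k] x) x < ε

/-- `f` is a recurrent map of the metric space `X`. -/
def IsRecurrent {X : Type*} [m : MetricSpace X] (f : X → X) : Prop :=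
  RecurrentWith m f

/-- The standard 2-sphere. -/
abbrev Sphere2 : Set (EuclideanSpace ℝ (Fin 3)) := Metric.sphere 0 1

/-- A homeomorphism of the sphere is orientation-preserving iff it has degree `+1`,
equivalently (by Hopf's theorem) iff it is homotopic to the identity. -/
def SphereOrientationPreserving (f : Sphere2 ≃ₜ Sphere2) : Prop :=
  ContinuousMap.Homotopic ⟨f, f.continuous⟩ (ContinuousMap.id Sphere2)

namespace SphRec

theorem locPath_of_convex {E : Type*} [NormedAddCommGroup E] [NormedSpace ℝ E] {s : Set E}
    (hs : Convex ℝ s) : LocallyPathConnectedSpace s := by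
  refine .of_bases (p := fun _ r => 0 < r) (s := fun x r => Metric.ball x r) (fun x => Metric.nhds_basis_ball) ?_
  intro x r hr
  have : Metric.ball x r = ((↑) : s → E) ⁻¹' (s ∩ Metric.ball (x : E) r) := by
    ext y; simp [Subtype.dist_eq]
  rw [this]
  have h1 : IsPathConnected (s ∩ Metric.ball (x : E) r) :=
    (hs.inter (convex_ball _ _)).isPathConnected ⟨x, x.2, Metric.mem_ball_self hr⟩
  exact Topology.IsInducing.subtypeVal.isPathConnected_iff.mpr (by
    rw [Subtype.image_preimage_coe, Set.inter_eq_self_of_subset_right Set.inter_subset_left]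
    exact h1)

theorem log_convex {E : Type*} [NormedAddCommGroup E] [NormedSpace ℝ E] {s : Set E}
    (hs : Convex ℝ s) (g : E → ℂ) (hg : ContinuousOn g s) (hne : ∀ x ∈ s, g x ≠ 0) :
    ∃ l : E → ℂ, ContinuousOn l s ∧ ∀ x ∈ s, Complex.exp (l x) = g x := by
  classical
  rcases s.eq_empty_or_nonempty with rfl | hn
  · exact ⟨0, by simp, by simp⟩
  haveI := locPath_of_convex hs
  haveI : ContractibleSpace s := hs.contractibleSpace hn
  obtain ⟨a, ha⟩ := hn
  obtain ⟨F, ⟨-, hF⟩, -⟩ := Complex.isCoveringMapOn_exp.existsUnique_continuousMap_lifts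
    (⟨s.restrict g, hg.restrict⟩ : C(s, ℂ)) (a₀ := ⟨a, ha⟩) (e₀ := Complex.log (g a))
    (Complex.exp_log (hne a ha)) (fun x => hne x x.2)
  refine ⟨fun x => if hx : x ∈ s then F ⟨x, hx⟩ else 0, ?_, ?_⟩
  · rw [continuousOn_iff_continuous_restrict]
    refine F.continuous.congr ?_
    intro x; simp
  · intro x hx
    simp only [hx, dif_pos]
    exact congrFun hF ⟨x, hx⟩

theorem log_univ {E : Type*} [NormedAddCommGroup E] [NormedSpace ℝ E] 
    (g : E → ℂ) (hg : Continuous g) (hne : ∀ x, g x ≠ 0) :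
    ∃ l : E → ℂ, Continuous l ∧ ∀ x, Complex.exp (l x) = g x := by
  obtain ⟨l, h1, h2⟩ := log_convex (convex_univ (𝕜 := ℝ) (E := E)) g hg.continuousOn (fun x _ => hne x)
  exact ⟨l, continuousOn_univ.mp h1, fun x => h2 x trivial⟩

theorem exp_one_const {X : Type*} [TopologicalSpace X] {s : Set X} (hs : IsPreconnected s)
    {d : X → ℂ} (hd : ContinuousOn d s) (h1 : ∀ x ∈ s, Complex.exp (d x) = 1) 
    {x y : X} (hx : x ∈ s) (hy : y ∈ s) : d x = d y := by
  have : DiscreteTopology (AddSubgroup.zmultiples (2 * Real.pi * Complex.I)) := 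
    NormedSpace.discreteTopology_zmultiples _
  refine hs.constant_of_mapsTo (T := ((AddSubgroup.zmultiples (2 * Real.pi * Complex.I) : AddSubgroup ℂ) : Set ℂ)) ⟨this⟩ hd ?_ hx hy
  intro z hz
  obtain ⟨n, hn⟩ := Complex.exp_eq_one_iff.mp (h1 z hz)
  exact ⟨n, by simp [hn]⟩

/-- two functions with equal exponentials (up to constant factor) on a preconnected set -/
theorem log_sub_const {X : Type*} [TopologicalSpace X] {s : Set X} (hs : IsPreconnected s)
    {d e : X → ℂ} (hd : ContinuousOn d s) (he : ContinuousOn e s)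
    (h1 : ∀ x ∈ s, Complex.exp (d x) = Complex.exp (e x)) 
    {x y : X} (hx : x ∈ s) (hy : y ∈ s) : d x - e x = d y - e y :=
  exp_one_const hs (hd.sub he) (fun z hz => by
    simp [Complex.exp_sub, h1 z hz]) hx hy

theorem int_const {X : Type*} [TopologicalSpace X] {s : Set X} (hs : IsPreconnected s)
    {d : X → ℝ} (hd : ContinuousOn d s) (h1 : ∀ x ∈ s, ∃ n : ℤ, d x = n) 
    {x y : X} (hx : x ∈ s) (hy : y ∈ s) : d x = d y := by
  have : DiscreteTopology (AddSubgroup.zmultiples (1 : ℝ)) := 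
    NormedSpace.discreteTopology_zmultiples _
  refine hs.constant_of_mapsTo (T := ((AddSubgroup.zmultiples (1:ℝ) : AddSubgroup ℝ) : Set ℝ)) ⟨this⟩ hd ?_ hx hy
  intro z hz
  obtain ⟨n, hn⟩ := h1 z hz
  exact ⟨n, by simp [hn]⟩

end SphRec

namespace SphRec

/-- Orientation preserving in the sense of a well-defined logarithm of difference quotients. -/
def OP (h : ℂ → ℂ) : Prop := ∃ L : ℂ → ℂ → ℂ,
  ContinuousOn (fun p : ℂ × ℂ => L p.1 p.2) {p | p.1 ≠ p.2} ∧
  ∀ x y, x ≠ y → Complex.exp (L x y) * (x - y) = h x - h y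

theorem conf_preconnected : IsPreconnected {p : ℂ × ℂ | p.1 ≠ p.2} := by
  have : {p : ℂ × ℂ | p.1 ≠ p.2} = Set.range (fun q : ℂ × ℂ => (q.1 + Complex.exp q.2, q.1)) := by
    ext ⟨x, y⟩
    simp only [Set.mem_ofPred_eq, Set.mem_range, Prod.mk.injEq, Prod.exists]
    constructor
    · intro hxy
      exact ⟨y, Complex.log (x - y), by rw [Complex.exp_log (sub_ne_zero.mpr hxy)]; ring, rfl⟩
    · rintro ⟨a, b, h1, rfl⟩ h2
      rw [← h1] at h2
      exact Complex.exp_ne_zero b (by simp at h2)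
  rw [this]
  exact isPreconnected_range (by fun_prop)

theorem OP.symm_log {h : ℂ → ℂ} (H : OP h) : ∃ L : ℂ → ℂ → ℂ,
    ContinuousOn (fun p : ℂ × ℂ => L p.1 p.2) {p | p.1 ≠ p.2} ∧
    (∀ x y, x ≠ y → Complex.exp (L x y) * (x - y) = h x - h y) ∧
    ∀ x y, x ≠ y → L x y = L y x := by
  obtain ⟨L, hL, hL2⟩ := H
  refine ⟨L, hL, hL2, ?_⟩
  have hs : ContinuousOn (fun p : ℂ × ℂ => L p.2 p.1) {p | p.1 ≠ p.2} := 
    hL.comp (f := Prod.swap) (by fun_prop) (fun p hp => fun h => hp h.symm)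
  intro x y hxy
  have := log_sub_const conf_preconnected hL hs (fun p hp => ?_) (x := (x, y)) (y := (y, x)) hxy hxy.symm
  · simp only at this
    linear_combination (1/2) * this
  · have hp' : p.1 - p.2 ≠ 0 := sub_ne_zero.mpr hp
    apply mul_right_cancel₀ hp'
    rw [hL2 _ _ hp]
    have := hL2 _ _ (Ne.symm hp)
    linear_combination this

theorem periodic_exp {q : ℂ → ℂ} (hq : ∀ ζ, q (ζ + 2 * Real.pi * Complex.I) = q ζ) {a b : ℂ}
    (hab : Complex.exp a = Complex.exp b) : q a = q b := by
  obtain ⟨n, rfl⟩ := Complex.exp_eq_exp_iff_exists_int.mp hab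
  have : Function.Periodic q (2 * Real.pi * Complex.I) := hq
  exact (this.int_mul n) b

theorem descend_log {P : Type*} [TopologicalSpace P] {q : P → ℂ → ℂ} (hc : Continuous fun p : P × ℂ => q p.1 p.2)
    (hq : ∀ w ζ, q w (ζ + 2 * Real.pi * Complex.I) = q w ζ) :
    ContinuousOn (fun p : P × ℂ => q p.1 (Complex.log p.2)) {p | p.2 ≠ 0} := by
  intro p hp
  have hp : p.2 ≠ 0 := hp
  apply ContinuousAt.continuousWithinAt
  have h1 : ∀ᶠ x in 𝓝 p, q x.1 (Complex.log x.2) = q x.1 (Complex.log (x.2 / p.2) + Complex.log p.2) := by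
    have : ∀ᶠ x : P × ℂ in 𝓝 p, x.2 ≠ 0 := continuousAt_snd.eventually_ne hp
    filter_upwards [this] with x hx
    apply periodic_exp (hq x.1)
    rw [Complex.exp_add, Complex.exp_log hx, Complex.exp_log hp, Complex.exp_log (div_ne_zero hx hp)]
    field_simp
  rw [continuousAt_congr h1]
  refine ContinuousAt.comp (g := fun p : P × ℂ => q p.1 p.2) (f := fun x : P × ℂ => (x.1, Complex.log (x.2 / p.2) + Complex.log p.2)) hc.continuousAt ?_
  refine continuousAt_fst.prodMk (ContinuousAt.add ?_ continuousAt_const)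
  refine ContinuousAt.clog (continuousAt_snd.div_const _) ?_
  simp [div_self hp]

theorem wind {h : ℂ → ℂ} (hc : Continuous h) (hi : Function.Injective h) :
    ∃ q : ℂ → ℂ → ℂ, Continuous (fun p : ℂ × ℂ => q p.1 p.2) ∧
      (∀ w ζ, Complex.exp (q w ζ) * Complex.exp ζ = h (w + Complex.exp ζ) - h w) ∧
      ∃ k : ℤ, ∀ w ζ, q w (ζ + 2 * Real.pi * Complex.I) = q w ζ + k * (2 * Real.pi * Complex.I) := by
  obtain ⟨l, hl, hl2⟩ := log_univ (E := ℂ × ℂ)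
    (fun p => (h (p.1 + Complex.exp p.2) - h p.1) / Complex.exp p.2) (by
      refine Continuous.div (by fun_prop) (by fun_prop) (fun p => Complex.exp_ne_zero _)) (by
      intro p
      refine div_ne_zero (sub_ne_zero.mpr fun h => ?_) (Complex.exp_ne_zero _)
      exact Complex.exp_ne_zero p.2 (by simpa using hi h))
  have hper : ∀ p : ℂ × ℂ, Complex.exp (l (p.1, p.2 + 2 * Real.pi * Complex.I)) = Complex.exp (l p) := by
    intro p
    rw [hl2, hl2]
    simp [Complex.exp_add]
  have hcc : ∀ w ζ, l (w, ζ + 2 * Real.pi * Complex.I) - l (w, ζ) = l (0, 0 + 2 * Real.pi * Complex.I) - l (0, 0) := by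
    intro w ζ
    exact log_sub_const (s := Set.univ) (d := fun p : ℂ × ℂ => l (p.1, p.2 + 2 * Real.pi * Complex.I)) (e := l) isPreconnected_univ
      (by fun_prop) (by fun_prop) (fun p _ => hper p) (x := (w, ζ)) (y := (0, 0)) trivial trivial
  refine ⟨fun w ζ => l (w, ζ), hl, ?_, ?_⟩
  · intro w ζ
    rw [hl2]
    field_simp [Complex.exp_ne_zero]
  · obtain ⟨n, hn⟩ := Complex.exp_eq_exp_iff_exists_int.mp (hper (0, 0))
    refine ⟨n, fun w ζ => ?_⟩
    have := hcc w ζ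
    simp only at hn
    rw [hn] at this
    linear_combination this

theorem OP_of_wind_zero {h : ℂ → ℂ} {q : ℂ → ℂ → ℂ} (hc : Continuous (fun p : ℂ × ℂ => q p.1 p.2))
      (hq : ∀ w ζ, Complex.exp (q w ζ) * Complex.exp ζ = h (w + Complex.exp ζ) - h w) 
      (hp : ∀ w ζ, q w (ζ + 2 * Real.pi * Complex.I) = q w ζ) : OP h := by
  refine ⟨fun x y => q y (Complex.log (x - y)), ?_, ?_⟩
  · exact (descend_log hc hp).comp (f := fun p : ℂ × ℂ => (p.2, p.1 - p.2)) (by fun_prop)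
      (fun p hp => sub_ne_zero.mpr hp)
  · intro x y hxy
    have := hq y (Complex.log (x - y))
    rw [Complex.exp_log (sub_ne_zero.mpr hxy)] at this
    rw [this]; simp

theorem OP_of_loc {h : ℂ → ℂ} (hc : Continuous h) (hi : Function.Injective h) (w : ℂ) (r : ℝ) (hr : 0 < r)
    (l : ℂ → ℂ) (hl : ContinuousOn l (Metric.ball w r \ {w})) 
    (hl2 : ∀ z ∈ Metric.ball w r \ {w}, Complex.exp (l z) * (z - w) = h z - h w) : OP h := by
  obtain ⟨q, qc, qe, k, qk⟩ := wind hc hi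
  have hmem : ∀ ζ : ℂ, ζ.re < Real.log r → w + Complex.exp ζ ∈ Metric.ball w r \ {w} := by
    intro ζ hζ
    refine ⟨?_, by simp [Complex.exp_ne_zero]⟩
    simp [Complex.norm_exp]
    rwa [← Real.lt_log_iff_exp_lt hr]
  have hconn : IsPreconnected {ζ : ℂ | ζ.re < Real.log r} := (convex_halfSpace_re_lt _).isPreconnected
  have key := fun x y => log_sub_const hconn (d := fun ζ => l (w + Complex.exp ζ)) (e := fun ζ => q w ζ)
    (hl.comp (by fun_prop) hmem) (Continuous.continuousOn (by fun_prop)) (fun ζ hζ => by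
      have h1 := hl2 _ (hmem ζ hζ)
      rw [← qe w ζ] at h1
      simpa [Complex.exp_ne_zero] using h1) (x := x) (y := y)
  have k0 := key ((Real.log r - 1 : ℝ) + 2 * Real.pi * Complex.I) ((Real.log r - 1 : ℝ)) (by simp) (by simp)
  rw [qk] at k0
  have e1 : Complex.exp (((Real.log r - 1 : ℝ):ℂ) + 2 * Real.pi * Complex.I) = Complex.exp ((Real.log r - 1 : ℝ):ℂ) := by
    simp [Complex.exp_add]
  rw [e1] at k0
  have k1 : (k:ℂ) * (2 * Real.pi * Complex.I) = 0 := by linear_combination -k0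
  refine OP_of_wind_zero qc qe (fun w ζ => ?_)
  rw [qk, k1, add_zero]

end SphRec

namespace SphRec

theorem convex_tri (a b c : ℝ) : Convex ℝ {p : ℝ × ℝ | a ≤ p.1 ∧ p.1 < p.2 ∧ p.2 ≤ b ∧ p.2 - p.1 < c} := by
  rw [convex_iff_forall_pos]
  rintro ⟨x1, x2⟩ ⟨h1, h2, h3, h4⟩ ⟨y1, y2⟩ ⟨k1, k2, k3, k4⟩ s t hs ht hst
  simp only [Set.mem_ofPred_eq, Prod.fst_add, Prod.smul_fst, Prod.snd_add, Prod.smul_snd, smul_eq_mul] at *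
  obtain rfl : t = 1 - s := by linarith
  refine ⟨?_, ?_, ?_, ?_⟩ <;> nlinarith

theorem convex_tri_le (a b c : ℝ) : Convex ℝ {p : ℝ × ℝ | a ≤ p.1 ∧ p.1 < p.2 ∧ p.2 ≤ b ∧ p.2 - p.1 ≤ c} := by
  rw [convex_iff_forall_pos]
  rintro ⟨x1, x2⟩ ⟨h1, h2, h3, h4⟩ ⟨y1, y2⟩ ⟨k1, k2, k3, k4⟩ s t hs ht hst
  simp only [Set.mem_ofPred_eq, Prod.fst_add, Prod.smul_fst, Prod.snd_add, Prod.smul_snd, smul_eq_mul] at *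
  obtain rfl : t = 1 - s := by linarith
  refine ⟨?_, ?_, ?_, ?_⟩ <;> nlinarith

theorem J_lemma {h : ℂ → ℂ} (H : OP h) {X : ℝ → ℂ} (hX : Continuous X)
    (hs : ∀ t, X (t + 1) = h (X t)) (hloc : ∀ t t', t < t' → t' - t ≤ 1 → X t ≠ X t')
    {σ e : ℝ} (hl : σ + 1 < e) (he : X e = X σ)
    (hinj : ∀ s t, σ ≤ s → s < t → t < e → X s ≠ X t)
    {D : ℝ → ℂ} (hD : ContinuousOn D (Set.Icc σ e))
    (hDe : ∀ t ∈ Set.Icc σ e, Complex.exp (D t) = X (t + 1) - X t) : D e ≠ D σ := by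
  obtain ⟨L, Lc, Le, Ls⟩ := H.symm_log
  have hinj2 : ∀ s t, σ ≤ s → s < t → t ≤ e → t - s < e - σ → X s ≠ X t := by
    intro s t h1 h2 h3 h4
    rcases h3.lt_or_eq with h3 | rfl
    · exact hinj s t h1 h2 h3
    · rw [he]
      exact (hinj σ s le_rfl (by linarith) h2).symm
  set T := {p : ℝ × ℝ | σ ≤ p.1 ∧ p.1 < p.2 ∧ p.2 ≤ e ∧ p.2 - p.1 < e - σ} with hT
  set S := {p : ℝ × ℝ | σ ≤ p.1 ∧ p.1 < p.2 ∧ p.2 ≤ e + 1 ∧ p.2 - p.1 ≤ 1} with hS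
  obtain ⟨Λ, Λc, Λe⟩ := log_convex (convex_tri σ e (e - σ)) (fun p => X p.2 - X p.1) (by fun_prop)
    (fun p hp => sub_ne_zero.mpr (hinj2 p.1 p.2 hp.1 hp.2.1 hp.2.2.1 hp.2.2.2).symm)
  obtain ⟨M, Mc, Me⟩ := log_convex (convex_tri_le σ (e + 1) 1) (fun p => X p.2 - X p.1) (by fun_prop)
    (fun p hp => sub_ne_zero.mpr (hloc p.1 p.2 hp.2.1 hp.2.2.2).symm)
  rw [← hT] at Λc Λe
  rw [← hS] at Mc Me
  -- comparison of Λ and M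
  have c1 : ∀ p q : ℝ × ℝ, p ∈ {p : ℝ × ℝ | σ ≤ p.1 ∧ p.1 < p.2 ∧ p.2 ≤ e ∧ p.2 - p.1 ≤ 1} →
      q ∈ {p : ℝ × ℝ | σ ≤ p.1 ∧ p.1 < p.2 ∧ p.2 ≤ e ∧ p.2 - p.1 ≤ 1} → Λ p - M p = Λ q - M q := by
    intro p q hp hq
    have i1 : {p : ℝ × ℝ | σ ≤ p.1 ∧ p.1 < p.2 ∧ p.2 ≤ e ∧ p.2 - p.1 ≤ 1} ⊆ T :=
      fun p hp => ⟨hp.1, hp.2.1, hp.2.2.1, by linarith [hp.2.2.2]⟩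
    have i2 : {p : ℝ × ℝ | σ ≤ p.1 ∧ p.1 < p.2 ∧ p.2 ≤ e ∧ p.2 - p.1 ≤ 1} ⊆ S :=
      fun p hp => ⟨hp.1, hp.2.1, by linarith [hp.2.2.1], hp.2.2.2⟩
    exact log_sub_const (convex_tri_le σ e 1).isPreconnected (Λc.mono i1) (Mc.mono i2)
      (fun p hp => by rw [Λe p (i1 hp), Me p (i2 hp)]) hp hq
  -- shifts
  have sh : ∀ p : ℝ × ℝ, X p.1 ≠ X p.2 → (X (p.2 + 1) - X (p.1 + 1)) = Complex.exp (L (X p.2) (X p.1)) * (X p.2 - X p.1) := by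
    intro p hp
    rw [hs, hs, Le _ _ hp.symm]
  have Lcont : ∀ s : Set (ℝ × ℝ), (∀ p ∈ s, X p.1 ≠ X p.2) → ContinuousOn (fun p : ℝ × ℝ => L (X p.2) (X p.1)) s := by
    intro s hs
    exact Lc.comp (f := fun p : ℝ × ℝ => (X p.2, X p.1)) (by fun_prop) (fun p hp => (hs p hp).symm)
  have c2 : ∀ p q : ℝ × ℝ, p ∈ {p : ℝ × ℝ | σ ≤ p.1 ∧ p.1 < p.2 ∧ p.2 ≤ e ∧ p.2 - p.1 ≤ 1} →
      q ∈ {p : ℝ × ℝ | σ ≤ p.1 ∧ p.1 < p.2 ∧ p.2 ≤ e ∧ p.2 - p.1 ≤ 1} →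
      M (p.1 + 1, p.2 + 1) - (M p + L (X p.2) (X p.1)) = M (q.1 + 1, q.2 + 1) - (M q + L (X q.2) (X q.1)) := by
    intro p q hp hq
    have i2 : {p : ℝ × ℝ | σ ≤ p.1 ∧ p.1 < p.2 ∧ p.2 ≤ e ∧ p.2 - p.1 ≤ 1} ⊆ S :=
      fun p hp => ⟨hp.1, hp.2.1, by linarith [hp.2.2.1], hp.2.2.2⟩
    have i3 : ∀ p : ℝ × ℝ, p ∈ {p : ℝ × ℝ | σ ≤ p.1 ∧ p.1 < p.2 ∧ p.2 ≤ e ∧ p.2 - p.1 ≤ 1} → (p.1 + 1, p.2 + 1) ∈ S :=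
      fun p hp => ⟨by linarith [hp.1], by linarith [hp.2.1], by linarith [hp.2.2.1], by linarith [hp.2.2.2]⟩
    refine log_sub_const (convex_tri_le σ e 1).isPreconnected (d := fun p : ℝ × ℝ => M (p.1 + 1, p.2 + 1))
      (e := fun p => M p + L (X p.2) (X p.1)) (Mc.comp (by fun_prop) i3)
      ((Mc.mono i2).add (Lcont _ fun p hp => hloc _ _ hp.2.1 hp.2.2.2)) ?_ hp hq
    intro p hp
    rw [Complex.exp_add, Me _ (i2 hp), Me _ (i3 p hp), sh p (hloc _ _ hp.2.1 hp.2.2.2), mul_comm]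
  have c3 : ∀ p q : ℝ × ℝ, p ∈ {p : ℝ × ℝ | σ ≤ p.1 ∧ p.1 < p.2 ∧ p.2 ≤ e - 1 ∧ p.2 - p.1 < e - σ} →
      q ∈ {p : ℝ × ℝ | σ ≤ p.1 ∧ p.1 < p.2 ∧ p.2 ≤ e - 1 ∧ p.2 - p.1 < e - σ} →
      Λ (p.1 + 1, p.2 + 1) - (Λ p + L (X p.2) (X p.1)) = Λ (q.1 + 1, q.2 + 1) - (Λ q + L (X q.2) (X q.1)) := by
    intro p q hp hq
    have i2 : {p : ℝ × ℝ | σ ≤ p.1 ∧ p.1 < p.2 ∧ p.2 ≤ e - 1 ∧ p.2 - p.1 < e - σ} ⊆ T :=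
      fun p hp => ⟨hp.1, hp.2.1, by linarith [hp.2.2.1], hp.2.2.2⟩
    have i3 : ∀ p : ℝ × ℝ, p ∈ {p : ℝ × ℝ | σ ≤ p.1 ∧ p.1 < p.2 ∧ p.2 ≤ e - 1 ∧ p.2 - p.1 < e - σ} → (p.1 + 1, p.2 + 1) ∈ T :=
      fun p hp => ⟨by linarith [hp.1], by linarith [hp.2.1], by linarith [hp.2.2.1], by linarith [hp.2.2.2]⟩
    have i4 : ∀ p ∈ {p : ℝ × ℝ | σ ≤ p.1 ∧ p.1 < p.2 ∧ p.2 ≤ e - 1 ∧ p.2 - p.1 < e - σ}, X p.1 ≠ X p.2 :=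
      fun p hp => hinj2 _ _ hp.1 hp.2.1 (by linarith [hp.2.2.1]) hp.2.2.2
    refine log_sub_const (convex_tri σ (e - 1) (e - σ)).isPreconnected (d := fun p : ℝ × ℝ => Λ (p.1 + 1, p.2 + 1))
      (e := fun p => Λ p + L (X p.2) (X p.1)) (Λc.comp (by fun_prop) i3)
      ((Λc.mono i2).add (Lcont _ i4)) ?_ hp hq
    intro p hp
    rw [Complex.exp_add, Λe _ (i2 hp), Λe _ (i3 p hp), sh p (i4 p hp), mul_comm]
  -- closing up
  have c4 : ∀ p q : ℝ, p ∈ Set.Ioo σ e → q ∈ Set.Ioo σ e → Λ (p, e) - Λ (σ, p) = Λ (q, e) - Λ (σ, q) := by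
    intro p q hp hq
    have i1 : ∀ p ∈ Set.Ioo σ e, (p, e) ∈ T := fun p hp => ⟨hp.1.le, hp.2, le_rfl, by simpa using hp.1⟩
    have i2 : ∀ p ∈ Set.Ioo σ e, (σ, p) ∈ T := fun p hp => ⟨le_rfl, hp.1, hp.2.le, by simpa using hp.2⟩
    refine exp_one_const (d := fun p => Λ (p, e) - Λ (σ, p) - Real.pi * Complex.I) (convex_Ioo σ e).isPreconnected ?_ ?_ hp hq |> sub_left_injective
    · exact ((Λc.comp (f := fun p : ℝ => (p, e)) (by fun_prop) i1).sub (Λc.comp (f := fun p : ℝ => (σ, p)) (by fun_prop) i2)).sub continuousOn_const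
    · intro p hp
      have : X p - X σ ≠ 0 := sub_ne_zero.mpr (hinj _ _ le_rfl hp.1 hp.2).symm
      rw [Complex.exp_sub, Complex.exp_sub, Λe _ (i1 p hp), Λe _ (i2 p hp), Complex.exp_pi_mul_I, he]
      field_simp
      ring
  have c4e : Complex.exp (Λ (e - 1, e) - Λ (σ, e - 1)) = -1 := by
    rw [Complex.exp_sub, Λe _ ⟨by linarith, by linarith, le_rfl, by linarith⟩, Λe _ ⟨by linarith, by linarith, by linarith, by linarith⟩]
    have : X (e - 1) - X σ ≠ 0 := sub_ne_zero.mpr (hinj _ _ le_rfl (by linarith) (by linarith)).symm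
    simp only [he]
    field_simp
    ring
  have c5 : D e - M (e, e + 1) = D σ - M (σ, σ + 1) := by
    have i1 : ∀ p ∈ Set.Icc σ e, (p, p + 1) ∈ S := fun p hp => ⟨hp.1, by simp, by simpa using hp.2, by simp⟩
    refine log_sub_const (convex_Icc σ e).isPreconnected hD (e := fun t => M (t, t + 1))
      (Mc.comp (f := fun p : ℝ => (p, p + 1)) (by fun_prop) i1) ?_ ⟨by linarith, le_rfl⟩ ⟨le_rfl, by linarith⟩
    intro t ht
    rw [hDe t ht, Me _ (i1 t ht)]
  intro hcon
  obtain ⟨η, hη0, hη1, hη2⟩ : ∃ η : ℝ, 0 < η ∧ η ≤ 1 ∧ η < e - 1 - σ :=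
    ⟨min 1 ((e - 1 - σ)/2), lt_min one_pos (by linarith), min_le_left _ _, lt_of_le_of_lt (min_le_right _ _) (by linarith)⟩
  have d1 := c2 (e - 1, e) (σ, σ + η) ⟨by simp; linarith, by simp, by simp, by simp⟩ ⟨by simp, by simpa, by simp; linarith, by simpa⟩
  have d2 := c3 (σ, e - 1) (σ, σ + η) ⟨by simp, by simp; linarith, by simp, by simp⟩ ⟨by simp, by simpa, by simp; linarith, by simp; linarith⟩
  have d3 := c1 (σ, σ + η) (σ + 1, σ + η + 1) ⟨by simp, by simpa, by simp; linarith, by simpa⟩ ⟨by simp, by simp; linarith, by simp; linarith, by simp; linarith⟩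
  have d4 := c1 (e - 1, e) (σ, σ + 1) ⟨by simp; linarith, by simp, by simp, by simp⟩ ⟨by simp, by simp, by simp; linarith, by simp⟩
  have d4' := c1 (σ, σ + η) (σ, σ + 1) ⟨by simp, by simpa, by simp; linarith, by simpa⟩ ⟨by simp, by simp, by simp; linarith, by simp⟩
  have d5 := c4 (e - 1) (σ + 1) ⟨by linarith, by linarith⟩ ⟨by linarith, by linarith⟩
  have d6 := Ls (X σ) (X (e - 1)) (hinj _ _ le_rfl (by linarith) (by linarith))
  simp only [sub_add_cancel, he] at d1 d2 d3 d4 d5 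
  have : Λ (e - 1, e) - Λ (σ, e - 1) = 0 := by
    linear_combination (1/2) * (hcon - c5 - d1 + d2 - d3 + d4 + d5 - d6)
  rw [this] at c4e
  norm_num at c4e

end SphRec

namespace SphRec

/-- No nonempty compact relatively open subset. -/
def NoCpt (K : Set ℂ) : Prop := ∀ S U : Set ℂ, IsOpen U → S = K ∩ U → IsCompact S → S = ∅

/-- the nonvanishing function `g` on the interval has a logarithm that closes up -/
def Closes (σ e : ℝ) (g : ℝ → ℂ) : Prop := ∃ D : ℝ → ℂ, ContinuousOn D (Set.Icc σ e) ∧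
  (∀ t ∈ Set.Icc σ e, Complex.exp (D t) = g t) ∧ D e = D σ

theorem log_div_of_re_pos {a b u : ℂ} (ha : 0 < (a / u).re) (hb : 0 < (b / u).re) :
    Complex.log (b / a) = Complex.log (b / u) - Complex.log (a / u) := by
  have hu : u ≠ 0 := by rintro rfl; simp at ha
  have ha0 : a ≠ 0 := by rintro rfl; simp at ha
  have hb0 : b ≠ 0 := by rintro rfl; simp at hb
  have h1 : b / a = Complex.exp (Complex.log (b / u) - Complex.log (a / u)) := by
    rw [Complex.exp_sub, Complex.exp_log (div_ne_zero hb0 hu), Complex.exp_log (div_ne_zero ha0 hu)]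
    field_simp
  have k1 := abs_lt.mp (Complex.abs_arg_lt_pi_div_two_iff.mpr (Or.inl ha))
  have k2 := abs_lt.mp (Complex.abs_arg_lt_pi_div_two_iff.mpr (Or.inl hb))
  rw [h1, Complex.log_exp]
  · simp [Complex.log_im]; linarith
  · simp [Complex.log_im]; linarith

theorem re_pos_of_norm_sub_lt {a u : ℂ} (h : ‖a - u‖ < ‖u‖) : 0 < (a / u).re := by
  have hu : u ≠ 0 := by rintro rfl; simp at h; linarith [norm_nonneg a]
  have h1 : ‖a / u - 1‖ < 1 := by
    have : a / u - 1 = (a - u) / u := by field_simp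
    rw [this, norm_div, div_lt_one (norm_pos_iff.mpr hu)]
    exact h
  have := (Complex.abs_re_le_norm (a / u - 1))
  have h2 := abs_lt.mp (lt_of_le_of_lt this h1)
  simp at h2
  linarith [h2.1]

theorem grid_potential (n : ℕ) (H V : ℕ → ℕ → ℂ)
    (hc : ∀ i < n, ∀ j < n, H i j + V (i + 1) j - H i (j + 1) - V i j = 0) :
    ∃ ψ : ℕ → ℕ → ℂ, (∀ i < n, ∀ j ≤ n, ψ (i + 1) j - ψ i j = H i j) ∧
      (∀ i ≤ n, ∀ j < n, ψ i (j + 1) - ψ i j = V i j) := by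
  refine ⟨fun i j => ∑ i' ∈ Finset.range i, H i' 0 + ∑ j' ∈ Finset.range j, V i j', ?_, ?_⟩
  · intro i hi j hj
    induction j with
    | zero => simp [Finset.sum_range_succ]
    | succ j ih =>
      have h1 := ih (by omega)
      have h2 := hc i hi j (by omega)
      simp only [Finset.sum_range_succ] at h1 ⊢
      linear_combination h1 + h2
  · intro i hi j hj
    simp only [Finset.sum_range_succ]
    ring

theorem closes_near {γ : ℝ → ℂ} {σ e : ℝ} (hγ : Continuous γ) (hloop : γ e = γ σ) {c c0 : ℂ}
    (hn : ∀ t ∈ Set.Icc σ e, ‖c - c0‖ < ‖γ t - c0‖) (h0 : Closes σ e (fun t => γ t - c0)) :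
    Closes σ e (fun t => γ t - c) := by
  obtain ⟨D, hD, hDe, hD1⟩ := h0
  have hre : ∀ t ∈ Set.Icc σ e, 0 < ((γ t - c) / (γ t - c0)).re := fun t ht => 
    re_pos_of_norm_sub_lt (by
      have : γ t - c - (γ t - c0) = -(c - c0) := by ring
      rw [this, norm_neg]; exact hn t ht)
  have hz : ∀ t ∈ Set.Icc σ e, γ t - c0 ≠ 0 := fun t ht => norm_pos_iff.mp ((norm_nonneg _).trans_lt (hn t ht))
  refine ⟨fun t => D t + Complex.log ((γ t - c) / (γ t - c0)), ?_, ?_, ?_⟩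
  · refine hD.add (ContinuousOn.clog (ContinuousOn.div (by fun_prop) (by fun_prop) hz) fun t ht => Or.inl (hre t ht))
  · intro t ht
    have h3 : (γ t - c) / (γ t - c0) ≠ 0 := fun h => by have := hre t ht; rw [h] at this; simp at this
    rw [Complex.exp_add, hDe t ht, Complex.exp_log h3]
    field_simp [hz t ht]
  · simp [hD1, hloop]

theorem closes_far {γ : ℝ → ℂ} {σ e : ℝ} (hγ : Continuous γ) (hloop : γ e = γ σ) {c : ℂ}
    (hn : ∀ t ∈ Set.Icc σ e, ‖γ t‖ < ‖c‖) : 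
    Closes σ e (fun t => γ t - c) := by
  rcases Set.eq_empty_or_nonempty (Set.Icc σ e) with h | ⟨t0, ht0⟩
  · exact ⟨fun _ => 0, by simp [h], by simp [h], rfl⟩
  have hc : c ≠ 0 := norm_pos_iff.mp ((norm_nonneg _).trans_lt (hn t0 ht0))
  have hre : ∀ t ∈ Set.Icc σ e, 0 < ((γ t - c) / (-c)).re := fun t ht => 
    re_pos_of_norm_sub_lt (by simpa using hn t ht)
  refine ⟨fun t => Complex.log (-c) + Complex.log ((γ t - c) / (-c)), ?_, ?_, ?_⟩
  · exact continuousOn_const.add (ContinuousOn.clog (ContinuousOn.div (by fun_prop) (by fun_prop) (by simp [hc])) fun t ht => Or.inl (hre t ht))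
  · intro t ht
    have h3 : (γ t - c) / (-c) ≠ 0 := fun h => by have := hre t ht; rw [h] at this; simp at this
    rw [Complex.exp_add, Complex.exp_log (neg_ne_zero.mpr hc), Complex.exp_log h3]
    field_simp
  · simp [hloop]

theorem closes_on_K {K : Set ℂ} (hK : IsClosed K) (hN : NoCpt K) {γ : ℝ → ℂ} {σ e : ℝ} (hγ : Continuous γ)
    (hloop : γ e = γ σ) (hd : ∀ t ∈ Set.Icc σ e, γ t ∉ K) :
    ∀ c ∈ K, Closes σ e (fun t => γ t - c) := by
  rcases Set.eq_empty_or_nonempty (Set.Icc σ e) with h | hne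
  · intro c _; exact ⟨fun _ => 0, by simp [h], by simp [h], rfl⟩
  have hcomp : IsCompact (γ '' Set.Icc σ e) := isCompact_Icc.image hγ
  set C := γ '' Set.Icc σ e
  have hCn : C.Nonempty := hne.image _
  have hpos : ∀ c, c ∉ C → 0 < infDist c C := fun c hc => (hcomp.isClosed.notMem_iff_infDist_pos hCn).mp hc
  have hle : ∀ c, ∀ t ∈ Set.Icc σ e, infDist c C ≤ ‖γ t - c‖ := fun c t ht => by
    rw [← dist_eq_norm, dist_comm]; exact infDist_le_dist_of_mem ⟨t, ht, rfl⟩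
  obtain ⟨R, hR⟩ := hcomp.isBounded.exists_norm_le
  set U : Set ℂ := {c | c ∉ C ∧ ¬ Closes σ e (fun t => γ t - c)}
  set W : Set ℂ := {c | c ∉ C ∧ Closes σ e (fun t => γ t - c)}
  have hU : IsOpen U := by
    rw [Metric.isOpen_iff]
    rintro c ⟨hc, hnc⟩
    refine ⟨infDist c C / 2, by linarith [hpos c hc], fun c' hc' => ?_⟩
    have h1 : ∀ t ∈ Set.Icc σ e, ‖c - c'‖ < ‖γ t - c'‖ := by
      intro t ht
      have h2 := hle c t ht
      have h3 : ‖γ t - c‖ ≤ ‖γ t - c'‖ + ‖c' - c‖ := norm_sub_le_norm_sub_add_norm_sub _ _ _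
      rw [mem_ball, dist_eq_norm] at hc'
      rw [norm_sub_rev]; linarith
    refine ⟨?_, fun hcl => hnc (closes_near hγ hloop h1 hcl)⟩
    rintro ⟨t, ht, rfl⟩
    have := h1 t ht
    simp at this; linarith [norm_nonneg (c - γ t)]
  have hW : IsOpen W := by
    rw [Metric.isOpen_iff]
    rintro c ⟨hc, hnc⟩
    refine ⟨infDist c C, hpos c hc, fun c' hc' => ?_⟩
    rw [mem_ball, dist_eq_norm] at hc'
    have h1 : ∀ t ∈ Set.Icc σ e, ‖c' - c‖ < ‖γ t - c‖ := fun t ht => hc'.trans_le (hle c t ht)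
    refine ⟨?_, closes_near hγ hloop h1 hnc⟩
    rintro ⟨t, ht, rfl⟩
    exact lt_irrefl _ (h1 t ht)
  have hKC : ∀ c ∈ K, c ∉ C := by
    rintro c hc ⟨t, ht, rfl⟩; exact hd t ht hc
  have hS : K ∩ U = ∅ := by
    refine hN _ U hU rfl ?_
    have : K ∩ U = K \ W := by
      ext c
      constructor
      · rintro ⟨h1, h2⟩; exact ⟨h1, fun h => h2.2 h.2⟩
      · rintro ⟨h1, h2⟩; exact ⟨h1, hKC c h1, fun h => h2 ⟨hKC c h1, h⟩⟩
    rw [Metric.isCompact_iff_isClosed_bounded]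
    constructor
    · rw [this]; exact hK.sdiff hW
    · refine (isBounded_closedBall (x := (0:ℂ)) (r := R)).subset ?_
      rintro c ⟨-, hc⟩
      by_contra hcon
      simp only [mem_closedBall, dist_zero_right, not_le] at hcon
      exact hc.2 (closes_far hγ hloop (fun t ht => (hR _ ⟨t, ht, rfl⟩).trans_lt hcon))
  intro c hc
  by_contra hcon
  have : c ∈ K ∩ U := ⟨hc, hKC c hc, hcon⟩
  rw [hS] at this; exact this

end SphRec

namespace SphRec

/-- lattice points -/
noncomputable def LP (a δ : ℝ) (i j : ℝ) : ℂ := ⟨-a + δ * i, -a + δ * j⟩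

/-- principal curl around a cell for lattice function w -/
noncomputable def pcurl (w00 w10 w11 w01 : ℂ) : ℂ :=
  Complex.log (w10 / w00) + Complex.log (w11 / w10) - Complex.log (w11 / w01) - Complex.log (w01 / w00)

theorem pcurl_zero {u w00 w10 w11 w01 : ℂ} (h1 : 0 < (w00 / u).re) (h2 : 0 < (w10 / u).re)
    (h3 : 0 < (w11 / u).re) (h4 : 0 < (w01 / u).re) : pcurl w00 w10 w11 w01 = 0 := by
  unfold pcurl
  rw [log_div_of_re_pos h1 h2, log_div_of_re_pos h2 h3, log_div_of_re_pos h4 h3, log_div_of_re_pos h1 h4]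
  ring

theorem pcurl_int {w00 w10 w11 w01 : ℂ} (h1 : w00 ≠ 0) (h2 : w10 ≠ 0)
    (h3 : w11 ≠ 0) (h4 : w01 ≠ 0) : ∃ k : ℤ, pcurl w00 w10 w11 w01 = k * (2 * Real.pi * Complex.I) := by
  apply Complex.exp_eq_one_iff.mp
  unfold pcurl
  rw [Complex.exp_sub, Complex.exp_sub, Complex.exp_add, Complex.exp_log (div_ne_zero h2 h1),
    Complex.exp_log (div_ne_zero h3 h2), Complex.exp_log (div_ne_zero h3 h4), Complex.exp_log (div_ne_zero h4 h1)]
  field_simp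

theorem LP_sub_half_ne (a δ : ℝ) (hδ : 0 < δ) (i j p q : ℕ) : LP a δ i j - LP a δ (p + 1/2) (q + 1/2) ≠ 0 := by
  intro h
  have := congrArg Complex.re h
  simp [LP] at this
  have h3 : (i : ℝ) = p + 1/2 := by
    have : δ * ((i:ℝ) - (p + 1/2)) = 0 := by linarith
    have := (mul_eq_zero.mp this).resolve_left hδ.ne'
    linarith
  have h4 : (2 * i : ℝ) = 2 * p + 1 := by linarith
  have h5 : 2 * i = 2 * p + 1 := by exact_mod_cast h4
  omega

theorem pcurl_center (a δ : ℝ) (hδ : 0 < δ) (i j p q : ℕ) :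
    pcurl (LP a δ i j - LP a δ (p + 1/2) (q + 1/2)) (LP a δ (i+1) j - LP a δ (p + 1/2) (q + 1/2))
      (LP a δ (i+1) (j+1) - LP a δ (p + 1/2) (q + 1/2)) (LP a δ i (j+1) - LP a δ (p + 1/2) (q + 1/2))
      = if (p, q) = (i, j) then 2 * Real.pi * Complex.I else 0 := by
  split_ifs with h
  · simp only [Prod.mk.injEq] at h
    obtain ⟨rfl, rfl⟩ := h
    have e : ∀ s t : ℝ, LP a δ (p + s) (q + t) - LP a δ (p + 1/2) (q + 1/2) = (δ/2 : ℝ) * ⟨2 * s - 1, 2 * t - 1⟩ := by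
      intro s t
      apply Complex.ext
      · simp [LP]; ring
      · simp [LP]; ring
    have e00 := e 0 0
    have e10 := e 1 0
    have e01 := e 0 1
    have e11 := e 1 1
    rw [add_zero, add_zero] at e00
    rw [add_zero] at e10 e01
    rw [e00, e10, e01, e11]
    have hd : ((δ/2 : ℝ) : ℂ) ≠ 0 := by exact_mod_cast (by positivity)
    unfold pcurl
    simp only [mul_div_mul_left _ _ hd]
    norm_num
    have n1 : (⟨-1, -1⟩ : ℂ) ≠ 0 := fun h => by simpa using congrArg Complex.re h
    have n2 : (⟨1, -1⟩ : ℂ) ≠ 0 := fun h => by simpa using congrArg Complex.re h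
    have n3 : (⟨-1, 1⟩ : ℂ) ≠ 0 := fun h => by simpa using congrArg Complex.re h
    have i1 : (⟨1, -1⟩ : ℂ) / ⟨-1, -1⟩ = Complex.I := by
      rw [div_eq_iff n1]; apply Complex.ext <;> simp
    have i2 : (⟨1, 1⟩ : ℂ) / ⟨1, -1⟩ = Complex.I := by
      rw [div_eq_iff n2]; apply Complex.ext <;> simp
    have i3 : (⟨1, 1⟩ : ℂ) / ⟨-1, 1⟩ = -Complex.I := by
      rw [div_eq_iff n3]; apply Complex.ext <;> simp
    have i4 : (⟨-1, 1⟩ : ℂ) / ⟨-1, -1⟩ = -Complex.I := by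
      rw [div_eq_iff n1]; apply Complex.ext <;> simp
    rw [i1, i2, i3, i4, Complex.log_I, Complex.log_neg_I]
    ring
  · have key : (p < i ∨ i < p) ∨ (q < j ∨ j < q) := by
      by_contra hcon
      push Not at hcon
      exact h (by ext <;> simp <;> omega)
    have re1 : ∀ s t : ℝ, (LP a δ s t - LP a δ (p + 1/2) (q + 1/2)).re = δ * (s - p - 1/2) := by
      intro s t; simp [LP]; ring
    have im1 : ∀ s t : ℝ, (LP a δ s t - LP a δ (p + 1/2) (q + 1/2)).im = δ * (t - q - 1/2) := by
      intro s t; simp [LP]; ring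
    have dI : ∀ z : ℂ, (z / Complex.I).re = z.im := by intro z; simp [Complex.div_I]
    have dI' : ∀ z : ℂ, (z / -Complex.I).re = -z.im := by intro z; simp [div_neg, Complex.div_I]
    rcases key with (hk | hk) | (hk | hk)
    · have : (p : ℝ) + 1 ≤ i := by exact_mod_cast hk
      apply pcurl_zero (u := 1) <;> rw [div_one, re1] <;> apply mul_pos hδ <;> linarith
    · have : (i : ℝ) + 1 ≤ p := by exact_mod_cast hk
      apply pcurl_zero (u := -1) <;> rw [div_neg, div_one, Complex.neg_re, re1, ← mul_neg] <;> apply mul_pos hδ <;> linarith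
    · have : (q : ℝ) + 1 ≤ j := by exact_mod_cast hk
      apply pcurl_zero (u := Complex.I) <;> rw [dI, im1] <;> apply mul_pos hδ <;> linarith
    · have : (j : ℝ) + 1 ≤ q := by exact_mod_cast hk
      apply pcurl_zero (u := -Complex.I) <;> rw [dI', im1, ← mul_neg] <;> apply mul_pos hδ <;> linarith

theorem log_eventually {D : ℝ → ℂ} {g : ℝ → ℂ} {s : Set ℝ} (hD : ContinuousOn D s) 
    (hDe : ∀ t ∈ s, Complex.exp (D t) = g t) {t0 : ℝ} (ht0 : t0 ∈ s) :
    ∀ᶠ t in 𝓝[s] t0, D t - D t0 = Complex.log (g t / g t0) := by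
  have h1 : Tendsto (fun t => (D t - D t0).im) (𝓝[s] t0) (𝓝 0) := by
    have : Tendsto (fun t => (D t - D t0).im) (𝓝[s] t0) (𝓝 (D t0 - D t0).im) :=
      (Complex.continuous_im.tendsto _).comp ((hD t0 ht0).sub_const _)
    simpa using this
  have h2 := h1.eventually (Ioo_mem_nhds (by linarith [Real.pi_pos] : -Real.pi < 0) Real.pi_pos)
  filter_upwards [h2, self_mem_nhdsWithin] with t ht hts
  rw [← hDe t hts, ← hDe t0 ht0, ← Complex.exp_sub, Complex.log_exp ht.1 ht.2.le]

theorem const_of_eventually {G : ℝ → ℂ} {σ e : ℝ} (hσ : σ ≤ e) (h : ∀ t0 ∈ Set.Icc σ e, ∀ᶠ t in 𝓝[Set.Icc σ e] t0, G t = G t0) :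
    G e = G σ := by
  have hl : IsLocallyConstant (fun t : Set.Icc σ e => G t) := by
    rw [IsLocallyConstant.iff_eventually_eq]
    intro x
    have := h x x.2
    rw [nhdsWithin_eq_map_subtype_coe x.2] at this
    exact this
  have : PreconnectedSpace (Set.Icc σ e) := Subtype.preconnectedSpace isPreconnected_Icc
  exact hl.apply_eq_of_isPreconnected isPreconnected_univ (x := ⟨e, hσ, le_rfl⟩) (y := ⟨σ, le_rfl, hσ⟩) trivial trivial

end SphRec

namespace SphRec

theorem LP_norm_sub (a δ : ℝ) (hδ : 0 < δ) (s t s' t' : ℝ) : ‖LP a δ s t - LP a δ s' t'‖ ≤ δ * (|s - s'| + |t - t'|) := by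
  have h1 : (LP a δ s t - LP a δ s' t').re = δ * (s - s') := by simp [LP]; ring
  have h2 : (LP a δ s t - LP a δ s' t').im = δ * (t - t') := by simp [LP]; ring
  refine (Complex.norm_le_abs_re_add_abs_im _).trans ?_
  rw [h1, h2, abs_mul, abs_mul, abs_of_pos hδ]; linarith

theorem G_lemma {K : Set ℂ} (hK : IsClosed K) (hN : NoCpt K) {v : ℂ → ℂ} (hv : Continuous v)
    (hv0 : ∀ z, z ∉ K → v z ≠ 0) {γ : ℝ → ℂ} (hγ : Continuous γ) {σ e : ℝ} (hσ : σ ≤ e)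
    (hloop : γ e = γ σ) (hd : ∀ t ∈ Set.Icc σ e, γ t ∉ K) {D : ℝ → ℂ}
    (hD : ContinuousOn D (Set.Icc σ e)) (hDe : ∀ t ∈ Set.Icc σ e, Complex.exp (D t) = v (γ t)) :
    D e = D σ := by
  have hcomp : IsCompact (γ '' Set.Icc σ e) := isCompact_Icc.image hγ
  -- distance to K
  obtain ⟨d, hd0, hd4⟩ : ∃ d > 0, ∀ t ∈ Set.Icc σ e, ∀ k ∈ K, 4 * d ≤ ‖γ t - k‖ := by
    obtain ⟨d, hd0, hd1⟩ := hcomp.exists_thickening_subset_open hK.isOpen_compl (by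
      rintro _ ⟨t, ht, rfl⟩; exact hd t ht)
    refine ⟨d / 4, by positivity, fun t ht k hk => ?_⟩
    by_contra hcon
    push Not at hcon
    refine hd1 (?_ : k ∈ thickening d _) hk
    rw [mem_thickening_iff]
    exact ⟨_, ⟨t, ht, rfl⟩, by rw [dist_comm, dist_eq_norm]; linarith⟩
  obtain ⟨a, ha0, haγ⟩ : ∃ a > 0, ∀ t ∈ Set.Icc σ e, ‖γ t‖ < a := by
    obtain ⟨R, hR⟩ := hcomp.isBounded.exists_norm_le
    exact ⟨max R 0 + 1, by positivity, fun t ht => by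
      have := hR _ ⟨t, ht, rfl⟩
      have := le_max_left R 0
      linarith⟩
  -- lower bound for v
  obtain ⟨m, hm0, hm⟩ : ∃ m > 0, ∀ z : ℂ, ‖z‖ ≤ 2 * a → (∀ k ∈ K, d / 2 ≤ ‖z - k‖) → m ≤ ‖v z‖ := by
    have hcl : IsClosed {z : ℂ | ∀ k ∈ K, d / 2 ≤ ‖z - k‖} := by
      have : {z : ℂ | ∀ k ∈ K, d / 2 ≤ ‖z - k‖} = ⋂ k ∈ K, {z : ℂ | d / 2 ≤ ‖z - k‖} := by ext; simp
      rw [this]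
      exact isClosed_biInter fun k _ => isClosed_le continuous_const (by fun_prop)
    have hc := (isCompact_closedBall (0:ℂ) (2 * a)).inter_right hcl
    rcases Set.eq_empty_or_nonempty (closedBall (0:ℂ) (2 * a) ∩ {z : ℂ | ∀ k ∈ K, d / 2 ≤ ‖z - k‖}) with he | hne
    · refine ⟨1, one_pos, fun z hz hk => ?_⟩
      have : z ∈ (∅ : Set ℂ) := he ▸ ⟨by simpa using hz, hk⟩
      exact this.elim
    · obtain ⟨z0, hz0, hmin⟩ := hc.exists_isMinOn hne hv.norm.continuousOn
      refine ⟨‖v z0‖, norm_pos_iff.mpr (hv0 z0 fun h => ?_), fun z hz hk => hmin ⟨by simpa using hz, hk⟩⟩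
      have := hz0.2 z0 h
      simp at this; linarith
  obtain ⟨η, hη0, hη⟩ : ∃ η > 0, ∀ x y : ℂ, ‖x‖ ≤ 2 * a → ‖y‖ ≤ 2 * a → ‖x - y‖ < η → ‖v x - v y‖ < m := by
    have := (isCompact_closedBall (0:ℂ) (2 * a)).uniformContinuousOn_of_continuous hv.continuousOn
    rw [Metric.uniformContinuousOn_iff] at this
    obtain ⟨η, h1, h2⟩ := this m hm0
    refine ⟨η, h1, fun x y hx hy hxy => ?_⟩
    rw [← dist_eq_norm]
    exact h2 x (by simpa using hx) y (by simpa using hy) (by rwa [dist_eq_norm])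
  obtain ⟨n, hn0, hn⟩ : ∃ n : ℕ, 0 < n ∧ 2 * a / n < min (d / 3) (η / 3) := by
    obtain ⟨n, hn⟩ := exists_nat_gt (2 * a / min (d / 3) (η / 3))
    have hmin : 0 < min (d / 3) (η / 3) := by positivity
    have hn0 : (0:ℝ) < n := lt_trans (by positivity) hn
    refine ⟨n, by exact_mod_cast hn0, ?_⟩
    rw [div_lt_iff₀ hmin] at hn
    rw [div_lt_iff₀ hn0]; linarith
  set δ := 2 * a / n with hδ
  have hnr : (0:ℝ) < n := by exact_mod_cast hn0
  have hδ0 : 0 < δ := by positivity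
  have hδn : δ * n = 2 * a := by rw [hδ]; field_simp
  have hδd : 3 * δ < d := by have := hn.trans_le (min_le_left _ _); linarith
  have hδη : 3 * δ < η := by have := hn.trans_le (min_le_right _ _); linarith
  set P : ℕ → ℕ → ℂ := fun i j => LP a δ i j with hP
  set c : ℕ × ℕ → ℂ := fun Q => LP a δ (Q.1 + 1/2) (Q.2 + 1/2) with hc
  have hPn : ∀ i ≤ n, ∀ j ≤ n, ‖P i j‖ ≤ 2 * a := by
    intro i hi j hj
    have hi' : (i:ℝ) ≤ n := by exact_mod_cast hi
    have hj' : (j:ℝ) ≤ n := by exact_mod_cast hj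
    have hi0 : (0:ℝ) ≤ i := Nat.cast_nonneg _
    have hj0 : (0:ℝ) ≤ j := Nat.cast_nonneg _
    refine (Complex.norm_le_abs_re_add_abs_im _).trans ?_
    have h1 : |(P i j).re| ≤ a := by simp only [hP, LP]; rw [abs_le]; constructor <;> nlinarith
    have h2 : |(P i j).im| ≤ a := by simp only [hP, LP]; rw [abs_le]; constructor <;> nlinarith
    linarith
  -- the modified function
  set w : ℂ → ℂ := fun z => if v z = 0 then 1 else v z with hw
  have hw0 : ∀ z, w z ≠ 0 := by intro z; simp only [hw]; split_ifs with h <;> simp [h]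
  have hwv : ∀ z, v z ≠ 0 → w z = v z := by intro z hz; simp [hw, hz]
  have hk : ∀ Q : ℕ × ℕ, ∃ k : ℤ, pcurl (w (P Q.1 Q.2)) (w (P (Q.1+1) Q.2)) (w (P (Q.1+1) (Q.2+1))) (w (P Q.1 (Q.2+1))) = k * (2 * Real.pi * Complex.I) :=
    fun Q => pcurl_int (hw0 _) (hw0 _) (hw0 _) (hw0 _)
  choose k hk using hk
  have cP : ∀ (Q : ℕ × ℕ) (s t : ℕ), s ≤ 1 → t ≤ 1 → ‖P (Q.1 + s) (Q.2 + t) - c Q‖ ≤ δ := by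
    intro Q s t hs ht
    refine (LP_norm_sub a δ hδ0 _ _ _ _).trans ?_
    have h1 : |((Q.1 + s : ℕ) : ℝ) - (Q.1 + 1/2)| ≤ 1/2 := by
      interval_cases s <;> simp [abs_le] <;> norm_num
    have h2 : |((Q.2 + t : ℕ) : ℝ) - (Q.2 + 1/2)| ≤ 1/2 := by
      interval_cases t <;> simp [abs_le] <;> norm_num
    nlinarith
  -- good cells have zero curl
  have hgood : ∀ Q : ℕ × ℕ, Q.1 < n → Q.2 < n → k Q ≠ 0 → ∃ κ ∈ K, ‖c Q - κ‖ < d := by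
    intro Q hQ1 hQ2 hkQ
    by_contra hcon
    push Not at hcon
    have g1 : ∀ s t : ℕ, s ≤ 1 → t ≤ 1 → m ≤ ‖v (P (Q.1 + s) (Q.2 + t))‖ := by
      intro s t hs ht
      refine hm _ (hPn _ (by omega) _ (by omega)) fun κ hκ => ?_
      have h1 := hcon κ hκ
      have h2 := cP Q s t hs ht
      have h3 : ‖c Q - κ‖ ≤ ‖c Q - P (Q.1 + s) (Q.2 + t)‖ + ‖P (Q.1 + s) (Q.2 + t) - κ‖ := norm_sub_le_norm_sub_add_norm_sub _ _ _
      rw [norm_sub_rev] at h2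
      linarith
    have g2 : ∀ s t : ℕ, s ≤ 1 → t ≤ 1 → w (P (Q.1 + s) (Q.2 + t)) = v (P (Q.1 + s) (Q.2 + t)) := fun s t hs ht =>
      hwv _ (norm_pos_iff.mp (hm0.trans_le (g1 s t hs ht)))
    have g3 : ∀ s t : ℕ, s ≤ 1 → t ≤ 1 → 0 < (w (P (Q.1 + s) (Q.2 + t)) / v (P Q.1 Q.2)).re := by
      intro s t hs ht
      rw [g2 s t hs ht]
      refine re_pos_of_norm_sub_lt (lt_of_lt_of_le ?_ (g1 0 0 (by omega) (by omega)))
      refine hη _ _ (hPn _ (by omega) _ (by omega)) (hPn _ (by omega) _ (by omega)) ?_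
      have h2 := cP Q s t hs ht
      have h2' := cP Q 0 0 (by omega) (by omega)
      have h3 := norm_sub_le_norm_sub_add_norm_sub (P (Q.1 + s) (Q.2 + t)) (c Q) (P Q.1 Q.2)
      rw [norm_sub_rev] at h2'
      simp only [add_zero] at h2'
      linarith
    have := pcurl_zero (g3 0 0 (by omega) (by omega)) (g3 1 0 (by omega) (by omega)) (g3 1 1 (by omega) (by omega)) (g3 0 1 (by omega) (by omega))
    simp only [add_zero] at this
    rw [hk Q] at this
    have h5 : (2 * Real.pi * Complex.I : ℂ) ≠ 0 := Complex.two_pi_I_ne_zero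
    simp [h5, hkQ] at this
  set B := Finset.range n ×ˢ Finset.range n with hB
  have hBn : ∀ Q ∈ B, Q.1 < n ∧ Q.2 < n := by intro Q hQ; simpa [hB] using hQ
  -- generic cochain
  set coch : ℂ → ℂ → ℂ := fun x y => Complex.log (w y / w x) - ∑ Q ∈ B, k Q * Complex.log ((y - c Q) / (x - c Q)) with hcoch
  obtain ⟨ψ, ψH, ψV⟩ := grid_potential n (fun i j => coch (P i j) (P (i+1) j)) (fun i j => coch (P i j) (P i (j+1))) (by
    intro i hi j hj
    have h1 := hk (i, j)
    have h2 : ∀ Q : ℕ × ℕ, _ := fun Q => pcurl_center a δ hδ0 i j Q.1 Q.2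
    simp only [pcurl] at h1 h2
    simp only [hcoch]
    have h3 : ∑ Q ∈ B, (k Q : ℂ) * (if (Q.1, Q.2) = (i, j) then 2 * Real.pi * Complex.I else 0) = k (i, j) * (2 * Real.pi * Complex.I) := by
      rw [Finset.sum_eq_single (i, j)]
      · simp
      · intro Q _ hQ; rw [if_neg (by simpa using hQ)]; simp
      · intro hQ; exact absurd (by simp [hB, hi, hj]) hQ
    simp only [← h2, mul_sub, mul_add, Finset.sum_add_distrib, Finset.sum_sub_distrib] at h3
    simp only [hP, hc, Nat.cast_add, Nat.cast_one] at h1 h3 ⊢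
    linear_combination h1 - h3)
  -- logs around bad centers
  have hcl : ∀ Q : ℕ × ℕ, ∃ DQ : ℝ → ℂ, Q ∈ B → k Q ≠ 0 → (ContinuousOn DQ (Set.Icc σ e) ∧
      (∀ t ∈ Set.Icc σ e, Complex.exp (DQ t) = γ t - c Q) ∧ DQ e = DQ σ) := by
    intro Q
    by_cases hQ : Q ∈ B ∧ k Q ≠ 0
    · obtain ⟨κ, hκ, hκ2⟩ := hgood Q (hBn Q hQ.1).1 (hBn Q hQ.1).2 hQ.2
      obtain ⟨DQ, h⟩ := closes_near hγ hloop (c := c Q) (c0 := κ) (fun t ht => hκ2.trans_le (by linarith [hd4 t ht κ hκ]))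
        (closes_on_K hK hN hγ hloop hd κ hκ)
      exact ⟨DQ, fun _ _ => h⟩
    · exact ⟨0, fun h1 h2 => absurd ⟨h1, h2⟩ hQ⟩
  choose DQ hDQ using hcl
  -- half plane facts
  have va : ∀ t ∈ Set.Icc σ e, ∀ x, ‖x‖ ≤ 2 * a → ‖x - γ t‖ < 3 * δ → 0 < (w x / w (γ t)).re := by
    intro t ht x hx hxt
    have h0 : m ≤ ‖v (γ t)‖ := hm _ (by linarith [haγ t ht]) (fun κ hκ => by linarith [hd4 t ht κ hκ])
    have h1 : ‖v x - v (γ t)‖ < ‖v (γ t)‖ := (hη _ _ hx (by linarith [haγ t ht]) (by linarith)).trans_le h0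
    have h2 := re_pos_of_norm_sub_lt h1
    rw [hwv (γ t) (norm_pos_iff.mp (hm0.trans_le h0)), hwv x (fun h => by rw [h] at h2; simp at h2)]
    exact h2
  have vc : ∀ t ∈ Set.Icc σ e, ∀ x, ‖x - γ t‖ < 3 * δ → ∀ Q ∈ B, k Q ≠ 0 → 0 < ((x - c Q) / (γ t - c Q)).re := by
    intro t ht x hxt Q hQ hkQ
    obtain ⟨κ, hκ, hκ2⟩ := hgood Q (hBn Q hQ).1 (hBn Q hQ).2 hkQ
    apply re_pos_of_norm_sub_lt
    have h1 := hd4 t ht κ hκ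
    have h2 := norm_sub_le_norm_sub_add_norm_sub (γ t) (c Q) κ
    have h3 : x - c Q - (γ t - c Q) = x - γ t := by ring
    rw [h3]; linarith
  have cadd : ∀ t ∈ Set.Icc σ e, ∀ x y, ‖x‖ ≤ 2 * a → ‖y‖ ≤ 2 * a → ‖x - γ t‖ < 3 * δ → ‖y - γ t‖ < 3 * δ →
      coch x y = coch (γ t) y - coch (γ t) x := by
    intro t ht x y hx hy hxt hyt
    simp only [hcoch]
    rw [log_div_of_re_pos (va t ht x hx hxt) (va t ht y hy hyt)]
    have : ∑ Q ∈ B, (k Q : ℂ) * Complex.log ((y - c Q) / (x - c Q)) = ∑ Q ∈ B, ((k Q : ℂ) * Complex.log ((y - c Q) / (γ t - c Q)) - k Q * Complex.log ((x - c Q) / (γ t - c Q))) := by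
      refine Finset.sum_congr rfl fun Q hQ => ?_
      by_cases hkQ : k Q = 0
      · simp [hkQ]
      · rw [log_div_of_re_pos (vc t ht x hxt Q hQ hkQ) (vc t ht y hyt Q hQ hkQ)]; ring
    rw [this, Finset.sum_sub_distrib]
    ring
  -- vertices near points of the curve
  set Nb : ℂ → ℕ → ℕ → Prop := fun z i j => i ≤ n ∧ j ≤ n ∧ |z.re + a - δ * i| < δ ∧ |z.im + a - δ * j| < δ with hNb
  have nbd : ∀ z i j, Nb z i j → ‖P i j - z‖ < 2 * δ := by
    intro z i j h
    refine (Complex.norm_le_abs_re_add_abs_im _).trans_lt ?_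
    have h1 : (P i j - z).re = -(z.re + a - δ * i) := by simp [hP, LP]; ring
    have h2 : (P i j - z).im = -(z.im + a - δ * j) := by simp [hP, LP]; ring
    rw [h1, h2, abs_neg, abs_neg]
    linarith [h.2.2.1, h.2.2.2]
  have nbex : ∀ t ∈ Set.Icc σ e, ∃ ij : ℕ × ℕ, Nb (γ t) ij.1 ij.2 := by
    intro t ht
    have fl : ∀ x : ℝ, |x| < a → ∃ i : ℕ, i ≤ n ∧ |x + a - δ * i| < δ := by
      intro x hx
      rw [abs_lt] at hx
      have hx0 : 0 ≤ (x + a) / δ := div_nonneg (by linarith) hδ0.le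
      refine ⟨⌊(x + a) / δ⌋₊, ?_, ?_⟩
      · have : (⌊(x + a) / δ⌋₊ : ℝ) ≤ n := (Nat.floor_le hx0).trans (by rw [div_le_iff₀ hδ0]; linarith)
        exact_mod_cast this
      · have h1 := Nat.floor_le hx0
        have h2 := Nat.lt_floor_add_one ((x + a) / δ)
        rw [le_div_iff₀ hδ0] at h1
        rw [div_lt_iff₀ hδ0] at h2
        rw [abs_lt]; constructor <;> nlinarith
    obtain ⟨i, hi, hi2⟩ := fl (γ t).re ((Complex.abs_re_le_norm _).trans_lt (haγ t ht))
    obtain ⟨j, hj, hj2⟩ := fl (γ t).im ((Complex.abs_im_le_norm _).trans_lt (haγ t ht))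
    exact ⟨(i, j), hi, hj, hi2, hj2⟩
  have nstep : ∀ t ∈ Set.Icc σ e, ∀ i j i' j', Nb (γ t) i j → Nb (γ t) i' j' →
      ψ i j - coch (γ t) (P i j) = ψ i' j' - coch (γ t) (P i' j') := by
    intro t ht
    have sH : ∀ i j, Nb (γ t) i j → Nb (γ t) (i + 1) j → ψ i j - coch (γ t) (P i j) = ψ (i+1) j - coch (γ t) (P (i+1) j) := by
      intro i j h1 h2
      have h3 := ψH i h2.1 j h1.2.1
      rw [cadd t ht _ _ (hPn _ h1.1 _ h1.2.1) (hPn _ h2.1 _ h2.2.1) (by linarith [nbd _ _ _ h1]) (by linarith [nbd _ _ _ h2])] at h3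
      linear_combination -h3
    have sV : ∀ i j, Nb (γ t) i j → Nb (γ t) i (j+1) → ψ i j - coch (γ t) (P i j) = ψ i (j+1) - coch (γ t) (P i (j+1)) := by
      intro i j h1 h2
      have h3 := ψV i h1.1 j h2.2.1
      rw [cadd t ht _ _ (hPn _ h1.1 _ h1.2.1) (hPn _ h2.1 _ h2.2.1) (by linarith [nbd _ _ _ h1]) (by linarith [nbd _ _ _ h2])] at h3
      linear_combination -h3
    have cl : ∀ (x : ℝ) (i i' : ℕ), |x - δ * i| < δ → |x - δ * i'| < δ → i' = i ∨ i' = i + 1 ∨ i = i' + 1 := by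
      intro x i i' h1 h2
      rw [abs_lt] at h1 h2
      have h3 : (i:ℝ) < i' + 2 := by
        by_contra hcon; push Not at hcon; nlinarith
      have h4 : (i':ℝ) < i + 2 := by
        by_contra hcon; push Not at hcon; nlinarith
      have h3' : i < i' + 2 := by exact_mod_cast h3
      have h4' : i' < i + 2 := by exact_mod_cast h4
      omega
    intro i j i' j' h1 h2
    have hmix : Nb (γ t) i' j := ⟨h2.1, h1.2.1, h2.2.2.1, h1.2.2.2⟩
    have e1 : ψ i j - coch (γ t) (P i j) = ψ i' j - coch (γ t) (P i' j) := by
      rcases cl _ i i' h1.2.2.1 h2.2.2.1 with rfl | rfl | rfl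
      · rfl
      · exact sH _ _ h1 hmix
      · exact (sH _ _ hmix h1).symm
    rw [e1]
    rcases cl _ j j' h1.2.2.2 h2.2.2.2 with rfl | rfl | rfl
    · rfl
    · exact sV _ _ hmix h2
    · exact (sV _ _ h2 hmix).symm
  have nbex' : ∀ t, ∃ ij : ℕ × ℕ, t ∈ Set.Icc σ e → Nb (γ t) ij.1 ij.2 := by
    intro t
    by_cases ht : t ∈ Set.Icc σ e
    · obtain ⟨ij, h⟩ := nbex t ht; exact ⟨ij, fun _ => h⟩
    · exact ⟨0, fun h => absurd h ht⟩
  -- choose vertices depending only on the point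
  have nbz : ∀ z : ℂ, ∃ ij : ℕ × ℕ, (∃ i j, Nb z i j) → Nb z ij.1 ij.2 := by
    intro z
    by_cases h : ∃ i j, Nb z i j
    · obtain ⟨i, j, h⟩ := h; exact ⟨(i, j), fun _ => h⟩
    · exact ⟨0, fun h' => absurd h' h⟩
  choose p hp using nbz
  have hpγ : ∀ t ∈ Set.Icc σ e, Nb (γ t) (p (γ t)).1 (p (γ t)).2 := fun t ht => by
    obtain ⟨ij, h⟩ := nbex t ht
    exact hp _ ⟨_, _, h⟩
  set G : ℝ → ℂ := fun t => D t - (∑ Q ∈ B, k Q * DQ Q t) - ψ (p (γ t)).1 (p (γ t)).2 + coch (γ t) (P (p (γ t)).1 (p (γ t)).2) with hG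
  have hGc : G e = G σ := by
    apply const_of_eventually hσ
    intro t0 ht0
    have f1 := log_eventually hD hDe ht0
    have f2 : ∀ᶠ t in 𝓝[Set.Icc σ e] t0, ∀ Q ∈ B, (k Q : ℂ) * (DQ Q t - DQ Q t0) = k Q * Complex.log ((γ t - c Q) / (γ t0 - c Q)) := by
      rw [Filter.eventually_all_finset]
      intro Q hQ
      by_cases hkQ : k Q = 0
      · simp [hkQ]
      · obtain ⟨q1, q2, -⟩ := hDQ Q hQ hkQ
        filter_upwards [log_eventually q1 q2 ht0] with t ht
        rw [ht]
    have f3 : ∀ᶠ t in 𝓝[Set.Icc σ e] t0, ‖γ t - γ t0‖ < δ := by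
      have : ∀ᶠ t in 𝓝 t0, dist (γ t) (γ t0) < δ := hγ.continuousAt.eventually (ball_mem_nhds _ hδ0)
      simp only [dist_eq_norm] at this
      exact this.filter_mono nhdsWithin_le_nhds
    have f4 : ∀ᶠ t in 𝓝[Set.Icc σ e] t0, Nb (γ t) (p (γ t0)).1 (p (γ t0)).2 := by
      have hp0 := hpγ t0 ht0
      have o1 : ∀ᶠ t in 𝓝 t0, |(γ t).re + a - δ * (p (γ t0)).1| < δ :=
        (Continuous.continuousAt (by fun_prop)).eventually_lt_const hp0.2.2.1
      have o2 : ∀ᶠ t in 𝓝 t0, |(γ t).im + a - δ * (p (γ t0)).2| < δ :=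
        (Continuous.continuousAt (by fun_prop)).eventually_lt_const hp0.2.2.2
      refine Filter.Eventually.filter_mono nhdsWithin_le_nhds ?_
      filter_upwards [o1, o2] with t h1 h2
      exact ⟨hp0.1, hp0.2.1, h1, h2⟩
    filter_upwards [f1, f2, f3, f4, self_mem_nhdsWithin] with t g1 g2 g3 g4 ht
    have np := hpγ t ht
    have n0 := hpγ t0 ht0
    have s1 := nstep t ht _ _ _ _ np g4
    have b1 : ‖P (p (γ t0)).1 (p (γ t0)).2 - γ t0‖ < 3 * δ := by linarith [nbd _ _ _ n0]
    have s2 := cadd t0 ht0 (γ t) (P (p (γ t0)).1 (p (γ t0)).2) (by linarith [haγ t ht]) (hPn _ n0.1 _ n0.2.1) (by linarith) b1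
    have s3 : coch (γ t0) (γ t) = (D t - D t0) - ∑ Q ∈ B, (k Q * DQ Q t - k Q * DQ Q t0) := by
      simp only [hcoch]
      have z1 : v (γ t) ≠ 0 := hv0 _ (hd t ht)
      have z2 : v (γ t0) ≠ 0 := hv0 _ (hd t0 ht0)
      rw [hwv _ z1, hwv _ z2, ← g1]
      congr 1
      exact Finset.sum_congr rfl fun Q hQ => by rw [← g2 Q hQ]; ring
    rw [Finset.sum_sub_distrib] at s3
    simp only [hG]
    linear_combination - s1 + s2 - s3
  simp only [hG, hloop] at hGc
  have : ∑ Q ∈ B, (k Q : ℂ) * DQ Q e = ∑ Q ∈ B, k Q * DQ Q σ := by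
    refine Finset.sum_congr rfl fun Q hQ => ?_
    by_cases hkQ : k Q = 0
    · simp [hkQ]
    · rw [(hDQ Q hQ hkQ).2.2]
  linear_combination hGc + this

end SphRec

namespace SphRec

theorem mem_comp_of_mem_closure {O : Set ℂ} (hO : IsOpen O) {x z : ℂ} (hz : z ∈ closure (connectedComponentIn O x)) (hzO : z ∈ O) :
    z ∈ connectedComponentIn O x := by
  have hop : IsOpen (connectedComponentIn O z) := hO.connectedComponentIn
  obtain ⟨p, hp1, hp2⟩ := mem_closure_iff.mp hz _ hop (mem_connectedComponentIn hzO)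
  rw [connectedComponentIn_eq hp2, ← connectedComponentIn_eq hp1]
  exact mem_connectedComponentIn hzO

theorem E_lemma {A B : Set ℂ} (hA : IsClosed A) (hB : IsClosed B) (hAB : Disjoint A B) {x y : ℂ}
    (hxA : x ∉ A) (hxB : x ∉ B) (hyA : y ∈ connectedComponentIn Aᶜ x) (hyB : y ∈ connectedComponentIn Bᶜ x) :
    y ∈ connectedComponentIn (A ∪ B)ᶜ x := by
  classical
  by_contra hcon
  have hO : IsOpen (A ∪ B)ᶜ := (hA.union hB).isOpen_compl
  set O := (A ∪ B)ᶜ with hOdef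
  have hxO : x ∈ O := by simp [hOdef, hxA, hxB]
  have hyA' : y ∉ A := connectedComponentIn_subset _ _ hyA
  have hyB' : y ∉ B := connectedComponentIn_subset _ _ hyB
  have hyO : y ∈ O := by simp [hOdef, hyA', hyB']
  set Ra := connectedComponentIn O x with hRa
  have hRao : IsOpen Ra := hO.connectedComponentIn
  set Rb := O \ closure Ra with hRb
  have hRbo : IsOpen Rb := hO.sdiff isClosed_closure
  have hRab : ∀ z ∈ O, z ∉ Rb → z ∈ Ra := by
    intro z hz hzb
    by_contra h
    exact hzb ⟨hz, fun h' => h (mem_comp_of_mem_closure hO h' hz)⟩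
  have hxRb : x ∉ Rb := fun h => h.2 (subset_closure (mem_connectedComponentIn hxO))
  have hyRb : y ∈ Rb := by
    by_contra h; exact hcon (hRab y hyO h)
  have hfr : frontier Rb ⊆ A ∪ B := by
    intro z hz
    by_contra h
    have hzO : z ∈ O := h
    have hzb : z ∉ Rb := fun h' => hz.2 (by rwa [hRbo.interior_eq])
    have hza := hRab z hzO hzb
    obtain ⟨p, hp1, hp2⟩ := mem_closure_iff.mp hz.1 _ hRao hza
    exact hp2.2 (subset_closure hp1)
  obtain ⟨f, hf0, hf1, -⟩ := exists_continuous_zero_one_of_isClosed hA hB hAB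
  have key : ∀ c : ℂ, Complex.exp (2 * Real.pi * Complex.I * c) = 1 → Continuous f →
      ∀ C : Set ℂ, IsClosed C → (∀ z ∈ frontier Rb, z ∉ C → (f z : ℂ) = c) → 
      ContinuousOn (fun z => if z ∈ Rb then (f z : ℂ) else c) Cᶜ := by
    intro c _ _ C hC hz
    refine ContinuousOn.if ?_ ?_ continuousOn_const
    · rintro z ⟨h1, h2⟩
      exact hz z h2 h1
    · exact (Complex.continuous_ofReal.comp f.continuous).continuousOn
  obtain ⟨l, hl, hle⟩ := log_univ (E := ℂ) (fun z => if z ∈ Rb then Complex.exp (2 * Real.pi * Complex.I * f z) else 1) (by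
      refine Continuous.if ?_ (by fun_prop) continuous_const
      intro z hz
      rcases hfr hz with h | h
      · rw [hf0 h]; simp
      · rw [hf1 h]; simp) (by
      intro z; split_ifs <;> simp [Complex.exp_ne_zero])
  have main : ∀ (c : ℂ) (C : Set ℂ), Complex.exp (2 * Real.pi * Complex.I * c) = 1 → IsClosed C →
      (∀ z ∈ frontier Rb, z ∉ C → (f z : ℂ) = c) → y ∈ connectedComponentIn Cᶜ x → x ∉ C →
      l x - 2 * Real.pi * Complex.I * c = l y - 2 * Real.pi * Complex.I * f y := by
    intro c C hc hC hz hy hx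
    have := exp_one_const (isPreconnected_connectedComponentIn (F := Cᶜ) (x := x))
      (d := fun z => l z - 2 * Real.pi * Complex.I * (if z ∈ Rb then (f z : ℂ) else c))
      (hl.continuousOn.sub (continuousOn_const.mul ((key c hc f.continuous C hC hz).mono (connectedComponentIn_subset _ _)))) (by
        intro z _
        rw [Complex.exp_sub, hle]
        split_ifs
        · exact div_self (Complex.exp_ne_zero _)
        · rw [hc, div_one]) (mem_connectedComponentIn hx) hy
    simpa [hxRb, hyRb] using this
  have m1 := main 1 A (by simp) hA (fun z hz hzA => by
    have := (hfr hz).resolve_left hzA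
    rw [hf1 this]; simp) hyA hxA
  have m2 := main 0 B (by simp) hB (fun z hz hzB => by
    have := (hfr hz).resolve_right hzB
    rw [hf0 this]; simp) hyB hxB
  rw [← m2] at m1
  have : (2 * Real.pi * Complex.I : ℂ) = 0 := by linear_combination -m1
  exact Complex.two_pi_I_ne_zero this

theorem BK_lemma (h : ℂ ≃ₜ ℂ) (H : OP h) {x : ℂ} (hx : h x ≠ x) :
    h x ∈ connectedComponentIn {z | h z ≠ z} x := by
  classical
  by_contra hcon
  have hO : IsOpen {z | h z ≠ z} := isOpen_ne_fun h.continuous continuous_id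
  set O := {z | h z ≠ z} with hOd
  set U := connectedComponentIn O x with hU
  have hUo : IsOpen U := hO.connectedComponentIn
  have hxU : x ∈ U := mem_connectedComponentIn hx
  set y := h x with hy
  have hhU : ∀ z ∈ U, h z ∉ U := by
    intro z hz hhz
    have hpre : IsPreconnected (h '' U) := isPreconnected_connectedComponentIn.image _ h.continuous.continuousOn
    have hsub : h '' U ⊆ O := by
      rintro _ ⟨w, hw, rfl⟩
      have : h w ≠ w := connectedComponentIn_subset _ _ hw
      exact fun h' => this (h.injective h')
    have := hpre.subset_connectedComponentIn ⟨z, hz, rfl⟩ hsub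
    rw [← connectedComponentIn_eq hhz] at this
    exact hcon (this ⟨x, hxU, rfl⟩)
  have hfr : ∀ z ∈ frontier U, h z = z := by
    intro z hz
    by_contra hne
    have := mem_comp_of_mem_closure hO hz.1 hne
    exact hz.2 (by rwa [hUo.interior_eq])
  set k : ℂ → ℂ := fun z => if z ∈ U then h z else z with hk
  have hkc : Continuous k := Continuous.if hfr h.continuous continuous_id
  have hyO : y ∈ O := fun h' => hx (h.injective h')
  have hyx : y ≠ x := hx
  have hycl : y ∉ closure U := fun h' => hcon (mem_comp_of_mem_closure hO h' hyO)
  have kx : ∀ z, k z - x ≠ 0 := by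
    intro z h0
    rw [sub_eq_zero] at h0
    simp only [hk] at h0
    split_ifs at h0 with hz
    · exact hhU z hz (h0 ▸ hxU)
    · exact hz (h0 ▸ hxU)
  have ky : ∀ z, z ≠ x → z ≠ y → k z - y ≠ 0 := by
    intro z h1 h2 h0
    rw [sub_eq_zero] at h0
    simp only [hk] at h0
    split_ifs at h0 with hz
    · exact h1 (h.injective h0)
    · exact h2 h0
  -- log of k - x
  obtain ⟨l, hl, hle⟩ := log_univ (E := ℂ) (fun z => k z - x) (by fun_prop) kx
  -- ratio
  set Q : ℂ → ℂ := fun z => if z = y then 1 / (y - x) else (k z - y) / ((z - y) * (z - x)) with hQ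
  have hQ0 : ∀ z, z ≠ x → Q z ≠ 0 := by
    intro z hz
    simp only [hQ]
    split_ifs with h1
    · simp [sub_ne_zero.mpr hyx]
    · exact div_ne_zero (ky z hz h1) (mul_ne_zero (sub_ne_zero.mpr h1) (sub_ne_zero.mpr hz))
  have hQc : ContinuousOn Q {z | z ≠ x} := by
    intro z hz
    apply ContinuousAt.continuousWithinAt
    by_cases h1 : z = y
    · have : ∀ᶠ w in 𝓝 z, Q w = 1 / (w - x) := by
        rw [h1]
        filter_upwards [isClosed_closure.isOpen_compl.mem_nhds hycl] with w hw
        have hwU : w ∉ U := fun h' => hw (subset_closure h')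
        simp only [hQ, hk, hwU, if_false]
        split_ifs with h2
        · rw [h2]
        · have : w - y ≠ 0 := sub_ne_zero.mpr h2
          rw [div_mul_eq_div_div, div_self this]
      rw [continuousAt_congr this]
      exact ContinuousAt.div continuousAt_const (by fun_prop) (sub_ne_zero.mpr hz)
    · have : ∀ᶠ w in 𝓝 z, Q w = (k w - y) / ((w - y) * (w - x)) := by
        filter_upwards [isOpen_ne.mem_nhds h1] with w hw
        simp only [hQ]; rw [if_neg hw]
      rw [continuousAt_congr this]
      exact ContinuousAt.div (by fun_prop) (by fun_prop) (mul_ne_zero (sub_ne_zero.mpr h1) (sub_ne_zero.mpr hz))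
  have hxe : ∀ ζ, x + Complex.exp ζ ≠ x := by intro ζ; simp [Complex.exp_ne_zero]
  obtain ⟨q, hq, hqe⟩ := log_univ (E := ℂ) (fun ζ => Q (x + Complex.exp ζ)) 
    (hQc.comp_continuous (by fun_prop) (fun ζ => hxe ζ)) (fun ζ => hQ0 _ (hxe ζ))
  have eper : ∀ ζ, Complex.exp (ζ + 2 * Real.pi * Complex.I) = Complex.exp ζ := by
    intro ζ; simp [Complex.exp_add]
  have hqp : ∀ ζ ξ, q (ζ + 2 * Real.pi * Complex.I) - q ζ = q (ξ + 2 * Real.pi * Complex.I) - q ξ := by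
    intro ζ ξ
    exact log_sub_const (s := Set.univ) isPreconnected_univ (d := fun ζ => q (ζ + 2 * Real.pi * Complex.I)) (e := q)
      (by fun_prop) (by fun_prop) (fun ζ _ => by rw [hqe, hqe, eper]) trivial trivial
  -- near x
  obtain ⟨L, hL, hLe⟩ := H
  obtain ⟨r, hr0, hrU⟩ := Metric.isOpen_iff.mp hUo x hxU
  set r' := min r ‖x - y‖ with hr'
  have hr'0 : 0 < r' := lt_min hr0 (norm_pos_iff.mpr (sub_ne_zero.mpr hyx.symm))
  have hloc : ∀ ζ : ℂ, ζ.re < Real.log r' → x + Complex.exp ζ ∈ U ∧ 0 < ((x + Complex.exp ζ - y) / (x - y)).re := by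
    intro ζ hζ
    have h1 : ‖Complex.exp ζ‖ < r' := by
      rw [Complex.norm_exp, ← Real.lt_log_iff_exp_lt hr'0]; exact hζ
    refine ⟨hrU ?_, re_pos_of_norm_sub_lt ?_⟩
    · rw [mem_ball, dist_eq_norm]; simpa using h1.trans_le (min_le_left _ _)
    · have : x + Complex.exp ζ - y - (x - y) = Complex.exp ζ := by ring
      rw [this]; exact h1.trans_le (min_le_right _ _)
  have hconn : IsPreconnected {ζ : ℂ | ζ.re < Real.log r'} := (convex_halfSpace_re_lt _).isPreconnected
  have key1 := log_sub_const hconn (d := q)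
    (e := fun ζ => L (x + Complex.exp ζ) x - Complex.log ((x + Complex.exp ζ - y) / (x - y)) - Complex.log (x - y))
    (by fun_prop) (by
      refine ContinuousOn.sub (ContinuousOn.sub ?_ ?_) continuousOn_const
      · exact hL.comp (f := fun ζ : ℂ => (x + Complex.exp ζ, x)) (by fun_prop) (fun ζ _ => hxe ζ)
      · exact ContinuousOn.clog (by fun_prop) (fun ζ hζ => Or.inl (hloc ζ hζ).2)) (by
      intro ζ hζ
      obtain ⟨g1, g2⟩ := hloc ζ hζ
      have n1 : x - y ≠ 0 := sub_ne_zero.mpr hyx.symm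
      have n2 : (x + Complex.exp ζ - y) / (x - y) ≠ 0 := fun h' => by rw [h'] at g2; simp at g2
      have n3 : x + Complex.exp ζ - y ≠ 0 := fun h' => n2 (by simp [h'])
      have n4 := Complex.exp_ne_zero ζ
      rw [hqe, Complex.exp_sub, Complex.exp_sub, Complex.exp_log n1, Complex.exp_log n2]
      simp only [hQ]
      rw [if_neg (sub_ne_zero.mp n3)]
      simp only [hk, g1, if_true]
      have := hLe _ _ (hxe ζ)
      rw [← this]
      have n5 : x + Complex.exp ζ - x ≠ 0 := by simpa using n4
      field_simp) 
      (x := ((Real.log r' - 1 : ℝ) : ℂ) + 2 * Real.pi * Complex.I) (y := ((Real.log r' - 1 : ℝ) : ℂ)) (by simp) (by simp)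
  rw [eper] at key1
  have hq0 : ∀ ζ, q (ζ + 2 * Real.pi * Complex.I) = q ζ := by
    intro ζ
    have := hqp ζ ((Real.log r' - 1 : ℝ) : ℂ)
    linear_combination this + key1
  -- near infinity
  have hkt : Tendsto k (cocompact ℂ) (cocompact ℂ) := by
    have h1 : Tendsto h (cocompact ℂ) (cocompact ℂ) := h.isClosedEmbedding.tendsto_cocompact
    refine Tendsto.if' (f := h) (g := id) h1 tendsto_id
  set φ : ℂ → ℂ := fun w => (w - y) / (w - x) with hφ
  have hφt : Tendsto φ (cocompact ℂ) (𝓝 1) := by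
    have h1 : Tendsto (fun w : ℂ => 1 + (x - y) * (w - x)⁻¹) (cocompact ℂ) (𝓝 (1 + (x - y) * 0)) := by
      refine Tendsto.const_add _ (Tendsto.const_mul _ ?_)
      have : Tendsto (fun w : ℂ => w - x) (cocompact ℂ) (Bornology.cobounded ℂ) := by
        rw [← Metric.cobounded_eq_cocompact]
        exact tendsto_sub_const_cobounded x
      exact tendsto_inv₀_cobounded.comp this
    rw [mul_zero, add_zero] at h1
    refine h1.congr' ?_
    have : {x}ᶜ ∈ cocompact ℂ := isCompact_singleton.compl_mem_cocompact
    filter_upwards [this] with w hw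
    have : w - x ≠ 0 := sub_ne_zero.mpr hw
    simp only [hφ]; field_simp; ring
  have hρ : Tendsto (fun z => φ (k z) / φ z) (cocompact ℂ) (𝓝 1) := by
    have := (hφt.comp hkt).div hφt one_ne_zero
    rw [div_one] at this
    exact this
  have hev : ∀ᶠ z in cocompact ℂ, 0 < (φ (k z) / φ z).re ∧ z ≠ y := by
    have h1 : ∀ᶠ w : ℂ in 𝓝 1, 0 < w.re := Complex.continuous_re.continuousAt.eventually_const_lt (by simp)
    exact (hρ.eventually h1).and (isCompact_singleton.compl_mem_cocompact)
  obtain ⟨M, hM⟩ : ∃ M : ℝ, ∀ z : ℂ, M < ‖z - x‖ → 0 < (φ (k z) / φ z).re ∧ z ≠ y := by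
    rw [← Metric.cobounded_eq_cocompact, (Metric.hasBasis_cobounded_compl_closedBall x).eventually_iff] at hev
    obtain ⟨M, -, hM⟩ := hev
    exact ⟨M, fun z hz => hM (by simpa [dist_eq_norm] using hz)⟩
  set M' := max M 1 with hM'
  have hM'0 : 0 < M' := by positivity
  have hfar : ∀ ζ : ℂ, Real.log M' < ζ.re → M < ‖x + Complex.exp ζ - x‖ := by
    intro ζ hζ
    rw [Real.log_lt_iff_lt_exp hM'0] at hζ
    simp only [add_sub_cancel_left, Complex.norm_exp]
    exact (le_max_left _ _).trans_lt hζ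
  have hconn2 : IsPreconnected {ζ : ℂ | Real.log M' < ζ.re} := (convex_halfSpace_re_gt _).isPreconnected
  have key2 := log_sub_const hconn2 (d := fun ζ => q ζ + 2 * ζ)
    (e := fun ζ => l (x + Complex.exp ζ) + Complex.log (φ (k (x + Complex.exp ζ)) / φ (x + Complex.exp ζ)))
    (by fun_prop) (by
      refine ContinuousOn.add (by fun_prop) (ContinuousOn.clog ?_ fun ζ hζ => Or.inl (hM _ (hfar ζ hζ)).1)
      refine ContinuousOn.div ?_ ?_ ?_
      · exact Continuous.continuousOn (Continuous.div (by fun_prop) (by fun_prop) fun ζ => kx _)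
      · exact Continuous.continuousOn (Continuous.div (by fun_prop) (by fun_prop) fun ζ => sub_ne_zero.mpr (hxe ζ))
      · intro ζ hζ h0
        have := (hM _ (hfar ζ hζ)).1
        rw [h0] at this; simp at this) (by
      intro ζ hζ
      obtain ⟨g1, g2⟩ := hM _ (hfar ζ hζ)
      have n0 : φ (k (x + Complex.exp ζ)) / φ (x + Complex.exp ζ) ≠ 0 := fun h' => by rw [h'] at g1; simp at g1
      rw [Complex.exp_add, Complex.exp_add, Complex.exp_log n0, hqe, hle]
      simp only [hQ]
      rw [if_neg g2]
      simp only [hφ]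
      have n1 := kx (x + Complex.exp ζ)
      have n2 := sub_ne_zero.mpr g2
      have n3 : Complex.exp (2 * ζ) = (x + Complex.exp ζ - x) * (x + Complex.exp ζ - x) := by
        rw [two_mul, Complex.exp_add]; ring
      have n4 := sub_ne_zero.mpr (hxe ζ)
      rw [n3]
      field_simp)
      (x := ((Real.log M' + 1 : ℝ) : ℂ) + 2 * Real.pi * Complex.I) (y := ((Real.log M' + 1 : ℝ) : ℂ)) (by simp) (by simp)
  rw [eper, hq0] at key2
  have : (2 * Real.pi * Complex.I : ℂ) = 0 := by linear_combination key2 / 2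
  exact Complex.two_pi_I_ne_zero this

end SphRec

namespace SphRec

lemma push (a b : ℂ) (η : ℝ) (hη : 0 < η) (hab : dist b a < η) :
    ∃ Ψ : ℂ ≃ₜ ℂ, Ψ a = b ∧ ∀ z, η ≤ dist z a → Ψ z = z := by
  set g : ℂ → ℂ := fun w => (max 0 (1 - ‖w - a‖ / η) : ℝ) • (b - a) with hg
  obtain ⟨c, hc⟩ : ∃ c : NNReal, (c : ℝ) = ‖b - a‖ / η :=
    ⟨Real.toNNReal (‖b - a‖ / η), Real.coe_toNNReal _ (by positivity)⟩
  have hc1 : c < 1 := by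
    rw [← NNReal.coe_lt_coe]
    rw [hc, NNReal.coe_one]
    rw [div_lt_one hη, ← dist_eq_norm]; exact hab
  have hgl : ∀ w w', ‖g w - g w'‖ ≤ c * ‖w - w'‖ := by
    intro w w'
    simp only [hg, ← sub_smul, norm_smul]
    have h1 : ‖max 0 (1 - ‖w - a‖ / η) - max 0 (1 - ‖w' - a‖ / η)‖ ≤ ‖w - w'‖ / η := by
      rw [Real.norm_eq_abs]
      rw [max_comm, max_comm 0]
      refine (abs_max_sub_max_le_abs _ _ _).trans ?_
      have : (|‖w' - a‖ - ‖w - a‖|) ≤ ‖w - w'‖ := by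
        refine (abs_norm_sub_norm_le _ _).trans ?_
        rw [norm_sub_rev]; simp
      have e : 1 - ‖w - a‖ / η - (1 - ‖w' - a‖ / η) = (‖w' - a‖ - ‖w - a‖) / η := by ring
      rw [e, abs_div, abs_of_pos hη]
      gcongr
    calc _ ≤ ‖w - w'‖ / η * ‖b - a‖ := by gcongr
      _ = _ := by rw [hc]; ring
  have happ : ApproximatesLinearOn (fun w => w + g w) (ContinuousLinearEquiv.refl ℝ ℂ : ℂ →L[ℝ] ℂ) Set.univ c := by
    intro w _ w' _
    have e : w + g w - (w' + g w') - (ContinuousLinearEquiv.refl ℝ ℂ : ℂ →L[ℝ] ℂ) (w - w') = g w - g w' := by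
      simp; ring
    rw [e]
    exact hgl w w'
  have hN : ‖((ContinuousLinearEquiv.refl ℝ ℂ).symm : ℂ →L[ℝ] ℂ)‖₊⁻¹ = 1 := by
    have : ((ContinuousLinearEquiv.refl ℝ ℂ).symm : ℂ →L[ℝ] ℂ) = ContinuousLinearMap.id ℝ ℂ := by
      ext w <;> simp
    rw [this]
    have := ContinuousLinearMap.norm_id (𝕜 := ℝ) (E := ℂ)
    have h2 : ‖ContinuousLinearMap.id ℝ ℂ‖₊ = 1 := by ext; simpa using this
    rw [h2]; simp
  refine ⟨happ.toHomeomorph _ (Or.inr (by rw [hN]; exact hc1)), ?_, ?_⟩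
  · show a + g a = b
    simp [hg]
  · intro z hz
    show z + g z = z
    have : 1 - ‖z - a‖ / η ≤ 0 := by
      rw [sub_nonpos, one_le_div hη, ← dist_eq_norm]; exact hz
    simp [hg, max_eq_left this]

lemma move_lemma (V : Set ℂ) (hV : IsOpen V) (hc : IsPreconnected V) (x : ℂ) (hx : x ∈ V) (r : ℝ) (hr : 0 < r)
    (p : ℂ) (hp : p ∈ V) :
    ∃ Φ : ℂ ≃ₜ ℂ, Φ x = x ∧ (∀ z, z ∉ V → Φ z = z) ∧ dist (Φ p) x < r := by
  set S : Set ℂ := {p | ∃ Φ : ℂ ≃ₜ ℂ, Φ x = x ∧ (∀ z, z ∉ V → Φ z = z) ∧ dist (Φ p) x < r} with hS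
  have hSo : IsOpen S := by
    rw [isOpen_iff_mem_nhds]
    rintro q ⟨Φ, h1, h2, h3⟩
    have : ∀ᶠ q' in 𝓝 q, dist (Φ q') x < r :=
      (Φ.continuous.dist continuous_const).continuousAt.eventually_lt continuousAt_const h3
    filter_upwards [this] with q' hq'
    exact ⟨Φ, h1, h2, hq'⟩
  have hxS : x ∈ S := ⟨Homeomorph.refl ℂ, rfl, fun _ _ => rfl, by simpa using hr⟩
  have hco : IsOpen (V ∩ Sᶜ) := by
    rw [isOpen_iff_mem_nhds]
    rintro q ⟨hqV, hqS⟩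
    have hqx : q ≠ x := fun h => hqS (h ▸ hxS)
    have : V ∩ {x}ᶜ ∈ 𝓝 q := (hV.inter isOpen_compl_singleton).mem_nhds ⟨hqV, hqx⟩
    obtain ⟨η, hη, hb⟩ := Metric.mem_nhds_iff.1 this
    filter_upwards [Metric.ball_mem_nhds q hη] with q' hq'
    refine ⟨(hb hq').1, ?_⟩
    rintro ⟨Φ, h1, h2, h3⟩
    obtain ⟨Ψ, g1, g2⟩ := push q q' η hη hq'
    have hout : ∀ z, z ∉ V ∩ {x}ᶜ → Ψ z = z := fun z hz => g2 z (by
      by_contra hlt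
      exact hz (hb (by simpa using hlt)))
    refine hqS ⟨Ψ.trans Φ, ?_, ?_, ?_⟩
    · simp [hout x (by simp), h1]
    · intro z hz
      simp [hout z (fun h => hz h.1), h2 z hz]
    · simpa [g1] using h3
  by_contra hcon
  have hpS : p ∉ S := hcon
  obtain ⟨z, -, hz1, hz2⟩ := hc S (V ∩ Sᶜ) hSo hco (fun z hz => by
    by_cases h : z ∈ S
    · exact Or.inl h
    · exact Or.inr ⟨hz, h⟩) ⟨x, hx, hxS⟩ ⟨p, hp, hp, hpS⟩
  exact hz2.2 hz1

end SphRec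

namespace SphRec

lemma disk_lemma (g : ℂ ≃ₜ ℂ) (x : ℂ) (r : ℝ) (hfix : ∀ z ∈ closedBall x r, g z ≠ z) (hgx : dist (g x) x < r) :
    ∃ R u, 0 < R ∧ R < r ∧ ‖u - x‖ = R ∧ ‖g u - x‖ = R ∧ ∀ z, R ≤ max ‖z - x‖ ‖g z - x‖ := by
  set m : ℂ → ℝ := fun z => max ‖z - x‖ ‖g z - x‖ with hm
  have hmc : Continuous m := by
    have := g.continuous
    fun_prop
  have hmx : m x = ‖g x - x‖ := by simp [hm]
  obtain ⟨u, -, hu⟩ := (isCompact_closedBall x (‖g x - x‖)).exists_isMinOn ⟨x, by simp⟩ hmc.continuousOn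
  have hmin : ∀ z, m u ≤ m z := by
    intro z
    by_cases hz : z ∈ closedBall x (‖g x - x‖)
    · exact hu hz
    · have h1 : m u ≤ m x := hu (by simp)
      rw [mem_closedBall, not_le, dist_eq_norm] at hz
      exact (h1.trans (hmx ▸ hz.le)).trans (le_max_left _ _)
  have hR0 : 0 < m u := by
    by_contra hcon
    have h1 : ‖u - x‖ ≤ 0 := (le_max_left _ _).trans (not_lt.mp hcon)
    have h2 : ‖g u - x‖ ≤ 0 := (le_max_right _ _).trans (not_lt.mp hcon)
    rw [norm_le_zero_iff, sub_eq_zero] at h1 h2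
    subst h1
    have hr : 0 < r := dist_nonneg.trans_lt hgx
    exact hfix u (by simp [hr.le]) h2
  -- small decrease of norm
  have dec : ∀ v : ℂ, v ≠ x → ∀ W ∈ 𝓝 v, ∃ v' ∈ W, ‖v' - x‖ < ‖v - x‖ := by
    intro v hv W hW
    have ht : Tendsto (fun s : ℝ => v + (s : ℂ) * (x - v)) (𝓝[>] 0) (𝓝 v) := by
      have : Continuous (fun s : ℝ => v + (s : ℂ) * (x - v)) := by fun_prop
      have h0 := this.tendsto 0
      simp only [Complex.ofReal_zero, zero_mul, add_zero] at h0
      exact h0.mono_left nhdsWithin_le_nhds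
    have h1 : ∀ᶠ s in 𝓝[>] (0 : ℝ), s < 1 := nhdsWithin_le_nhds (gt_mem_nhds one_pos)
    have h2 : ∀ᶠ s in 𝓝[>] (0 : ℝ), 0 < s := self_mem_nhdsWithin
    obtain ⟨s, hsW, hs0, hs1⟩ := ((ht.eventually hW).and (h2.and h1)).exists
    refine ⟨_, hsW, ?_⟩
    have e : v + (s : ℂ) * (x - v) - x = ((1 - s : ℝ) : ℂ) * (v - x) := by push_cast; ring
    rw [e, norm_mul, Complex.norm_real, Real.norm_eq_abs, abs_of_pos (by linarith)]
    have : 0 < ‖v - x‖ := norm_pos_iff.2 (sub_ne_zero.2 hv)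
    have hs0' : 0 < s := hs0
    nlinarith
  have hle1 : ‖u - x‖ ≤ m u := le_max_left _ _
  have hle2 : ‖g u - x‖ ≤ m u := le_max_right _ _
  have e1 : ‖u - x‖ = m u := by
    refine le_antisymm hle1 (not_lt.1 fun hlt => ?_)
    have hgu : ‖g u - x‖ = m u := by
      rcases max_choice ‖u - x‖ ‖g u - x‖ with h | h
      · exact absurd h.symm (ne_of_lt hlt)
      · exact h.symm
    have hne : g u ≠ x := fun h => by rw [h] at hgu; simp at hgu; linarith
    have hW : {v | ‖g.symm v - x‖ < m u} ∈ 𝓝 (g u) := by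
      have : IsOpen {v | ‖g.symm v - x‖ < m u} := by
        have := g.symm.continuous
        exact isOpen_lt (by fun_prop) continuous_const
      exact this.mem_nhds (by simpa using hlt)
    obtain ⟨v, hv1, hv2⟩ := dec _ hne _ hW
    have h3 : m (g.symm v) < m u := max_lt hv1 (by rw [g.apply_symm_apply]; linarith)
    exact absurd (hmin _) (not_le.2 h3)
  have e2 : ‖g u - x‖ = m u := by
    refine le_antisymm hle2 (not_lt.1 fun hlt => ?_)
    have hne : u ≠ x := fun h => by rw [h] at e1; simp at e1; rw [h] at hR0; linarith
    have hW : {v | ‖g v - x‖ < m u} ∈ 𝓝 u := by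
      have : IsOpen {v | ‖g v - x‖ < m u} := by
        have := g.continuous
        exact isOpen_lt (by fun_prop) continuous_const
      exact this.mem_nhds hlt
    obtain ⟨v, hv1, hv2⟩ := dec _ hne _ hW
    have h3 : m v < m u := max_lt (by linarith) hv1
    exact absurd (hmin _) (not_le.2 h3)
  refine ⟨m u, u, hR0, ?_, e1, e2, hmin⟩
  exact (hmin x).trans_lt (by rw [hmx, ← dist_eq_norm]; exact hgx)

lemma arc_lemma (g : ℂ ≃ₜ ℂ) (x : ℂ) (r : ℝ) (hfix : ∀ z ∈ closedBall x r, g z ≠ z) (hgx : dist (g x) x < r) :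
    ∃ δ > 0, ∀ y, dist y x < δ → ∃ X : ℝ → ℂ, Continuous X ∧ (∀ t, X (t + 1) = g (X t)) ∧
      (∀ t t', t < t' → t' - t ≤ 1 → X t ≠ X t') ∧ (∀ t, ∃ n : ℤ, ∃ z ∈ closedBall x r, X t = (g ^ n) z) ∧
      X (1/2) = x ∧ ∃ t0 ∈ Set.Icc (1/2 : ℝ) 1, X t0 = y := by
  obtain ⟨R, u, hR0, hRr, hu, hw, hmin⟩ := disk_lemma g x r hfix hgx
  refine ⟨R, hR0, fun y hy => ?_⟩
  set w := g u with hwdef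
  have hwu : w ≠ u := hfix u (by rw [mem_closedBall, dist_eq_norm]; linarith)
  have hwx : w - x ≠ 0 := fun h => by rw [h] at hw; simp at hw; linarith
  have hux : u - x ≠ 0 := fun h => by rw [h] at hu; simp at hu; linarith
  set s : ℝ := ‖y - x‖ / R with hs
  have hs1 : s < 1 := by rw [hs, div_lt_one hR0, ← dist_eq_norm]; exact hy
  have hs0 : 0 ≤ s := by positivity
  set θ0 : ℝ := Complex.arg ((y - x) / (w - x)) with hθ0
  set E : ℝ → ℂ := fun τ => Complex.exp ((θ0 * (1 - τ) / (1 - s) : ℝ) * Complex.I) with hE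
  have hEc : Continuous E := by simp only [hE]; fun_prop
  have hEn : ∀ τ, ‖E τ‖ = 1 := fun τ => Complex.norm_exp_ofReal_mul_I _
  have hE1 : E 1 = 1 := by simp [hE]
  set c : ℝ → ℂ := fun t => (max 0 (1 - 2 * t) : ℝ) * (u - x) + (max 0 (2 * t - 1) : ℝ) * (w - x) with hc
  have hcc : Continuous c := by simp only [hc]; fun_prop
  set α : ℝ → ℂ := fun t => x + c t * E |2 * t - 1| with hα
  have hαc : Continuous α := by
    simp only [hα]
    exact continuous_const.add (hcc.mul (hEc.comp (by fun_prop)))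
  have hcl : ∀ t, t ≤ 1/2 → c t = (1 - 2 * t : ℝ) * (u - x) := by
    intro t ht
    simp only [hc]
    rw [max_eq_right (by linarith), max_eq_left (by linarith)]; simp
  have hcr : ∀ t, 1/2 ≤ t → c t = (2 * t - 1 : ℝ) * (w - x) := by
    intro t ht
    simp only [hc]
    rw [max_eq_left (by linarith), max_eq_right (by linarith)]; simp
  have hcn : ∀ t, ‖c t‖ = R * |2 * t - 1| := by
    intro t
    rcases le_total t (1/2) with ht | ht
    · rw [hcl t ht, norm_mul, hu, Complex.norm_real, Real.norm_eq_abs, abs_sub_comm]; ring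
    · rw [hcr t ht, norm_mul, hw, Complex.norm_real, Real.norm_eq_abs]; ring
  have hαn : ∀ t, ‖α t - x‖ = R * |2 * t - 1| := by
    intro t
    simp only [hα, add_sub_cancel_left, norm_mul, hEn, mul_one, hcn]
  have hα0 : α 0 = u := by
    simp only [hα]; rw [hcl 0 (by norm_num)]; simp [hE1]
  have hα1 : α 1 = w := by
    simp only [hα]; rw [hcr 1 (by norm_num)]; norm_num [hE1]
  have hαh : α (1/2) = x := by
    have := hαn (1/2)
    norm_num at this
    rw [sub_eq_zero] at this
    simpa using this
  have hαinj : ∀ t t', t < t' → α t ≠ α t' := by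
    intro t t' htt h
    have h1 : |2 * t - 1| = |2 * t' - 1| := by
      have := hαn t
      rw [h, hαn t'] at this
      exact (mul_left_cancel₀ hR0.ne' this).symm
    have h2 : 2 * t - 1 = - (2 * t' - 1) := by
      rcases abs_eq_abs.1 h1 with h2 | h2
      · linarith
      · exact h2
    have hEne : E |2 * t' - 1| ≠ 0 := fun h => by have := hEn |2 * t' - 1|; rw [h] at this; simp at this
    simp only [hα] at h
    rw [h1] at h
    have h3 := mul_right_cancel₀ hEne (add_left_cancel h)
    rw [hcl t (by linarith), hcr t' (by linarith)] at h3
    have h4 : 1 - 2 * t = 2 * t' - 1 := by linarith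
    rw [h4] at h3
    have h5 : ((2 * t' - 1 : ℝ) : ℂ) ≠ 0 := by
      rw [Complex.ofReal_ne_zero]; intro h6; linarith
    have := mul_left_cancel₀ h5 h3
    exact hwu (sub_left_injective this.symm)
  have hαball : ∀ t ∈ Set.Icc (0:ℝ) 1, ‖α t - x‖ ≤ R := by
    intro t ht
    rw [hαn]
    have : |2 * t - 1| ≤ 1 := abs_le.2 ⟨by linarith [ht.1], by linarith [ht.2]⟩
    nlinarith
  have hαlt : ∀ t, 0 < t → t < 1 → ‖α t - x‖ < R := by
    intro t h0 h1
    rw [hαn]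
    have : |2 * t - 1| < 1 := abs_lt.2 ⟨by linarith, by linarith⟩
    nlinarith
  set X : ℝ → ℂ := fun t => (g ^ ⌊t⌋) (α (Int.fract t)) with hX
  have hpow : ∀ (n : ℤ) z, (g ^ (n + 1)) z = g ((g ^ n) z) := by
    intro n z
    rw [add_comm, zpow_add, zpow_one]; rfl
  have hpow' : ∀ (n : ℤ) z, (g ^ (n + 1)) z = (g ^ n) (g z) := by
    intro n z
    rw [zpow_add, zpow_one]; rfl
  have hXIcc : ∀ (n : ℤ) (t : ℝ), t ∈ Set.Icc (n : ℝ) (n + 1) → X t = (g ^ n) (α (t - n)) := by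
    intro n t ht
    rcases ht.2.lt_or_eq with h | h
    · have : ⌊t⌋ = n := Int.floor_eq_iff.2 ⟨ht.1, h⟩
      simp only [hX, Int.fract, this]
    · have h1 : t = ((n + 1 : ℤ) : ℝ) := by push_cast; exact h
      have h2 : ⌊t⌋ = n + 1 := by rw [h1, Int.floor_intCast]
      have h3 : t - n = 1 := by linarith
      simp only [hX, Int.fract, h2]
      rw [h3, hα1, hpow', ← h1, sub_self, hα0]
  have hXs : ∀ t, X (t + 1) = g (X t) := by
    intro t
    simp only [hX]
    rw [Int.floor_add_one, Int.fract_add_one, hpow]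
  have hXc : Continuous X := by
    have hlf : LocallyFinite (fun n : ℤ => Set.Icc (n : ℝ) (n + 1)) := by
      intro t
      refine ⟨Set.Ioo (t - 1) (t + 1), Ioo_mem_nhds (by linarith) (by linarith), ?_⟩
      refine (Set.finite_Icc (⌊t⌋ - 2) (⌊t⌋ + 2)).subset ?_
      rintro n ⟨z, hz1, hz2⟩
      have a1 := Int.floor_le t
      have a2 := Int.lt_floor_add_one t
      have b1 := hz1.1
      have b2 := hz1.2
      have c1 := hz2.1
      have c2 := hz2.2
      constructor
      · have : ((⌊t⌋ : ℝ)) < n + 3 := by linarith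
        have : ⌊t⌋ < n + 3 := by exact_mod_cast this
        omega
      · have : (n : ℝ) < ⌊t⌋ + 3 := by linarith
        have : n < ⌊t⌋ + 3 := by exact_mod_cast this
        omega
    refine hlf.continuous ?_ (fun n => isClosed_Icc) ?_
    · ext t
      simp only [Set.mem_iUnion, Set.mem_univ, iff_true]
      exact ⟨⌊t⌋, Int.floor_le t, (Int.lt_floor_add_one t).le⟩
    · intro n
      have : Continuous fun t : ℝ => (g ^ n) (α (t - n)) :=
        (g ^ n).continuous.comp (hαc.comp (by fun_prop))
      exact this.continuousOn.congr (hXIcc n)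
  have hXloc0 : ∀ t t', 0 ≤ t → t < 1 → t < t' → t' - t ≤ 1 → X t ≠ X t' := by
    intro t t' h0 h1 h2 h3 h
    have hXt : X t = α t := by
      have := hXIcc 0 t ⟨by simpa using h0, by simpa using h1.le⟩
      simpa using this
    rcases le_total t' 1 with h4 | h4
    · have hXt' : X t' = α t' := by
        have := hXIcc 0 t' ⟨by simp; linarith, by simpa using h4⟩
        simpa using this
      exact hαinj t t' h2 (by rw [← hXt, ← hXt', h])
    · have hXt' : X t' = g (α (t' - 1)) := by
        have := hXIcc 1 t' ⟨by simpa using h4, by simp; linarith⟩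
        simpa using this
      rw [hXt, hXt'] at h
      rcases (show t' - 1 ≤ t by linarith).lt_or_eq with h5 | h5
      · have h6 := hαlt t (by linarith) h1
        have h7 := hmin (α (t' - 1))
        rw [← h] at h7
        rcases h4.lt_or_eq with h8 | h8
        · have h9 := hαlt (t' - 1) (by linarith) (by linarith)
          exact absurd h7 (not_le.2 (max_lt h9 h6))
        · rw [← h8, sub_self, hα0] at h
          exact hαinj t 1 h1 (by rw [h, hα1])
      · rw [h5] at h
        refine hfix (α t) ?_ h.symm
        rw [mem_closedBall, dist_eq_norm]
        linarith [hαball t ⟨h0, h1.le⟩]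
  have hXn : ∀ (n : ℤ) t, X (t + n) = (g ^ n) (X t) := by
    intro n t
    simp only [hX]
    rw [Int.floor_add_intCast, Int.fract_add_intCast, add_comm, zpow_add]; rfl
  refine ⟨X, hXc, hXs, ?_, ?_, ?_, ?_⟩
  · intro t t' h1 h2 h
    have e1 := hXn (-⌊t⌋) t
    have e2 := hXn (-⌊t⌋) t'
    have a1 := Int.floor_le t
    have a2 := Int.lt_floor_add_one t
    refine hXloc0 (t + (-⌊t⌋ : ℤ)) (t' + (-⌊t⌋ : ℤ)) (by push_cast; linarith) (by push_cast; linarith)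
      (by linarith) (by linarith) ?_
    rw [e1, e2, h]
  · intro t
    refine ⟨⌊t⌋, α (Int.fract t), ?_, rfl⟩
    rw [mem_closedBall, dist_eq_norm]
    linarith [hαball _ ⟨Int.fract_nonneg t, (Int.fract_lt_one t).le⟩]
  · have := hXIcc 0 (1/2) ⟨by norm_num, by norm_num⟩
    rw [this]
    simpa using hαh
  · refine ⟨(1 + s) / 2, ⟨by linarith, by linarith⟩, ?_⟩
    have := hXIcc 0 ((1 + s) / 2) ⟨by push_cast; linarith, by push_cast; linarith⟩
    rw [this]
    simp only [zpow_zero, Int.cast_zero, sub_zero]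
    show α ((1 + s) / 2) = y
    simp only [hα]
    rw [hcr _ (by linarith)]
    have e : 2 * ((1 + s) / 2) - 1 = s := by ring
    rw [e, abs_of_nonneg hs0]
    have e2 : E s = Complex.exp (θ0 * Complex.I) := by
      simp only [hE]
      rw [mul_div_assoc, div_self (by linarith), mul_one]
    have e3 := Complex.norm_mul_exp_arg_mul_I ((y - x) / (w - x))
    rw [norm_div, hw] at e3
    rw [e2]
    have e4 : (s : ℂ) * Complex.exp (θ0 * Complex.I) = (y - x) / (w - x) := e3
    have : (s : ℂ) * (w - x) * Complex.exp (θ0 * Complex.I) = y - x := by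
      rw [mul_right_comm, e4]; field_simp
    rw [this]; ring

end SphRec

namespace SphRec

lemma BL_lemma (h : ℂ ≃ₜ ℂ) (H : OP h) (K : Set ℂ) (hK : IsClosed K) (hN : NoCpt K)
    (hinv : ∀ z, h z ∈ K ↔ z ∈ K) (hfix : ∀ z, h z = z → z ∈ K) (x : ℂ) (hx : x ∉ K)
    (hcomp : h x ∈ connectedComponentIn Kᶜ x)
    (hrec : ∀ ε > 0, ∃ N : ℕ, 2 ≤ N ∧ dist (h^[N] x) x < ε) : False := by
  set V := connectedComponentIn Kᶜ x with hVdef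
  have hVo : IsOpen V := hK.isOpen_compl.connectedComponentIn
  have hVK : V ⊆ Kᶜ := connectedComponentIn_subset _ _
  have hxV : x ∈ V := mem_connectedComponentIn hx
  obtain ⟨r, hr, hrV⟩ := Metric.nhds_basis_closedBall.mem_iff.1 (hVo.mem_nhds hxV)
  obtain ⟨Φ, hΦx, hΦV, hΦh⟩ := move_lemma V hVo isPreconnected_connectedComponentIn x hxV r hr _ hcomp
  have hΦK : ∀ z, Φ z ∈ K ↔ z ∈ K := by
    intro z
    constructor
    · intro hz
      have h1 : Φ (Φ z) = Φ z := hΦV _ (fun h => hVK h hz)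
      rw [← Φ.injective h1]; exact hz
    · intro hz
      rw [hΦV z (fun h => hVK h hz)]; exact hz
  have hΦsx : Φ.symm x = x := by rw [Homeomorph.symm_apply_eq, hΦx]
  set g : ℂ ≃ₜ ℂ := (Φ.symm.trans h).trans Φ with hg
  have hgz : ∀ z, g z = Φ (h (Φ.symm z)) := fun z => rfl
  have hgK : ∀ z, g z ∈ K ↔ z ∈ K := by
    intro z
    rw [hgz, hΦK, hinv, ← hΦK, Φ.apply_symm_apply]
  have hgpowK : ∀ (n : ℤ) z, (g ^ n) z ∈ K ↔ z ∈ K := by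
    intro n
    induction n using Int.induction_on with
    | zero => intro z; simp
    | succ n ih =>
      intro z
      rw [zpow_add, zpow_one]
      show (g ^ (n : ℤ)) (g z) ∈ K ↔ _
      rw [ih, hgK]
    | pred n ih =>
      intro z
      rw [← ih z, ← hgK]
      have : (g ^ (-(n : ℤ))) = g * (g ^ (-(n : ℤ) - 1)) := by
        rw [← zpow_one_add]; congr 1; ring
      rw [this]; rfl
  obtain ⟨δ, hδ, harc⟩ := arc_lemma g x r (by
    intro z hz hgz'
    have hzK : z ∉ K := hVK (hrV hz)
    apply hzK
    rw [← Φ.apply_symm_apply z, hΦK]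
    apply hfix
    rw [Homeomorph.eq_symm_apply, ← hgz, hgz']) (by rw [hgz, hΦsx]; exact hΦh)
  obtain ⟨ε, hε, hεb⟩ := Metric.continuousAt_iff.1 (Φ.continuous.continuousAt (x := x)) δ hδ
  obtain ⟨N, hN2, hNx⟩ := hrec ε hε
  have hy := hεb hNx
  rw [hΦx] at hy
  obtain ⟨X', hXc', hXs', hXloc', hXK', hXh', t0, ht0, hXt0'⟩ := harc _ hy
  set X : ℝ → ℂ := fun t => Φ.symm (X' t) with hX
  have hXc : Continuous X := Φ.symm.continuous.comp hXc'
  have hXs : ∀ t, X (t + 1) = h (X t) := by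
    intro t
    simp only [hX]
    rw [hXs', hgz, Φ.symm_apply_apply]
  have hXloc : ∀ t t', t < t' → t' - t ≤ 1 → X t ≠ X t' := fun t t' h1 h2 h3 =>
    hXloc' t t' h1 h2 (Φ.symm.injective h3)
  have hXK : ∀ t, X t ∉ K := by
    intro t hc
    obtain ⟨n, z, hz, e⟩ := hXK' t
    have : X' t ∈ K := by
      rw [← Φ.apply_symm_apply (X' t), hΦK]; exact hc
    rw [e, hgpowK] at this
    exact hVK (hrV hz) this
  have hXn : ∀ n : ℕ, ∀ t, X (t + n) = h^[n] (X t) := by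
    intro n
    induction n with
    | zero => intro t; simp
    | succ n ih =>
      intro t
      rw [Function.iterate_succ_apply', ← ih, ← hXs]; congr 1; push_cast; ring
  have hcross : X t0 = X (1/2 + N) := by
    rw [hXn]
    simp only [hX]
    rw [hXh', hXt0', hΦsx, Φ.symm_apply_apply]
  -- minimal lag
  set C : Set (ℝ × ℝ) := (Set.Icc 0 (N + 1 : ℝ) ×ˢ Set.Icc 0 (N + 1 : ℝ)) ∩ {p | p.1 + 1 ≤ p.2 ∧ X p.1 = X p.2} with hC
  have hCc : IsCompact C := by
    refine (isCompact_Icc.prod isCompact_Icc).inter_right ?_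
    refine IsClosed.and ?_ ?_
    · exact isClosed_le (by fun_prop) (by fun_prop)
    · exact isClosed_eq (by fun_prop) (by fun_prop)
  have hN2' : (2 : ℝ) ≤ N := by exact_mod_cast hN2
  have hCne : C.Nonempty := by
    refine ⟨(t0, 1/2 + N), ⟨⟨⟨?_, ?_⟩, ?_, ?_⟩, ?_, hcross⟩⟩ <;> simp only <;> linarith [ht0.1, ht0.2]
  obtain ⟨⟨σ, e⟩, ⟨⟨⟨hσ0, hσ1⟩, he0, he1⟩, hlag, hse⟩, hmin⟩ := hCc.exists_isMinOn hCne
    (f := fun p : ℝ × ℝ => p.2 - p.1) (by fun_prop)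
  simp only at hσ0 hσ1 he0 he1 hlag hse
  have hlag' : σ + 1 < e := by
    refine lt_of_le_of_ne hlag fun h => ?_
    exact hXloc σ e (by linarith) (by linarith) hse
  have hinj : ∀ s t, σ ≤ s → s < t → t < e → X s ≠ X t := by
    intro s t h1 h2 h3 h4
    rcases le_or_gt (t - s) 1 with h5 | h5
    · exact hXloc s t h2 h5 h4
    · have h6 : (s, t) ∈ C := by
        refine ⟨⟨⟨?_, ?_⟩, ?_, ?_⟩, ?_, h4⟩ <;> simp only <;> linarith
      have h7 : e - σ ≤ t - s := hmin h6
      linarith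
  have hvne : ∀ z, z ∉ K → h z - z ≠ 0 := fun z hz h0 => hz (hfix z (sub_eq_zero.1 h0))
  obtain ⟨l, hl, hle⟩ := log_univ (fun t : ℝ => h (X t) - X t)
    (by have := h.continuous; fun_prop) (fun t => hvne _ (hXK t))
  refine J_lemma H hXc hXs hXloc hlag' hse.symm hinj (D := l) hl.continuousOn
    (fun t _ => by rw [hle, hXs]) ?_
  exact G_lemma (v := fun z => h z - z) hK hN (h.continuous.sub continuous_id) hvne hXc (by linarith) hse.symm (fun t _ => hXK t)
    hl.continuousOn (fun t _ => hle t)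

end SphRec

namespace SphRec

lemma D_pair (h : ℂ → ℂ) (L : ℂ → ℂ → ℂ) (hLc : ContinuousOn (fun p : ℂ × ℂ => L p.1 p.2) {p | p.1 ≠ p.2})
    (hLe : ∀ x y, x ≠ y → Complex.exp (L x y) * (x - y) = h x - h y) (hLs : ∀ x y, x ≠ y → L x y = L y x)
    (α β U U' W W' : ℝ → ℂ) (y : ℂ) (hα : Continuous α) (hβ : Continuous β)
    (hα0 : α 0 = y) (hβ0 : β 0 = y)
    (hαh : ∀ t ∈ Set.Icc (0:ℝ) 1, α (3 - t) = h (α t)) (hβh : ∀ t ∈ Set.Icc (0:ℝ) 1, β (3 - t) = h (β t))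
    (hdis : ∀ s ∈ Set.Icc (0:ℝ) 3, ∀ t ∈ Set.Icc (0:ℝ) 3, α s = β t → (s = 0 ∧ t = 0) ∨ (s = 3 ∧ t = 3))
    (hU : ContinuousOn U (Set.Icc 1 3)) (hUe : ∀ t ∈ Set.Icc (1:ℝ) 3, Complex.exp (U t) = α t - y)
    (hU' : ContinuousOn U' (Set.Icc 1 3)) (hUe' : ∀ t ∈ Set.Icc (1:ℝ) 3, Complex.exp (U' t) = β t - y)
    (hW : ContinuousOn W (Set.Icc 0 2)) (hWe : ∀ t ∈ Set.Icc (0:ℝ) 2, Complex.exp (W t) = α t - h y)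
    (hW' : ContinuousOn W' (Set.Icc 0 2)) (hWe' : ∀ t ∈ Set.Icc (0:ℝ) 2, Complex.exp (W' t) = β t - h y) :
    ∃ c : ℂ, Complex.exp c = - (β 1 - y) / (α 1 - y) ∧
      2 * c = (L (α 1) y + (U 3 - U 1) - (W 2 - W 0)) - (L (β 1) y + (U' 3 - U' 1) - (W' 2 - W' 0)) := by
  set S : Set (ℝ × ℝ) := {p | 0 ≤ p.1 ∧ p.1 ≤ 3 ∧ 0 ≤ p.2 ∧ p.2 ≤ 3 ∧ 0 < p.1 + p.2 ∧ p.1 + p.2 < 6} with hS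
  have hSc : Convex ℝ S := by
    rintro ⟨p1, p2⟩ ⟨a1, a2, a3, a4, a5, a6⟩ ⟨q1, q2⟩ ⟨b1, b2, b3, b4, b5, b6⟩ m n hm hn hmn
    simp only at a1 a2 a3 a4 a5 a6 b1 b2 b3 b4 b5 b6
    obtain rfl : n = 1 - m := by linarith
    have key : ∀ u v c : ℝ, c < u → c < v → c < m * u + (1 - m) * v := by
      intro u v c hu hv
      rcases hm.eq_or_lt with h | h
      · rw [← h]; linarith
      · nlinarith
    refine ⟨?_, ?_, ?_, ?_, ?_, ?_⟩ <;> simp only [Prod.smul_mk, Prod.mk_add_mk, smul_eq_mul]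
    · positivity
    · nlinarith
    · positivity
    · nlinarith
    · have := key _ _ _ a5 b5; linarith
    · have := key (-(p1 + p2)) (-(q1 + q2)) (-6) (by linarith) (by linarith); linarith
  have hα3 : α 3 = h y := by have := hαh 0 (by simp); simpa [hα0] using this
  have hβ3 : β 3 = h y := by have := hβh 0 (by simp); simpa [hβ0] using this
  have hne : ∀ p ∈ S, β p.2 - α p.1 ≠ 0 := by
    rintro ⟨s, t⟩ ⟨a1, a2, a3, a4, a5, a6⟩ h0
    simp only at a1 a2 a3 a4 a5 a6 h0
    rcases hdis s ⟨a1, a2⟩ t ⟨a3, a4⟩ (sub_eq_zero.1 h0).symm with h | h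
    · rw [h.1, h.2] at a5; simp at a5
    · rw [h.1, h.2] at a6; norm_num at a6
  obtain ⟨Φ, hΦ, hΦe⟩ := log_convex hSc (fun p : ℝ × ℝ => β p.2 - α p.1) (by fun_prop) hne
  have mk : ∀ s t : ℝ, 0 ≤ s → s ≤ 3 → 0 ≤ t → t ≤ 3 → 0 < s + t → s + t < 6 → (s, t) ∈ S :=
    fun s t h1 h2 h3 h4 h5 h6 => ⟨h1, h2, h3, h4, h5, h6⟩
  have hexp : ∀ s t : ℝ, (s, t) ∈ S → Complex.exp (Φ (s, t)) = β t - α s := fun s t hst => hΦe _ hst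
  have I13 : IsPreconnected (Set.Icc (1:ℝ) 3) := isPreconnected_Icc
  have I02 : IsPreconnected (Set.Icc (0:ℝ) 2) := isPreconnected_Icc
  -- edges
  have ed1 : Φ (3, 0) - Φ (1, 0) = U 3 - U 1 := by
    have c1 : ContinuousOn (fun s : ℝ => Φ (s, 0) + Real.pi * Complex.I) (Set.Icc 1 3) :=
      (hΦ.comp (f := fun s : ℝ => (s, (0:ℝ))) (by fun_prop) (fun s hs => mk _ _ (by linarith [hs.1]) (by linarith [hs.2]) (by norm_num) (by norm_num)
        (by linarith [hs.1]) (by linarith [hs.2]))).add continuousOn_const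
    have := log_sub_const I13 c1 hU (fun s hs => by
      rw [hUe s hs, Complex.exp_add, Complex.exp_pi_mul_I, hexp _ _ (mk _ _ (by linarith [hs.1]) (by linarith [hs.2]) (by norm_num) (by norm_num)
        (by linarith [hs.1]) (by linarith [hs.2])), hβ0]; ring) (x := 3) (y := 1) (by norm_num) (by norm_num)
    linear_combination this
  have ed2 : Φ (3, 2) - Φ (3, 0) = W' 2 - W' 0 := by
    have hm : ∀ t ∈ Set.Icc (0:ℝ) 2, ((3:ℝ), t) ∈ S := fun t ht => mk _ _ (by norm_num) (by norm_num) ht.1 (by linarith [ht.2])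
        (by linarith [ht.1]) (by linarith [ht.2])
    have c1 : ContinuousOn (fun t : ℝ => Φ (3, t)) (Set.Icc 0 2) :=
      hΦ.comp (f := fun t : ℝ => ((3:ℝ), t)) (by fun_prop) hm
    have := log_sub_const I02 c1 hW' (fun t ht => by
      rw [hWe' t ht, hexp _ _ (hm t ht), hα3]) (x := 2) (y := 0) (by norm_num) (by norm_num)
    linear_combination this
  have ed3 : Φ (0, 3) - Φ (0, 1) = U' 3 - U' 1 := by
    have hm : ∀ t ∈ Set.Icc (1:ℝ) 3, ((0:ℝ), t) ∈ S := fun t ht => mk _ _ (by norm_num) (by norm_num) (by linarith [ht.1]) (by linarith [ht.2])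
        (by linarith [ht.1]) (by linarith [ht.2])
    have c1 : ContinuousOn (fun t : ℝ => Φ (0, t)) (Set.Icc 1 3) :=
      hΦ.comp (f := fun t : ℝ => ((0:ℝ), t)) (by fun_prop) hm
    have := log_sub_const I13 c1 hU' (fun t ht => by
      rw [hUe' t ht, hexp _ _ (hm t ht), hα0]) (x := 3) (y := 1) (by norm_num) (by norm_num)
    linear_combination this
  have ed4 : Φ (2, 3) - Φ (0, 3) = W 2 - W 0 := by
    have hm : ∀ t ∈ Set.Icc (0:ℝ) 2, (t, (3:ℝ)) ∈ S := fun t ht => mk _ _ ht.1 (by linarith [ht.2]) (by norm_num) (by norm_num) 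
        (by linarith [ht.1]) (by linarith [ht.2])
    have c1 : ContinuousOn (fun t : ℝ => Φ (t, 3) + Real.pi * Complex.I) (Set.Icc 0 2) :=
      (hΦ.comp (f := fun t : ℝ => (t, (3:ℝ))) (by fun_prop) hm).add continuousOn_const
    have := log_sub_const I02 c1 hW (fun t ht => by
      rw [hWe t ht, Complex.exp_add, Complex.exp_pi_mul_I, hexp _ _ (hm t ht), hβ3]; ring) (x := 2) (y := 0) (by norm_num) (by norm_num)
    linear_combination this
  -- corner
  have hα1 : y ≠ α 1 := by
    intro e
    rcases hdis 1 (by norm_num) 0 (by norm_num) (by rw [hβ0, e]) with h | h <;> norm_num at h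
  have hβ1 : β 1 ≠ y := by
    intro e
    rcases hdis 0 (by norm_num) 1 (by norm_num) (by rw [hα0, e]) with h | h <;> norm_num at h
  have cor : Φ (2, 3) - Φ (3, 2) = L y (α 1) - L (β 1) y + (Φ (1, 0) - Φ (0, 1)) := by
    -- segment from (1,0) to (0,1)
    have I01 : IsPreconnected (Set.Icc (0:ℝ) 1) := isPreconnected_Icc
    have hm1 : ∀ t ∈ Set.Icc (0:ℝ) 1, ((1 - t : ℝ), t) ∈ S := fun t ht => mk _ _ (by linarith [ht.2]) (by linarith [ht.1])
      ht.1 (by linarith [ht.2]) (by linarith) (by linarith)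
    have hm2 : ∀ t ∈ Set.Icc (0:ℝ) 1, ((3 - (1 - t) : ℝ), 3 - t) ∈ S := fun t ht => mk _ _ (by linarith [ht.1]) (by linarith [ht.2])
      (by linarith [ht.2]) (by linarith [ht.1]) (by linarith) (by linarith)
    have hnn : ∀ t ∈ Set.Icc (0:ℝ) 1, β t ≠ α (1 - t) := fun t ht => sub_ne_zero.1 (hne _ (hm1 t ht))
    have c1 : ContinuousOn (fun t : ℝ => Φ (3 - (1 - t), 3 - t)) (Set.Icc 0 1) :=
      hΦ.comp (f := fun t : ℝ => ((3 - (1 - t) : ℝ), 3 - t)) (by fun_prop) hm2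
    have c2 : ContinuousOn (fun t : ℝ => L (β t) (α (1 - t)) + Φ (1 - t, t)) (Set.Icc 0 1) := by
      refine ContinuousOn.add ?_ ?_
      · exact hLc.comp (f := fun t : ℝ => (β t, α (1 - t))) (by fun_prop) hnn
      · exact hΦ.comp (f := fun t : ℝ => ((1 - t : ℝ), t)) (by fun_prop) hm1
    have := log_sub_const I01 c1 c2 (fun t ht => by
      rw [hexp _ _ (hm2 t ht), Complex.exp_add, hexp _ _ (hm1 t ht), hLe _ _ (hnn t ht), hβh t ht,
        hαh (1 - t) ⟨by linarith [ht.2], by linarith [ht.1]⟩]) (x := 0) (y := 1) (by norm_num) (by norm_num)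
    norm_num [hα0, hβ0] at this
    linear_combination this
  refine ⟨Φ (0, 1) - Φ (1, 0), ?_, ?_⟩
  · rw [Complex.exp_sub, hexp _ _ (mk _ _ (by norm_num) (by norm_num) (by norm_num) (by norm_num) (by norm_num) (by norm_num)),
      hexp _ _ (mk _ _ (by norm_num) (by norm_num) (by norm_num) (by norm_num) (by norm_num) (by norm_num)), hα0, hβ0,
      ← neg_sub (α 1) y, div_neg, neg_div]
  · rw [hLs y (α 1) hα1] at cor
    linear_combination ed1 + ed2 - ed3 - ed4 + cor

lemma D_lemma {h : ℂ → ℂ} (H : OP h) (α : Fin 3 → ℝ → ℂ) (y : ℂ) (hα : ∀ i, Continuous (α i))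
    (hα0 : ∀ i, α i 0 = y)
    (hαh : ∀ i, ∀ t ∈ Set.Icc (0:ℝ) 1, α i (3 - t) = h (α i t))
    (hdis : ∀ i j, i ≠ j → ∀ s ∈ Set.Icc (0:ℝ) 3, ∀ t ∈ Set.Icc (0:ℝ) 3, α i s = α j t →
      (s = 0 ∧ t = 0) ∨ (s = 3 ∧ t = 3)) : False := by
  obtain ⟨L, hLc, hLe, hLs⟩ := H.symm_log
  have hα3 : ∀ i, α i 3 = h y := by
    intro i
    have := hαh i 0 (by simp); simpa [hα0] using this
  have hney : ∀ i, ∀ t ∈ Set.Icc (1:ℝ) 3, α i t - y ≠ 0 := by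
    intro i t ht h0
    obtain ⟨j, hj⟩ : ∃ j, i ≠ j := ⟨i + 1, by fin_cases i <;> decide⟩
    rcases hdis i j hj t ⟨by linarith [ht.1], ht.2⟩ 0 (by norm_num) (by rw [hα0, sub_eq_zero.1 h0]) with h | h
    · linarith [ht.1, h.1]
    · linarith [h.2]
  have hneh : ∀ i, ∀ t ∈ Set.Icc (0:ℝ) 2, α i t - h y ≠ 0 := by
    intro i t ht h0
    obtain ⟨j, hj⟩ : ∃ j, i ≠ j := ⟨i + 1, by fin_cases i <;> decide⟩
    rcases hdis i j hj t ⟨by linarith [ht.1], by linarith [ht.2]⟩ 3 (by norm_num) (by rw [hα3, sub_eq_zero.1 h0]) with h | h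
    · linarith [h.2]
    · linarith [ht.2, h.1]
  choose U hU hUe using fun i => log_convex (convex_Icc (1:ℝ) 3) (fun t => α i t - y)
    ((hα i).sub continuous_const).continuousOn (hney i)
  choose W hW hWe using fun i => log_convex (convex_Icc (0:ℝ) 2) (fun t => α i t - h y)
    ((hα i).sub continuous_const).continuousOn (hneh i)
  have P : ∀ i j, i ≠ j → _ := fun i j hij => D_pair h L hLc hLe hLs (α i) (α j) (U i) (U j) (W i) (W j) y (hα i) (hα j) (hα0 i) (hα0 j)
    (hαh i) (hαh j) (hdis i j hij) (hU i) (hUe i) (hU j) (hUe j) (hW i) (hWe i) (hW j) (hWe j)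
  obtain ⟨c, c1, c2⟩ := P 0 1 (by decide)
  obtain ⟨d, d1, d2⟩ := P 1 2 (by decide)
  obtain ⟨e, e1, e2⟩ := P 2 0 (by decide)
  have h0 : c + d + e = 0 := by linear_combination (c2 + d2 + e2) / 2
  have h1 : Complex.exp (c + d + e) = -1 := by
    rw [Complex.exp_add, Complex.exp_add, c1, d1, e1]
    have n0 := hney 0 1 (by norm_num)
    have n1 := hney 1 1 (by norm_num)
    have n2 := hney 2 1 (by norm_num)
    field_simp
  rw [h0, Complex.exp_zero] at h1
  norm_num at h1

end SphRec

namespace SphRec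

section
variable {X : Type*} [TopologicalSpace X] [T2Space X] [CompactSpace X]

lemma clop_lemma {K : Set X} (hK : IsClosed K) {u : X} (hu : u ∈ K) {Q : Set X} (hQ : IsClosed Q)
    (hd : Disjoint (connectedComponentIn K u) Q) :
    ∃ A ⊆ K, u ∈ A ∧ IsClosed A ∧ IsClosed (K \ A) ∧ Disjoint A Q := by
  have : CompactSpace K := isCompact_iff_compactSpace.1 hK.isCompact
  have hc := connectedComponent_eq_iInter_isClopen (⟨u, hu⟩ : K)
  rw [connectedComponentIn_eq_image hu, hc] at hd
  have hQ' : IsCompact ((↑) ⁻¹' Q : Set K) := (hQ.preimage continuous_subtype_val).isCompact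
  have : Nonempty { s : Set K // IsClopen s ∧ (⟨u, hu⟩ : K) ∈ s } := ⟨⟨Set.univ, isClopen_univ, trivial⟩⟩
  obtain ⟨⟨A, hA, huA⟩, hAQ⟩ := hQ'.elim_directed_family_closed (ι := { s : Set K // IsClopen s ∧ (⟨u, hu⟩ : K) ∈ s }) 
    (fun s => s.1) (fun s => s.2.1.isClosed) (by
      rw [Set.eq_empty_iff_forall_notMem]
      rintro z ⟨hz1, hz2⟩
      exact Set.disjoint_left.1 hd ⟨z, hz2, rfl⟩ hz1) (by
      rintro ⟨s, hs, hs'⟩ ⟨t, ht, ht'⟩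
      exact ⟨⟨s ∩ t, hs.inter ht, hs', ht'⟩, Set.inter_subset_left, Set.inter_subset_right⟩)
  refine ⟨(↑) '' A, by rintro _ ⟨z, -, rfl⟩; exact z.2, ⟨_, huA, rfl⟩, ?_, ?_, ?_⟩
  · exact hK.isClosedEmbedding_subtypeVal.isClosedMap _ hA.isClosed
  · have : K \ ((↑) '' A) = ((↑) '' (Aᶜ : Set K) : Set X) := by
      ext z
      constructor
      · rintro ⟨h1, h2⟩
        exact ⟨⟨z, h1⟩, fun h => h2 ⟨_, h, rfl⟩, rfl⟩
      · rintro ⟨w, hw, rfl⟩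
        refine ⟨w.2, ?_⟩
        rintro ⟨w', hw', e⟩
        exact hw (Subtype.ext e ▸ hw')
    rw [this]
    exact hK.isClosedEmbedding_subtypeVal.isClosedMap _ hA.isOpen.isClosed_compl
  · rw [Set.disjoint_left]
    rintro _ ⟨z, hz, rfl⟩ hzQ
    have : z ∈ ((↑) ⁻¹' Q : Set K) ∩ A := ⟨hzQ, hz⟩
    rw [show ((↑) ⁻¹' Q : Set K) ∩ A = ∅ from hAQ] at this
    exact this

lemma bump {D : Set X} (hD : IsClosed D) (hDc : IsPreconnected D) {U : Set X} (hU : IsOpen U) {u : X} (hu : u ∈ D)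
    (huU : u ∉ U) (hDU : (D ∩ U).Nonempty) : (connectedComponentIn (D \ U) u ∩ closure U).Nonempty := by
  by_contra hcon
  rw [Set.not_nonempty_iff_eq_empty, ← Set.disjoint_iff_inter_eq_empty] at hcon
  have hDU' : IsClosed (D \ U) := hD.sdiff hU
  obtain ⟨A, hAK, huA, hA1, hA2, hA3⟩ := clop_lemma hDU' (⟨hu, huU⟩ : u ∈ D \ U) isClosed_closure hcon
  have := isPreconnected_closed_iff.1 hDc A (((D \ U) \ A) ∪ closure U) hA1 (hA2.union isClosed_closure) (by
    intro z hz
    by_cases h1 : z ∈ A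
    · exact Or.inl h1
    · by_cases h2 : z ∈ U
      · exact Or.inr (Or.inr (subset_closure h2))
      · exact Or.inr (Or.inl ⟨⟨hz, h2⟩, h1⟩)) ⟨u, hu, huA⟩ (by
      obtain ⟨z, hz1, hz2⟩ := hDU
      exact ⟨z, hz1, Or.inr (subset_closure hz2)⟩)
  obtain ⟨z, -, hz1, hz2 | hz2⟩ := this
  · exact hz2.2 hz1
  · exact Set.disjoint_left.1 hA3 hz1 hz2

lemma nested {ι : Type*} [Nonempty ι] (V : ι → Set X) (hV : Directed (· ⊇ ·) V) (hc : ∀ i, IsClosed (V i))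
    (hp : ∀ i, IsPreconnected (V i)) : IsPreconnected (⋂ i, V i) := by
  rw [isPreconnected_iff_subset_of_fully_disjoint_closed (isClosed_iInter hc)]
  intro u v hu hv huv hd
  obtain ⟨U1, U2, hU1, hU2, h1, h2, h12⟩ := (normal_separation hu hv hd)
  obtain ⟨i, hi⟩ := exists_subset_nhds_of_isCompact (U := U1 ∪ U2) hV (fun i => (hc i).isCompact) (by
    intro z hz
    refine (hU1.union hU2).mem_nhds ?_
    rcases huv hz with h | h
    · exact Or.inl (h1 h)
    · exact Or.inr (h2 h))
  rcases (hp i).subset_or_subset hU1 hU2 h12 hi with h | h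
  · left
    intro z hz
    rcases huv hz with h' | h'
    · exact h'
    · exact absurd (h2 h') (Set.disjoint_left.1 h12 (h (Set.mem_iInter.1 hz i)))
  · right
    intro z hz
    rcases huv hz with h' | h'
    · exact absurd (h (Set.mem_iInter.1 hz i)) (Set.disjoint_left.1 h12 (h1 h'))
    · exact h'

lemma isClosed_compIn {K : Set X} (hK : IsClosed K) (u : X) : IsClosed (connectedComponentIn K u) := by
  by_cases hu : u ∈ K
  · have h1 : closure (connectedComponentIn K u) ⊆ K :=
      closure_minimal (connectedComponentIn_subset _ _) hK
    have h2 : closure (connectedComponentIn K u) ⊆ connectedComponentIn K u :=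
      isPreconnected_connectedComponentIn.closure.subset_connectedComponentIn
        (subset_closure (mem_connectedComponentIn hu)) h1
    exact isClosed_of_closure_subset h2
  · rw [connectedComponentIn_eq_empty hu]; exact isClosed_empty

end

/-- recurrence -/
def Rec {X : Type*} [MetricSpace X] (f : X → X) : Prop :=
  ∀ ε > 0, ∀ m : ℕ, ∃ n ≥ m, ∀ x, dist (f^[n] x) x < ε

section
variable {X : Type*} [MetricSpace X] 

lemma Rec.back {f : X ≃ₜ X} (hf : Rec f) {C : Set X} (hC : IsClosed C) (h : ∀ z ∈ C, f z ∈ C) :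
    ∀ z ∈ C, f.symm z ∈ C := by
  intro z hz
  rw [← hC.closure_eq, Metric.mem_closure_iff]
  intro ε hε
  obtain ⟨n, hn, hx⟩ := hf ε hε 1
  have hit : ∀ m : ℕ, f^[m] z ∈ C := by
    intro m
    induction m with
    | zero => simpa
    | succ m ih => rw [Function.iterate_succ_apply']; exact h _ ih
  obtain ⟨m, rfl⟩ : ∃ m, n = m + 1 := ⟨n - 1, by omega⟩
  refine ⟨f^[m] z, hit m, ?_⟩
  have := hx (f.symm z)
  rw [Function.iterate_succ_apply, f.apply_symm_apply, dist_comm] at this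
  exact this

lemma Rec.symm {f : X ≃ₜ X} (hf : Rec f) : Rec f.symm := by
  intro ε hε m
  obtain ⟨n, hn, hx⟩ := hf ε hε m
  refine ⟨n, hn, fun x => ?_⟩
  have := hx (f.symm^[n] x)
  rw [Function.LeftInverse.iterate f.apply_symm_apply n x, dist_comm] at this
  exact this

variable [CompactSpace X]

lemma C_lemma {f : X ≃ₜ X} (hf : Rec f) {Z : Set X} (hZ : IsClosed Z) (hZc : IsPreconnected Z)
    (hZf : ∀ z, f z ∈ Z ↔ z ∈ Z) {u : X} (hu : u ∈ Z) (hfu : f u = u) {B : Set X} (hB : IsOpen B)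
    (hBZ : (Z ∩ B).Nonempty) (huB : u ∉ B) :
    (connectedComponentIn {z | z ∈ Z ∧ ∀ i : ℕ, f^[i] z ∉ B} u ∩ closure B).Nonempty := by
  set Zn : ℕ → Set X := fun n => {z | z ∈ Z ∧ ∀ i ≤ n, f^[i] z ∉ B} with hZn
  have fic : ∀ i : ℕ, Continuous (f^[i]) := fun i => f.continuous.iterate i
  set Un : ℕ → Set X := fun n => ⋃ i ∈ Set.Iic n, f^[i] ⁻¹' B with hUn
  have hUno : ∀ n, IsOpen (Un n) := fun n => isOpen_biUnion fun i _ => hB.preimage (fic i)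
  have hZU : ∀ n, Zn n = Z \ Un n := by
    intro n; ext z
    simp only [hZn, hUn, Set.mem_ofPred_eq, Set.mem_sdiff, Set.mem_iUnion, Set.mem_Iic, Set.mem_preimage, exists_prop, not_exists, not_and]
  have hZnc : ∀ n, IsClosed (Zn n) := fun n => by rw [hZU]; exact hZ.sdiff (hUno n)
  have hfiu : ∀ i : ℕ, f^[i] u = u := fun i => Function.iterate_fixed hfu i
  have huZ : ∀ n, u ∈ Zn n := fun n => ⟨hu, fun i _ => by rw [hfiu]; exact huB⟩
  set Cn : ℕ → Set X := fun n => connectedComponentIn (Zn n) u with hCn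
  have hCnc : ∀ n, IsClosed (Cn n) := fun n => isClosed_compIn (hZnc n) u
  have hCnp : ∀ n, IsPreconnected (Cn n) := fun n => isPreconnected_connectedComponentIn
  have huC : ∀ n, u ∈ Cn n := fun n => mem_connectedComponentIn (huZ n)
  have hCZ : ∀ n, Cn n ⊆ Zn n := fun n => connectedComponentIn_subset _ _
  have main : ∀ n, (Cn n ∩ closure B).Nonempty := by
    intro n
    by_contra hcon
    -- D = f ⁻¹ C_n
    have hback : ∀ z ∈ Cn n, f.symm z ∈ Cn n := by
      set D := f.symm '' Cn n with hD
      have hDc : IsClosed D := f.symm.isClosedMap _ (hCnc n)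
      have hDp : IsPreconnected D := (hCnp n).image _ f.symm.continuous.continuousOn
      have huD : u ∈ D := ⟨u, huC n, by rw [Homeomorph.symm_apply_eq, hfu]⟩
      have hDZ : ∀ z ∈ D, z ∈ Z ∧ ∀ i ≤ n, f^[i] (f z) ∉ B := by
        rintro _ ⟨w, hw, rfl⟩
        obtain ⟨h1, h2⟩ := hCZ n hw
        refine ⟨by rw [← hZf, f.apply_symm_apply]; exact h1, ?_⟩
        rw [f.apply_symm_apply]; exact h2
      have hDn : ∀ z ∈ D, z ∉ B → z ∈ Zn n := by
        intro z hz hzB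
        refine ⟨(hDZ z hz).1, fun i hi => ?_⟩
        rcases i with _ | i
        · simpa using hzB
        · rw [Function.iterate_succ_apply]; exact (hDZ z hz).2 i (by omega)
      have hDB : D ∩ B = ∅ := by
        rw [← Set.not_nonempty_iff_eq_empty]
        intro hne
        obtain ⟨z, hz1, hz2⟩ := bump hDc hDp hB huD huB hne
        refine hcon ⟨z, ?_, hz2⟩
        have : connectedComponentIn (D \ B) u ⊆ Cn n :=
          isPreconnected_connectedComponentIn.subset_connectedComponentIn
            (mem_connectedComponentIn ⟨huD, huB⟩) (fun w hw => by
              have := connectedComponentIn_subset _ _ hw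
              exact hDn w this.1 this.2)
        exact this hz1
      have hDC : D ⊆ Cn n := hDp.subset_connectedComponentIn huD (fun z hz => hDn z hz (fun hzB => by
        have : z ∈ D ∩ B := ⟨hz, hzB⟩
        rw [hDB] at this; exact this))
      exact fun z hz => hDC ⟨z, hz, rfl⟩
    have hfor : ∀ z ∈ Cn n, f z ∈ Cn n := hf.symm.back (hCnc n) hback
    have hfor' : ∀ i : ℕ, ∀ z ∈ Cn n, f^[i] z ∈ Cn n := by
      intro i
      induction i with
      | zero => intro z hz; simpa
      | succ i ih => intro z hz; rw [Function.iterate_succ_apply]; exact ih _ (hfor z hz)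
    have hb : (connectedComponentIn (Z \ Un n) u ∩ closure (Un n)).Nonempty := by
      refine bump hZ hZc (hUno n) hu ?_ ?_
      · have := huZ n; rw [hZU] at this; exact this.2
      · obtain ⟨z, hz1, hz2⟩ := hBZ
        refine ⟨z, hz1, ?_⟩
        simp only [hUn, Set.mem_iUnion]
        exact ⟨0, by simp, by simpa using hz2⟩
    rw [← hZU] at hb
    obtain ⟨z, hz1, hz2⟩ := hb
    have hcl : closure (Un n) = ⋃ i ∈ Set.Iic n, closure (f^[i] ⁻¹' B) := by
      simp only [hUn]
      exact (Set.finite_Iic n).closure_biUnion _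
    rw [hcl] at hz2
    simp only [Set.mem_iUnion] at hz2
    obtain ⟨i, -, hz3⟩ := hz2
    exact hcon ⟨f^[i] z, hfor' i z hz1, (fic i).closure_preimage_subset B hz3⟩
  have hanti : Antitone Cn := by
    intro m n hmn
    refine connectedComponentIn_mono u ?_
    rintro z ⟨h1, h2⟩
    exact ⟨h1, fun i hi => h2 i (hi.trans hmn)⟩
  have hdir : Directed (· ⊇ ·) Cn := hanti.directed_ge
  have hI := nested Cn hdir hCnc hCnp
  have hsub : (⋂ n, Cn n) ⊆ connectedComponentIn {z | z ∈ Z ∧ ∀ i : ℕ, f^[i] z ∉ B} u := by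
    refine hI.subset_connectedComponentIn (Set.mem_iInter.2 huC) ?_
    intro z hz
    rw [Set.mem_iInter] at hz
    exact ⟨(hCZ 0 (hz 0)).1, fun i => (hCZ i (hz i)).2 i le_rfl⟩
  have hne : (⋂ n, (Cn n ∩ closure B)).Nonempty := by
    refine IsCompact.nonempty_iInter_of_directed_nonempty_isCompact_isClosed _ ?_ main 
      (fun n => ((hCnc n).inter isClosed_closure).isCompact) (fun n => (hCnc n).inter isClosed_closure)
    exact Antitone.directed_ge (fun m n hmn => Set.inter_subset_inter_left _ (hanti hmn))
  obtain ⟨z, hz⟩ := hne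
  rw [Set.mem_iInter] at hz
  exact ⟨z, hsub (Set.mem_iInter.2 fun n => (hz n).1), (hz 0).2⟩

lemma C_inv {f : X ≃ₜ X} (hf : Rec f) {Z : Set X} (hZ : IsClosed Z) 
    (hZf : ∀ z, f z ∈ Z ↔ z ∈ Z) {u : X} (hu : u ∈ Z) (hfu : f u = u) {B : Set X} (hB : IsOpen B)
    (huB : u ∉ B) :
    IsClosed (connectedComponentIn {z | z ∈ Z ∧ ∀ i : ℕ, f^[i] z ∉ B} u) ∧
    u ∈ (connectedComponentIn {z | z ∈ Z ∧ ∀ i : ℕ, f^[i] z ∉ B} u) ∧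
    ∀ z, f z ∈ (connectedComponentIn {z | z ∈ Z ∧ ∀ i : ℕ, f^[i] z ∉ B} u) ↔
      z ∈ (connectedComponentIn {z | z ∈ Z ∧ ∀ i : ℕ, f^[i] z ∉ B} u) := by
  set W := {z | z ∈ Z ∧ ∀ i : ℕ, f^[i] z ∉ B} with hW
  have hWc : IsClosed W := by
    have : W = Z ∩ ⋂ i : ℕ, (f^[i] ⁻¹' B)ᶜ := by
      ext z; simp [hW]
    rw [this]
    exact hZ.inter (isClosed_iInter fun i => (hB.preimage (f.continuous.iterate i)).isClosed_compl)
  have huW : u ∈ W := ⟨hu, fun i => by rw [Function.iterate_fixed hfu]; exact huB⟩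
  have hC := isClosed_compIn hWc u
  have huC : u ∈ connectedComponentIn W u := mem_connectedComponentIn huW
  have hfor : ∀ z ∈ connectedComponentIn W u, f z ∈ connectedComponentIn W u := by
    have : f '' connectedComponentIn W u ⊆ connectedComponentIn W u := by
      refine (isPreconnected_connectedComponentIn.image _ f.continuous.continuousOn).subset_connectedComponentIn
        ⟨u, huC, hfu⟩ ?_
      rintro _ ⟨z, hz, rfl⟩
      obtain ⟨h1, h2⟩ := connectedComponentIn_subset _ _ hz
      exact ⟨(hZf z).2 h1, fun i => by rw [← Function.iterate_succ_apply]; exact h2 _⟩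
    exact fun z hz => this ⟨z, hz, rfl⟩
  refine ⟨hC, huC, fun z => ⟨fun h => ?_, hfor z⟩⟩
  have := hf.back hC hfor _ h
  rwa [f.symm_apply_apply] at this

end

end SphRec

namespace SphRec

lemma NoCpt_of_continuum {X : Type*} [TopologicalSpace X] [T2Space X] {ι : ℂ → X} (hι : IsOpenEmbedding ι)
    {P : X} (hP : ∀ z, ι z ≠ P) {C : Set X} (hC : IsClosed C) (hCc : IsPreconnected C) (hPC : P ∈ C) :
    NoCpt (ι ⁻¹' C) := by
  intro S U hU hS hSc
  by_contra hne
  obtain ⟨z, hz⟩ := Set.nonempty_iff_ne_empty.2 hne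
  have h1 : IsClosed (ι '' S) := (hSc.image hι.continuous).isClosed
  have h2 : IsClosed (C \ ι '' U) := hC.sdiff (hι.isOpenMap _ hU)
  have hzS := hz
  rw [hS] at hzS
  obtain ⟨w, -, hw1, hw2⟩ := isPreconnected_closed_iff.1 hCc _ _ h1 h2 (by
    intro w hw
    by_cases h : w ∈ ι '' U
    · obtain ⟨v, hv, rfl⟩ := h
      left
      exact ⟨v, by rw [hS]; exact ⟨hw, hv⟩, rfl⟩
    · exact Or.inr ⟨hw, h⟩) ⟨ι z, hzS.1, ⟨z, hz, rfl⟩⟩ ⟨P, hPC, hPC, by rintro ⟨v, -, hv⟩; exact hP v hv⟩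
  obtain ⟨v, hv, rfl⟩ := hw1
  rw [hS] at hv
  exact hw2.2 ⟨v, hv.2, rfl⟩

lemma far_preconn {M : ℝ} (hM : 0 < M) : IsPreconnected {z : ℂ | M < ‖z‖} := by
  have : {z : ℂ | M < ‖z‖} = Complex.exp '' {ζ : ℂ | Real.log M < ζ.re} := by
    ext z
    constructor
    · intro hz
      have hz' : M < ‖z‖ := hz
      have hz0 : z ≠ 0 := fun h => by rw [h, norm_zero] at hz'; linarith
      refine ⟨Complex.log z, ?_, Complex.exp_log hz0⟩
      show Real.log M < (Complex.log z).re
      rw [Complex.log_re]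
      exact Real.log_lt_log hM hz'
    · rintro ⟨ζ, hζ, rfl⟩
      show M < ‖Complex.exp ζ‖
      rw [Complex.norm_exp]
      exact (Real.log_lt_iff_lt_exp hM).1 hζ
  rw [this]
  exact (convex_halfSpace_re_gt _).isPreconnected.image _ Complex.continuous_exp.continuousOn

lemma far_comp {K Q : Set ℂ} (hK : IsClosed K) (hN : NoCpt K) (hQ : IsCompact Q) (hd : Disjoint Q K) {e : ℂ} (he : e ∈ K)
    {M : ℝ} (hM : 0 < M) (hQM : ∀ z ∈ Q, ‖z‖ ≤ M) : {z : ℂ | M < ‖z‖} ⊆ connectedComponentIn Qᶜ e := by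
  set W := connectedComponentIn Qᶜ e with hW
  have heQ : e ∈ Qᶜ := fun h => Set.disjoint_left.1 hd h he
  have hWo : IsOpen W := hQ.isClosed.isOpen_compl.connectedComponentIn
  have hfar : {z : ℂ | M < ‖z‖} ⊆ Qᶜ := fun z hz hzQ => absurd (hQM z hzQ) (not_le.2 hz)
  by_cases hne : ∃ p ∈ W, M < ‖p‖
  · obtain ⟨p, hpW, hp⟩ := hne
    have : W = connectedComponentIn Qᶜ p := connectedComponentIn_eq hpW
    rw [this]
    exact (far_preconn hM).subset_connectedComponentIn hp hfar
  · push Not at hne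
    exfalso
    have hcpt : IsCompact (K ∩ W) := by
      have hcl : IsClosed (K ∩ W) := by
        refine isClosed_of_closure_subset fun z hz => ?_
        have h1 : z ∈ K := closure_minimal Set.inter_subset_left hK hz
        refine ⟨h1, ?_⟩
        exact mem_comp_of_mem_closure hQ.isClosed.isOpen_compl (closure_mono Set.inter_subset_right hz)
          (fun h => Set.disjoint_left.1 hd h h1)
      refine (isCompact_closedBall (0:ℂ) M).of_isClosed_subset hcl ?_
      rintro z ⟨-, hz⟩
      simpa using hne z hz
    have := hN _ W hWo rfl hcpt
    have he' : e ∈ K ∩ W := ⟨he, mem_connectedComponentIn heQ⟩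
    rw [this] at he'
    exact he'

/-- points of `K` cannot be separated by compact sets off `K` -/
def Linked (K : Set ℂ) : Prop := ∀ Q : Set ℂ, IsCompact Q → Disjoint Q K → ∀ e ∈ K, ∀ e' ∈ K,
  e' ∈ connectedComponentIn Qᶜ e

lemma linked_of_NoCpt {K : Set ℂ} (hK : IsClosed K) (hN : NoCpt K) : Linked K := by
  intro Q hQ hd e he e' he'
  obtain ⟨M, hM⟩ := hQ.isBounded.exists_norm_le
  have hM' : ∀ z ∈ Q, ‖z‖ ≤ max M 1 := fun z hz => (hM z hz).trans (le_max_left _ _)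
  have h1 := far_comp hK hN hQ hd he (M := max M 1) (by positivity) hM'
  have h2 := far_comp hK hN hQ hd he' (M := max M 1) (by positivity) hM'
  have hp : ((max M 1 + 1 : ℝ) : ℂ) ∈ {z : ℂ | max M 1 < ‖z‖} := by
    show max M 1 < ‖((max M 1 + 1 : ℝ) : ℂ)‖
    rw [Complex.norm_real, Real.norm_eq_abs, abs_of_pos (by positivity)]; linarith
  rw [connectedComponentIn_eq (h1 hp), ← connectedComponentIn_eq (h2 hp)]
  exact mem_connectedComponentIn (fun h => Set.disjoint_left.1 hd h he')

lemma linked_of_preconn {K : Set ℂ} (hK : IsPreconnected K) : Linked K := by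
  intro Q hQ hd e he e' he'
  exact hK.subset_connectedComponentIn he (fun z hz h => Set.disjoint_left.1 hd h hz) he'

lemma path_in {O : Set ℂ} (hO : IsOpen O) {a b : ℂ} (hb : b ∈ connectedComponentIn O a) :
    ∃ γ : ℝ → ℂ, Continuous γ ∧ γ 0 = a ∧ γ 1 = b ∧ ∀ t, γ t ∈ O := by
  have haO : a ∈ O := by
    by_contra h
    rw [connectedComponentIn_eq_empty h] at hb; exact hb
  have hc : IsConnected (connectedComponentIn O a) := isConnected_connectedComponentIn_iff.2 haO
  have hp := hO.connectedComponentIn.isConnected_iff_isPathConnected.1 hc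
  obtain ⟨p, hp⟩ := hp.joinedIn a (mem_connectedComponentIn haO) b hb
  refine ⟨p.extend, p.continuous_extend, by simp, by simp, fun t => ?_⟩
  have : p.extend t ∈ Set.range p := by
    rw [← p.extend_range]; exact ⟨t, rfl⟩
  obtain ⟨s, hs⟩ := this
  rw [← hs]
  exact connectedComponentIn_subset _ _ (hp s)

lemma three_paths {h : ℂ ≃ₜ ℂ} (H : OP h) (y : ℂ) (r : ℝ) (hr : 0 < r) (e : Fin 3 → ℂ) (he : ∀ i, ‖e i - y‖ = r)
    (hinj : ∀ i j, i ≠ j → e i ≠ e j) (hB : ∀ z w, ‖z - y‖ ≤ r → ‖w - y‖ ≤ r → z ≠ h w)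
    (γ : Fin 3 → ℝ → ℂ) (hγ : ∀ i, Continuous (γ i)) (hγ0 : ∀ i, γ i 0 = e i) (hγ1 : ∀ i, γ i 1 = h (e i))
    (h1 : ∀ i j, i ≠ j → ∀ s ∈ Set.Icc (0:ℝ) 1, ∀ t ∈ Set.Icc (0:ℝ) 1, γ i s ≠ y + t * (e j - y))
    (h2 : ∀ i j, i ≠ j → ∀ s ∈ Set.Icc (0:ℝ) 1, ∀ t ∈ Set.Icc (0:ℝ) 1, γ i s ≠ h (y + t * (e j - y)))
    (h3 : ∀ i j, i < j → ∀ s ∈ Set.Icc (0:ℝ) 1, ∀ t ∈ Set.Icc (0:ℝ) 1, γ i s ≠ γ j t) : False := by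
  have h3' : ∀ i j, i ≠ j → ∀ s ∈ Set.Icc (0:ℝ) 1, ∀ t ∈ Set.Icc (0:ℝ) 1, γ i s ≠ γ j t := by
    intro i j hij s hs t ht
    rcases lt_or_gt_of_ne hij with h | h
    · exact h3 i j h s hs t ht
    · exact (h3 j i h t ht s hs).symm
  set a : Fin 3 → ℝ → ℂ := fun i t => y + t * (e i - y) with ha
  have hac : ∀ i, Continuous (a i) := fun i => by simp only [ha]; fun_prop
  have han : ∀ i, ∀ t ∈ Set.Icc (0:ℝ) 1, ‖a i t - y‖ = t * r := by
    intro i t ht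
    simp only [ha, add_sub_cancel_left, norm_mul, he, Complex.norm_real, Real.norm_eq_abs, abs_of_nonneg ht.1]
  have han' : ∀ i, ∀ t ∈ Set.Icc (0:ℝ) 1, ‖a i t - y‖ ≤ r := by
    intro i t ht
    rw [han i t ht]; nlinarith [ht.2]
  have haa : ∀ i j, i ≠ j → ∀ s ∈ Set.Icc (0:ℝ) 1, ∀ t ∈ Set.Icc (0:ℝ) 1, a i s = a j t → s = 0 ∧ t = 0 := by
    intro i j hij s hs t ht h
    have e1 := han i s hs
    rw [h, han j t ht] at e1
    have e2 : t = s := mul_right_cancel₀ hr.ne' e1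
    subst e2
    by_cases ht0 : t = 0
    · exact ⟨ht0, ht0⟩
    · exfalso
      simp only [ha] at h
      have := mul_left_cancel₀ (by exact_mod_cast ht0) (add_left_cancel h)
      exact hinj i j hij (sub_left_injective this)
  have ha1 : ∀ i, a i 1 = e i := fun i => by simp [ha]
  set α : Fin 3 → ℝ → ℂ := fun i t => if t ≤ 1 then a i t else if t ≤ 2 then γ i (t - 1) else h (a i (3 - t)) with hα
  have hαc : ∀ i, Continuous (α i) := by
    intro i
    simp only [hα]
    refine Continuous.if_le (hac i) ?_ continuous_id continuous_const ?_
    · refine Continuous.if_le ((hγ i).comp (by fun_prop)) (h.continuous.comp ((hac i).comp (by fun_prop))) continuous_id continuous_const ?_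
      rintro x rfl
      norm_num [ha1, hγ1]
    · rintro x rfl
      norm_num [ha1, hγ0]
  have A1 : ∀ i t, t ≤ 1 → α i t = a i t := fun i t ht => by simp only [hα, if_pos ht]
  have A2 : ∀ i t, 1 < t → t ≤ 2 → α i t = γ i (t - 1) := fun i t ht ht' => by
    simp only [hα, if_neg (not_le.2 ht), if_pos ht']
  have A3 : ∀ i t, 2 < t → α i t = h (a i (3 - t)) := fun i t ht => by
    simp only [hα, if_neg (not_le.2 (one_lt_two.trans ht)), if_neg (not_le.2 ht)]
  refine D_lemma H α y hαc (fun i => by rw [A1 i 0 (by norm_num)]; simp [ha]) ?_ ?_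
  · intro i t ht
    rw [A1 i t ht.2]
    rcases ht.2.lt_or_eq with h' | h'
    · rw [A3 i _ (by linarith)]; congr 2; ring
    · subst h'; rw [A2 i _ (by norm_num) (by norm_num)]; norm_num [hγ1, ha1]
  · intro i j hij s hs t ht hst
    rcases le_or_gt s 1 with hs1 | hs1
    · rw [A1 i s hs1] at hst
      rcases le_or_gt t 1 with ht1 | ht1
      · rw [A1 j t ht1] at hst
        exact Or.inl (haa i j hij s ⟨hs.1, hs1⟩ t ⟨ht.1, ht1⟩ hst)
      · rcases le_or_gt t 2 with ht2 | ht2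
        · rw [A2 j t ht1 ht2] at hst
          exact absurd hst.symm (h1 j i hij.symm (t - 1) ⟨by linarith, by linarith⟩ s ⟨hs.1, hs1⟩)
        · rw [A3 j t ht2] at hst
          exact absurd hst (hB _ _ (han' i s ⟨hs.1, hs1⟩) (han' j (3 - t) ⟨by linarith [ht.2], by linarith⟩))
    · rcases le_or_gt s 2 with hs2 | hs2
      · rw [A2 i s hs1 hs2] at hst
        rcases le_or_gt t 1 with ht1 | ht1
        · rw [A1 j t ht1] at hst
          exact absurd hst (h1 i j hij (s - 1) ⟨by linarith, by linarith⟩ t ⟨ht.1, ht1⟩)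
        · rcases le_or_gt t 2 with ht2 | ht2
          · rw [A2 j t ht1 ht2] at hst
            exact absurd hst (h3' i j hij _ ⟨by linarith, by linarith⟩ _ ⟨by linarith, by linarith⟩)
          · rw [A3 j t ht2] at hst
            exact absurd hst (h2 i j hij _ ⟨by linarith, by linarith⟩ (3 - t) ⟨by linarith [ht.2], by linarith⟩)
      · rw [A3 i s hs2] at hst
        rcases le_or_gt t 1 with ht1 | ht1
        · rw [A1 j t ht1] at hst
          exact absurd hst.symm (hB _ _ (han' j t ⟨ht.1, ht1⟩) (han' i (3 - s) ⟨by linarith [hs.2], by linarith⟩))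
        · rcases le_or_gt t 2 with ht2 | ht2
          · rw [A2 j t ht1 ht2] at hst
            exact absurd hst.symm (h2 j i hij.symm _ ⟨by linarith, by linarith⟩ (3 - s) ⟨by linarith [hs.2], by linarith⟩)
          · rw [A3 j t ht2] at hst
            have := haa i j hij (3 - s) ⟨by linarith [hs.2], by linarith⟩ (3 - t) ⟨by linarith [ht.2], by linarith⟩ (h.injective hst)
            right
            constructor <;> linarith [this.1, this.2]

lemma three_classes {h : ℂ ≃ₜ ℂ} (H : OP h) (y : ℂ) (r : ℝ) (hr : 0 < r) 
    (hB : ∀ z w, ‖z - y‖ ≤ r → ‖w - y‖ ≤ r → z ≠ h w) (K : Fin 3 → Set ℂ) (hL : ∀ i, Linked (K i))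
    (hc1 : IsCompact (K 1)) (hc2 : IsCompact (K 2)) (hd : ∀ i j, i ≠ j → Disjoint (K i) (K j))
    (hinv : ∀ i z, h z ∈ K i ↔ z ∈ K i) (hKB : ∀ i, ∀ z ∈ K i, r ≤ ‖z - y‖)
    (e : Fin 3 → ℂ) (heK : ∀ i, e i ∈ K i) (he : ∀ i, ‖e i - y‖ = r) : False := by
  have hinj : ∀ i j, i ≠ j → e i ≠ e j := fun i j hij h =>
    Set.disjoint_left.1 (hd i j hij) (heK i) (h ▸ heK j)
  set a : Fin 3 → ℝ → ℂ := fun i t => y + t * (e i - y) with ha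
  have hac : ∀ i, Continuous (a i) := fun i => by simp only [ha]; fun_prop
  have hdisj : ∀ i j, i ≠ j → ∀ t ∈ Set.Icc (0:ℝ) 1, a i t ∉ K j := by
    intro i j hij t ht hK
    have h1 := hKB j _ hK
    simp only [ha, add_sub_cancel_left, norm_mul, he, Complex.norm_real, Real.norm_eq_abs, abs_of_nonneg ht.1] at h1
    have : t = 1 := by nlinarith [ht.2]
    subst this
    have e1 : a i 1 = e i := by simp [ha]
    rw [e1] at hK
    exact Set.disjoint_left.1 (hd i j hij) (heK i) hK
  set T : Fin 3 → Set ℂ := fun i => a i '' Set.Icc 0 1 ∪ h '' (a i '' Set.Icc 0 1) with hT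
  have hTc : ∀ i, IsCompact (T i) := fun i =>
    (isCompact_Icc.image (hac i)).union ((isCompact_Icc.image (hac i)).image h.continuous)
  have hTK : ∀ i j, i ≠ j → Disjoint (T i) (K j) := by
    intro i j hij
    rw [Set.disjoint_left]
    rintro _ (⟨t, ht, rfl⟩ | ⟨_, ⟨t, ht, rfl⟩, rfl⟩)
    · exact hdisj i j hij t ht
    · rw [hinv]; exact hdisj i j hij t ht
  have get : ∀ i Q, IsCompact Q → Disjoint Q (K i) → ∃ γ : ℝ → ℂ, Continuous γ ∧ γ 0 = e i ∧ γ 1 = h (e i) ∧ ∀ t, γ t ∉ Q := by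
    intro i Q hQ hQK
    exact path_in hQ.isClosed.isOpen_compl (hL i Q hQ hQK _ (heK i) _ ((hinv i _).2 (heK i)))
  obtain ⟨g0, g0c, g00, g01, g0Q⟩ := get 0 (K 1 ∪ K 2 ∪ T 1 ∪ T 2) (((hc1.union hc2).union (hTc 1)).union (hTc 2)) (by
    simp only [Set.disjoint_union_left]
    exact ⟨⟨⟨hd 1 0 (by decide), hd 2 0 (by decide)⟩, hTK 1 0 (by decide)⟩, hTK 2 0 (by decide)⟩)
  simp only [Set.mem_union, not_or] at g0Q
  have G0 : IsCompact (g0 '' Set.Icc 0 1) := isCompact_Icc.image g0c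
  have G01 : Disjoint (g0 '' Set.Icc 0 1) (K 1) := by
    rw [Set.disjoint_left]; rintro _ ⟨t, -, rfl⟩; exact (g0Q t).1.1.1
  have G02 : Disjoint (g0 '' Set.Icc 0 1) (K 2) := by
    rw [Set.disjoint_left]; rintro _ ⟨t, -, rfl⟩; exact (g0Q t).1.1.2
  obtain ⟨g1, g1c, g10, g11, g1Q⟩ := get 1 (g0 '' Set.Icc 0 1 ∪ K 2 ∪ T 0 ∪ T 2) (((G0.union hc2).union (hTc 0)).union (hTc 2)) (by
    simp only [Set.disjoint_union_left]
    exact ⟨⟨⟨G01, hd 2 1 (by decide)⟩, hTK 0 1 (by decide)⟩, hTK 2 1 (by decide)⟩)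
  simp only [Set.mem_union, not_or] at g1Q
  have G1 : IsCompact (g1 '' Set.Icc 0 1) := isCompact_Icc.image g1c
  have G12 : Disjoint (g1 '' Set.Icc 0 1) (K 2) := by
    rw [Set.disjoint_left]; rintro _ ⟨t, -, rfl⟩; exact (g1Q t).1.1.2
  obtain ⟨g2, g2c, g20, g21, g2Q⟩ := get 2 (g0 '' Set.Icc 0 1 ∪ g1 '' Set.Icc 0 1 ∪ T 0 ∪ T 1) (((G0.union G1).union (hTc 0)).union (hTc 1)) (by
    simp only [Set.disjoint_union_left]
    exact ⟨⟨⟨G02, G12⟩, hTK 0 2 (by decide)⟩, hTK 1 2 (by decide)⟩)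
  simp only [Set.mem_union, not_or] at g2Q
  set γ : Fin 3 → ℝ → ℂ := ![g0, g1, g2] with hγ
  have hγT : ∀ i j, i ≠ j → ∀ s, γ i s ∉ T j := by
    intro i j hij s
    fin_cases i <;> fin_cases j
    · exact absurd rfl hij
    · exact (g0Q s).1.2
    · exact (g0Q s).2
    · exact (g1Q s).1.2
    · exact absurd rfl hij
    · exact (g1Q s).2
    · exact (g2Q s).1.2
    · exact (g2Q s).2
    · exact absurd rfl hij
  refine three_paths H y r hr e he hinj hB γ ?_ ?_ ?_ ?_ ?_ ?_
  · intro i; fin_cases i <;> assumption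
  · intro i; fin_cases i <;> assumption
  · intro i; fin_cases i <;> assumption
  · intro i j hij s hs t ht hst
    exact hγT i j hij s (Or.inl ⟨t, ht, hst.symm⟩)
  · intro i j hij s hs t ht hst
    exact hγT i j hij s (Or.inr ⟨_, ⟨t, ht, rfl⟩, hst.symm⟩)
  · intro i j hij s hs t ht hst
    fin_cases i <;> fin_cases j <;> first | exact absurd hij (by decide) | skip
    · exact (g1Q t).1.1.1 ⟨s, hs, hst⟩
    · exact (g2Q t).1.1.1 ⟨s, hs, hst⟩
    · exact (g2Q t).1.1.2 ⟨s, hs, hst⟩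

end SphRec

namespace SphRec

theorem exp_quot {u : ℂ} (hu : u ≠ 0) (h1 : ‖u‖ < 1) :
    (Complex.exp u - 1) / u ∈ Complex.slitPlane := by
  have h2 := Complex.norm_exp_sub_one_sub_id_le h1.le
  have h3 : ‖(Complex.exp u - 1) / u - 1‖ < 1 := by
    have : (Complex.exp u - 1) / u - 1 = (Complex.exp u - 1 - u) / u := by field_simp
    rw [this, norm_div, div_lt_one (norm_pos_iff.mpr hu)]
    nlinarith [norm_pos_iff.mpr hu]
  left
  have h4 := (abs_le.mp (Complex.abs_re_le_norm ((Complex.exp u - 1) / u - 1))).1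
  have : ((Complex.exp u - 1) / u - 1).re = ((Complex.exp u - 1) / u).re - 1 := by simp
  linarith

theorem Lift (h : ℂ ≃ₜ ℂ) (H : OP h) (h0 : h 0 = 0) {r : ℂ} (hr : r ≠ 0) (hrr : h r = r) :
    ∃ h1 : ℂ ≃ₜ ℂ, OP h1 ∧ (∀ ζ, Complex.exp (h1 ζ) = h (Complex.exp ζ)) ∧
      h1 (Complex.log r) = Complex.log r := by
  obtain ⟨L, hL, hL2⟩ := H
  have hLr : Complex.exp (L r 0) = 1 := by
    have := hL2 r 0 hr
    rw [h0, hrr] at this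
    simpa [hr] using this
  have hLe : ∀ u, u ≠ 0 → Complex.exp (L u 0) * u = h u := by
    intro u hu
    have := hL2 u 0 hu
    simpa [h0] using this
  have hLc : ContinuousOn (fun u => L u 0) {u | u ≠ 0} :=
    hL.comp (f := fun u : ℂ => (u, (0:ℂ))) (by fun_prop) (fun u hu => hu)
  have hsne : ∀ u, u ≠ 0 → h.symm u ≠ 0 := by
    intro u hu h'
    apply hu
    rw [← h.apply_symm_apply u, h', h0]
  have hg : ∀ ζ, Complex.exp (ζ - L (h.symm (Complex.exp ζ)) 0 + L r 0) = h.symm (Complex.exp ζ) := by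
    intro ζ
    have h2 := hLe _ (hsne _ (Complex.exp_ne_zero ζ))
    rw [h.apply_symm_apply] at h2
    rw [Complex.exp_add, Complex.exp_sub, hLr, mul_one, div_eq_iff (Complex.exp_ne_zero _), mul_comm]
    exact h2.symm
  have hh : ∀ ζ, Complex.exp (ζ + L (Complex.exp ζ) 0 - L r 0) = h (Complex.exp ζ) := by
    intro ζ
    rw [Complex.exp_sub, Complex.exp_add, hLr, div_one, mul_comm]
    exact hLe _ (Complex.exp_ne_zero ζ)
  let h1 : ℂ ≃ₜ ℂ :=
    { toFun := fun ζ => ζ + L (Complex.exp ζ) 0 - L r 0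
      invFun := fun ζ => ζ - L (h.symm (Complex.exp ζ)) 0 + L r 0
      left_inv := by
        intro ζ
        simp only
        rw [hh, h.symm_apply_apply]; ring
      right_inv := by
        intro ζ
        simp only
        rw [hg]; ring
      continuous_toFun := by
        have : Continuous fun ζ => L (Complex.exp ζ) 0 :=
          hLc.comp_continuous Complex.continuous_exp (fun ζ => Complex.exp_ne_zero ζ)
        exact (continuous_id.add this).sub continuous_const
      continuous_invFun := by
        have : Continuous fun ζ => L (h.symm (Complex.exp ζ)) 0 :=
          hLc.comp_continuous (h.symm.continuous.comp Complex.continuous_exp)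
            (fun ζ => hsne _ (Complex.exp_ne_zero ζ))
        exact (continuous_id.sub this).add continuous_const }
  have h1e : ∀ ζ, Complex.exp (h1 ζ) = h (Complex.exp ζ) := hh
  refine ⟨h1, ?_, h1e, ?_⟩
  swap
  · change Complex.log r + L (Complex.exp (Complex.log r)) 0 - L r 0 = _
    rw [Complex.exp_log hr]; ring
  obtain ⟨δ, hδ, hδ2⟩ := Metric.continuousAt_iff.mp (h1.continuous.continuousAt (x := 0)) 1 one_pos
  have key : ∀ z ∈ ball (0:ℂ) (min δ 1) \ {0}, z - 0 ≠ 0 ∧ ‖z - 0‖ < 1 ∧ h1 z - h1 0 ≠ 0 ∧ ‖h1 z - h1 0‖ < 1 := by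
    rintro z ⟨hz, hz0⟩
    have hz0 : z ≠ 0 := hz0
    have hz' : dist z 0 < min δ 1 := hz
    refine ⟨by simpa using hz0, ?_, ?_, ?_⟩
    · rw [← dist_eq_norm]; exact lt_of_lt_of_le hz' (min_le_right _ _)
    · exact sub_ne_zero.mpr (fun h' => hz0 (h1.injective h'))
    · rw [← dist_eq_norm]; exact hδ2 (lt_of_lt_of_le hz' (min_le_left _ _))
  have ene : ∀ z ∈ ball (0:ℂ) (min δ 1) \ {0}, Complex.exp z ≠ Complex.exp 0 := by
    intro z hz h'
    obtain ⟨a, b, -, -⟩ := key z hz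
    have := exp_quot a b
    rw [sub_zero, h'] at this
    simp at this
  refine OP_of_loc h1.continuous h1.injective 0 (min δ 1) (by positivity)
    (fun z => L (Complex.exp z) (Complex.exp 0) + Complex.log ((Complex.exp (z - 0) - 1) / (z - 0)) -
      Complex.log ((Complex.exp (h1 z - h1 0) - 1) / (h1 z - h1 0)) - h1 0) ?_ ?_
  · have c1 : ContinuousOn (fun z => L (Complex.exp z) (Complex.exp 0)) (ball (0:ℂ) (min δ 1) \ {0}) :=
      hL.comp (f := fun z : ℂ => (Complex.exp z, Complex.exp 0)) (by fun_prop) ene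
    have c2 : ContinuousOn (fun z : ℂ => Complex.log ((Complex.exp (z - 0) - 1) / (z - 0)))
        (ball (0:ℂ) (min δ 1) \ {0}) := by
      refine ContinuousOn.clog ?_ (fun z hz => exp_quot (key z hz).1 (key z hz).2.1)
      exact ContinuousOn.div (by fun_prop) (by fun_prop) (fun z hz => (key z hz).1)
    have c3 : ContinuousOn (fun z : ℂ => Complex.log ((Complex.exp (h1 z - h1 0) - 1) / (h1 z - h1 0)))
        (ball (0:ℂ) (min δ 1) \ {0}) := by
      have := h1.continuous
      refine ContinuousOn.clog ?_ (fun z hz => exp_quot (key z hz).2.2.1 (key z hz).2.2.2)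
      exact ContinuousOn.div (by fun_prop) (by fun_prop) (fun z hz => (key z hz).2.2.1)
    exact ((c1.add c2).sub c3).sub continuousOn_const
  · intro z hz
    obtain ⟨a, b, c, d⟩ := key z hz
    have e1 := Complex.slitPlane_ne_zero (exp_quot a b)
    have e2 := Complex.slitPlane_ne_zero (exp_quot c d)
    have e3 := hL2 _ _ (ene z hz)
    have e5 := ene z hz
    rw [Complex.exp_sub, Complex.exp_sub, Complex.exp_add, Complex.exp_log e1, Complex.exp_log e2]
    rw [← h1e, ← h1e] at e3
    have e4 : Complex.exp (h1 z - h1 0) * Complex.exp (h1 0) = Complex.exp (h1 z) := by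
      rw [← Complex.exp_add]; ring_nf
    have e6 : Complex.exp (h1 z - h1 0) - 1 ≠ 0 := by
      intro h'; rw [h'] at e2; simp at e2
    have e7 := Complex.exp_ne_zero (h1 0)
    simp only [sub_zero] at *
    rw [Complex.exp_zero] at *
    rw [← e4] at e3
    generalize Complex.exp (L (Complex.exp z) 1) = A at *
    generalize Complex.exp (h1 0) = B at *
    generalize Complex.exp (h1 z - h1 0) = C at *
    rw [div_div_eq_mul_div, div_div, div_mul_eq_mul_div, div_eq_iff (mul_ne_zero e6 e7)]
    have : A * ((Complex.exp z - 1) / z) * (h1 z - h1 0) * z = A * (Complex.exp z - 1) * (h1 z - h1 0) := by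
      field_simp
    rw [this, e3]; ring

theorem Lift_rec (h h1 : ℂ ≃ₜ ℂ) {r : ℂ} (hr : r ≠ 0) (hrr : h r = r)
    (h1e : ∀ ζ, Complex.exp (h1 ζ) = h (Complex.exp ζ)) (h1r : h1 (Complex.log r) = Complex.log r)
    (hrec : ∀ R : ℝ, ∀ ε > 0, ∀ m : ℕ, ∃ n ≥ m, ∀ z, ‖z‖ ≤ R → ‖h^[n] z - z‖ < ε) (ζ : ℂ) :
    ∀ ε > 0, ∃ N : ℕ, 2 ≤ N ∧ dist (h1^[N] ζ) ζ < ε := by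
  intro ε hε
  have hit : ∀ n : ℕ, ∀ ζ, Complex.exp (h1^[n] ζ) = h^[n] (Complex.exp ζ) := by
    intro n
    induction n with
    | zero => intro ζ; rfl
    | succ k ih => intro ζ; rw [Function.iterate_succ_apply, ih, Function.iterate_succ_apply, h1e]
  obtain ⟨δ, hδ, hδ2⟩ := Metric.continuousAt_iff.mp
    (continuousAt_clog (x := 1) Complex.one_mem_slitPlane) ε hε
  have hcpt : IsCompact (segment ℝ (Complex.log r) ζ) := by
    rw [segment_eq_image]
    exact isCompact_Icc.image (by fun_prop)
  obtain ⟨R, hR⟩ := (hcpt.image_of_continuousOn (f := fun s => ‖Complex.exp s‖) (by fun_prop)).bddAbove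
  obtain ⟨s0, hs0, hs0'⟩ := hcpt.exists_isMinOn ⟨ζ, right_mem_segment ℝ _ _⟩
    (f := fun s => ‖Complex.exp s‖) (by fun_prop)
  set a := ‖Complex.exp s0‖ with ha
  have ha0 : 0 < a := norm_pos_iff.mpr (Complex.exp_ne_zero _)
  obtain ⟨n, hn, hn2⟩ := hrec R (a * min δ (1/2)) (by positivity) 2
  have hq : ∀ s ∈ segment ℝ (Complex.log r) ζ, ‖h^[n] (Complex.exp s) / Complex.exp s - 1‖ < min δ (1/2) := by
    intro s hs
    have h2 : ‖Complex.exp s‖ ≤ R := hR ⟨s, hs, rfl⟩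
    have h3 : a ≤ ‖Complex.exp s‖ := hs0' hs
    have h4 := hn2 _ h2
    have : h^[n] (Complex.exp s) / Complex.exp s - 1 = (h^[n] (Complex.exp s) - Complex.exp s) / Complex.exp s := by
      field_simp [Complex.exp_ne_zero]
    rw [this, norm_div, div_lt_iff₀ (lt_of_lt_of_le ha0 h3)]
    refine lt_of_lt_of_le h4 ?_
    rw [mul_comm]
    have : 0 < min δ (1/2) := by positivity
    gcongr
  have hslit : ∀ s ∈ segment ℝ (Complex.log r) ζ, h^[n] (Complex.exp s) / Complex.exp s ∈ Complex.slitPlane := by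
    intro s hs
    left
    have h4 := (abs_le.mp (Complex.abs_re_le_norm (h^[n] (Complex.exp s) / Complex.exp s - 1))).1
    have h5 := lt_of_lt_of_le (hq s hs) (min_le_right _ _)
    have h6 : (h^[n] (Complex.exp s) / Complex.exp s - 1).re = (h^[n] (Complex.exp s) / Complex.exp s).re - 1 := by simp
    rw [h6] at h4
    linarith
  have hc1 : Continuous h1^[n] := h1.continuous.iterate n
  have hc : Continuous h^[n] := h.continuous.iterate n
  have hnr : h^[n] r = r := Function.iterate_fixed hrr n
  have h1nr : h1^[n] (Complex.log r) = Complex.log r := Function.iterate_fixed h1r n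
  have := log_sub_const (s := segment ℝ (Complex.log r) ζ) (convex_segment _ _).isPreconnected
    (d := fun s => h1^[n] s - s) (e := fun s => Complex.log (h^[n] (Complex.exp s) / Complex.exp s))
    (by fun_prop)
    (ContinuousOn.clog (ContinuousOn.div (by fun_prop) (by fun_prop) (fun s _ => Complex.exp_ne_zero s)) hslit)
    (by
      intro s hs
      rw [Complex.exp_log (Complex.slitPlane_ne_zero (hslit s hs)), Complex.exp_sub, hit])
    (left_mem_segment ℝ _ _) (right_mem_segment ℝ _ _)
  simp only [Complex.exp_log hr, hnr, h1nr, div_self hr, Complex.log_one, sub_self] at this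
  have h7 := hδ2 (x := h^[n] (Complex.exp ζ) / Complex.exp ζ) (by
    rw [dist_eq_norm]
    exact lt_of_lt_of_le (hq ζ (right_mem_segment ℝ _ _)) (min_le_left _ _))
  refine ⟨n, hn, ?_⟩
  rw [Complex.log_one, dist_zero_right] at h7
  rw [dist_eq_norm]
  rw [sub_eq_zero.mp this.symm]
  exact h7
end SphRec

namespace SphRec

lemma join_half {O H : Set ℂ} (hH : IsPreconnected H) (hHO : H ⊆ Complex.exp ⁻¹' O)
    {γ : ℝ → ℂ} (hγ : Continuous γ) {T : ℝ} (hT : 0 ≤ T) {z : ℂ} (hz : γ 0 = Complex.exp z)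
    (hne : ∀ t ∈ Set.Icc 0 T, γ t ≠ 0) (hO : ∀ t ∈ Set.Icc 0 T, γ t ∈ O)
    (hend : ∀ ζ, Complex.exp ζ = γ T → ζ ∈ H) :
    H ⊆ connectedComponentIn (Complex.exp ⁻¹' O) z := by
  obtain ⟨l, hl, hl2⟩ := log_convex (convex_Icc 0 T) γ hγ.continuousOn hne
  have h0 : (0:ℝ) ∈ Set.Icc 0 T := ⟨le_rfl, hT⟩
  have hT' : T ∈ Set.Icc 0 T := ⟨hT, le_rfl⟩
  have e0 : Complex.exp (z - l 0) = 1 := by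
    rw [Complex.exp_sub, hl2 0 h0, hz, div_self (Complex.exp_ne_zero _)]
  set m : ℝ → ℂ := fun t => l t + (z - l 0) with hm
  have hme : ∀ t ∈ Set.Icc 0 T, Complex.exp (m t) = γ t := by
    intro t ht
    simp only [hm]
    rw [Complex.exp_add, e0, mul_one, hl2 t ht]
  have hmc : IsPreconnected (m '' Set.Icc 0 T) :=
    isPreconnected_Icc.image _ (hl.add continuousOn_const)
  have hzm : z ∈ m '' Set.Icc 0 T := ⟨0, h0, by simp [hm]⟩
  have h1 : m '' Set.Icc 0 T ⊆ connectedComponentIn (Complex.exp ⁻¹' O) z := by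
    refine hmc.subset_connectedComponentIn hzm ?_
    rintro _ ⟨t, ht, rfl⟩
    show Complex.exp (m t) ∈ O
    rw [hme t ht]; exact hO t ht
  have h2 : m T ∈ H := hend _ (hme T hT')
  rw [connectedComponentIn_eq (h1 ⟨T, hT', rfl⟩)]
  exact hH.subset_connectedComponentIn h2 hHO

lemma image_comp (h : ℂ ≃ₜ ℂ) {K : Set ℂ} (hinv : ∀ z, h z ∈ K ↔ z ∈ K) {a b : ℂ}
    (hb : b ∈ connectedComponentIn Kᶜ a) : h b ∈ connectedComponentIn Kᶜ (h a) := by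
  have haO : a ∈ Kᶜ := by
    by_contra h
    rw [connectedComponentIn_eq_empty h] at hb; exact hb
  have h1 : IsPreconnected (h '' connectedComponentIn Kᶜ a) :=
    isPreconnected_connectedComponentIn.image _ h.continuous.continuousOn
  refine h1.subset_connectedComponentIn ⟨a, mem_connectedComponentIn haO, rfl⟩ ?_ ⟨b, hb, rfl⟩
  rintro _ ⟨c, hc, rfl⟩ hcK
  exact connectedComponentIn_subset _ _ hc ((hinv c).1 hcK)

theorem two_classes (h : ℂ ≃ₜ ℂ) (H : OP h) (h0 : h 0 = 0) {r : ℂ} (hr : r ≠ 0) (hrr : h r = r)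
    (hrec : ∀ R : ℝ, ∀ ε > 0, ∀ m : ℕ, ∃ n ≥ m, ∀ z, ‖z‖ ≤ R → ‖h^[n] z - z‖ < ε)
    {K1 K2 : Set ℂ} (hK1 : IsClosed K1) (hN : NoCpt K1) (hK2 : IsCompact K2) (hK2c : IsPreconnected K2)
    (h02 : (0:ℂ) ∈ K2) (hd : Disjoint K1 K2) (hi1 : ∀ z, h z ∈ K1 ↔ z ∈ K1) (hi2 : ∀ z, h z ∈ K2 ↔ z ∈ K2)
    (hfix : ∀ z, h z = z → z ∈ K1 ∪ K2) {y e1 e2 : ℂ} (hy1 : y ∉ K1) (hy2 : y ∉ K2)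
    (he1 : e1 ∈ K1) (he2 : e2 ∈ K2) (hye1 : y ∈ connectedComponentIn K2ᶜ e1)
    (hye2 : y ∈ connectedComponentIn K1ᶜ e2) : False := by
  obtain ⟨h1, H1, h1e, h1r⟩ := Lift h H h0 hr hrr
  have hy0 : y ≠ 0 := fun h => hy2 (h ▸ h02)
  set z := Complex.log y with hz
  have hez : Complex.exp z = y := Complex.exp_log hy0
  have hehz : Complex.exp (h1 z) = h y := by rw [h1e, hez]
  have hA : IsClosed (Complex.exp ⁻¹' K1) := hK1.preimage Complex.continuous_exp
  have hB : IsClosed (Complex.exp ⁻¹' K2) := hK2.isClosed.preimage Complex.continuous_exp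
  have hAB : Disjoint (Complex.exp ⁻¹' K1) (Complex.exp ⁻¹' K2) := hd.preimage _
  have hzA : z ∉ Complex.exp ⁻¹' K1 := by
    rw [Set.mem_preimage, hez]; exact hy1
  have hzB : z ∉ Complex.exp ⁻¹' K2 := by
    rw [Set.mem_preimage, hez]; exact hy2
  -- far part
  obtain ⟨M0, hM0⟩ := hK2.isBounded.exists_norm_le
  set M := max M0 1 with hMd
  have hM : 0 < M := by positivity
  have hM' : ∀ z ∈ K2, ‖z‖ ≤ M := fun z hz => (hM0 z hz).trans (le_max_left _ _)
  have far : ∀ ζ w e : ℂ, Complex.exp ζ = w → e ∈ K1 → w ∈ connectedComponentIn K2ᶜ e →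
      {ξ : ℂ | Real.log M < ξ.re} ⊆ connectedComponentIn (Complex.exp ⁻¹' K2ᶜ) ζ := by
    intro ζ w e hζ he hw
    have f1 := far_comp hK1 hN hK2 hd.symm he hM hM'
    have hp : ((M + 1 : ℝ) : ℂ) ∈ {z : ℂ | M < ‖z‖} := by
      show M < ‖((M + 1 : ℝ) : ℂ)‖
      rw [Complex.norm_real, Real.norm_eq_abs, abs_of_pos (by positivity)]; linarith
    have f2 := f1 hp
    rw [connectedComponentIn_eq hw] at f2
    obtain ⟨γ, g1, g2, g3, g4⟩ := path_in hK2.isClosed.isOpen_compl f2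
    refine join_half (convex_halfSpace_re_gt _).isPreconnected ?_ g1 zero_le_one (g2.trans hζ.symm)
      (fun t _ h => g4 t (h ▸ h02)) (fun t _ => g4 t) ?_
    · intro ξ hξ hξ2
      have hξ : Real.log M < ξ.re := hξ
      have := hM' _ hξ2
      rw [Complex.norm_exp] at this
      rw [Real.log_lt_iff_lt_exp hM] at hξ
      linarith
    · intro ξ hξ
      show Real.log M < ξ.re
      rw [Real.log_lt_iff_lt_exp hM, ← Complex.norm_exp, hξ, g3]
      exact hp
  -- near part
  have h01 : (0:ℂ) ∈ K1ᶜ := fun h => Set.disjoint_left.1 hd h h02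
  obtain ⟨ρ, hρ, hρ2⟩ := Metric.isOpen_iff.1 hK1.isOpen_compl 0 h01
  have near : ∀ ζ w e : ℂ, Complex.exp ζ = w → e ∈ K2 → w ∈ connectedComponentIn K1ᶜ e →
      {ξ : ℂ | ξ.re < Real.log ρ} ⊆ connectedComponentIn (Complex.exp ⁻¹' K1ᶜ) ζ := by
    intro ζ w e hζ he hw
    have f2 : (0:ℂ) ∈ connectedComponentIn K1ᶜ e :=
      hK2c.subset_connectedComponentIn he (fun u hu hu1 => Set.disjoint_left.1 hd hu1 hu) h02
    rw [connectedComponentIn_eq hw] at f2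
    obtain ⟨γ, g1, g2, g3, g4⟩ := path_in hK1.isOpen_compl f2
    have hw0 : w ≠ 0 := by rw [← hζ]; exact Complex.exp_ne_zero _
    set ρ' := min (ρ/2) ‖w‖ with hρ'
    have hwp : 0 < ‖w‖ := norm_pos_iff.2 hw0
    have hρ'p : 0 < ρ' := by positivity
    have hex : ∃ T ∈ Set.Icc (0:ℝ) 1, ‖γ T‖ ≤ ρ' ∧ ∀ t ∈ Set.Icc 0 T, ρ' ≤ ‖γ t‖ := by
      set S := Set.Icc (0:ℝ) 1 ∩ {t | ‖γ t‖ ≤ ρ'} with hS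
      have hSc : IsCompact S := isCompact_Icc.inter_right (isClosed_le (by fun_prop) continuous_const)
      obtain ⟨T, hT, hTm⟩ := hSc.exists_isLeast ⟨1, ⟨zero_le_one, le_rfl⟩, by
        show ‖γ 1‖ ≤ ρ'
        rw [g3, norm_zero]; exact hρ'p.le⟩
      refine ⟨T, hT.1, hT.2, ?_⟩
      have hlt : ∀ t ∈ Set.Ico 0 T, ρ' < ‖γ t‖ := by
        intro t ht
        by_contra hcon
        push Not at hcon
        have := hTm (a := t) ⟨⟨ht.1, ht.2.le.trans hT.1.2⟩, hcon⟩
        exact absurd ht.2 (not_lt.2 this)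
      rcases hT.1.1.eq_or_lt with h | h
      · intro t ht
        have : t = 0 := le_antisymm (by rw [h]; exact ht.2) ht.1
        rw [this, g2]
        exact min_le_right _ _
      · intro t ht
        have : t ∈ closure (Set.Ico 0 T) := by rw [closure_Ico h.ne]; exact ht
        exact closure_minimal (s := Set.Ico 0 T) (t := {t | ρ' ≤ ‖γ t‖}) (fun t ht => (hlt t ht).le)
          (isClosed_le continuous_const (by fun_prop)) this
    obtain ⟨T, hT, hT1, hT2⟩ := hex
    refine join_half (convex_halfSpace_re_lt _).isPreconnected ?_ g1 hT.1 (g2.trans hζ.symm)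
      (fun t ht h => by have := hT2 t ht; rw [h, norm_zero] at this; linarith) (fun t _ => g4 t) ?_
    · intro ξ hξ
      have hξ : ξ.re < Real.log ρ := hξ
      apply hρ2
      rw [mem_ball_zero_iff, Complex.norm_exp]
      exact (Real.lt_log_iff_exp_lt hρ).1 hξ
    · intro ξ hξ
      show ξ.re < Real.log ρ
      rw [Real.lt_log_iff_exp_lt hρ, ← Complex.norm_exp, hξ]
      refine hT1.trans_lt ((min_le_left _ _).trans_lt (by linarith))
  have jB : h1 z ∈ connectedComponentIn (Complex.exp ⁻¹' K2)ᶜ z := by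
    have a1 := far z y e1 hez he1 hye1
    have a2 := far (h1 z) (h y) (h e1) hehz ((hi1 _).2 he1) (image_comp h hi2 hye1)
    have hp : ((Real.log M + 1 : ℝ) : ℂ) ∈ {ξ : ℂ | Real.log M < ξ.re} := by
      show Real.log M < _
      simp
    have := connectedComponentIn_eq (a1 hp)
    rw [← Set.preimage_compl, this, ← connectedComponentIn_eq (a2 hp)]
    refine mem_connectedComponentIn ?_
    show Complex.exp (h1 z) ∈ K2ᶜ
    rw [hehz]
    exact fun h => hy2 ((hi2 _).1 h)
  have jA : h1 z ∈ connectedComponentIn (Complex.exp ⁻¹' K1)ᶜ z := by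
    have a1 := near z y e2 hez he2 hye2
    have a2 := near (h1 z) (h y) (h e2) hehz ((hi2 _).2 he2) (image_comp h hi1 hye2)
    have hp : ((Real.log ρ - 1 : ℝ) : ℂ) ∈ {ξ : ℂ | ξ.re < Real.log ρ} := by
      show _ < Real.log ρ
      simp
    have := connectedComponentIn_eq (a1 hp)
    rw [← Set.preimage_compl, this, ← connectedComponentIn_eq (a2 hp)]
    refine mem_connectedComponentIn ?_
    show Complex.exp (h1 z) ∈ K1ᶜ
    rw [hehz]
    exact fun h => hy1 ((hi1 _).1 h)
  have jAB := E_lemma hA hB hAB hzA hzB jA jB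
  refine BL_lemma h1 H1 (Complex.exp ⁻¹' K1 ∪ Complex.exp ⁻¹' K2) (hA.union hB) ?_ ?_ ?_ z ?_ jAB
    (Lift_rec h h1 hr hrr h1e h1r hrec z)
  · rw [← Set.preimage_union]
    intro S U hU hS hSc
    by_contra hne
    obtain ⟨ζ, hζ⟩ := Set.nonempty_iff_ne_empty.2 hne
    have hV : IsOpen (Complex.exp '' U) := Complex.isOpenMap_exp _ hU
    have hSi : Complex.exp '' S = (K1 ∪ K2) ∩ Complex.exp '' U := by
      rw [hS]
      ext w
      constructor
      · rintro ⟨u, ⟨hu1, hu2⟩, rfl⟩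
        exact ⟨hu1, u, hu2, rfl⟩
      · rintro ⟨hw, u, hu, rfl⟩
        exact ⟨u, ⟨hw, hu⟩, rfl⟩
    have hcS : IsCompact (Complex.exp '' S) := hSc.image Complex.continuous_exp
    have t1 : K1 ∩ Complex.exp '' U = ∅ := by
      refine hN _ _ hV rfl ?_
      have : K1 ∩ Complex.exp '' U = Complex.exp '' S ∩ K1 := by
        rw [hSi]; ext w; simp only [Set.mem_inter_iff, Set.mem_union]; tauto
      rw [this]; exact hcS.inter_right hK1
    have hζ' : Complex.exp ζ ∈ (K1 ∪ K2) ∩ Complex.exp '' U := by rw [← hSi]; exact ⟨ζ, hζ, rfl⟩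
    have hζ2 : Complex.exp ζ ∈ K2 := by
      rcases hζ'.1 with h | h
      · have : Complex.exp ζ ∈ K1 ∩ Complex.exp '' U := ⟨h, hζ'.2⟩
        rw [t1] at this; exact this.elim
      · exact h
    obtain ⟨w, hw, hw1, hw2⟩ := hK2c (Complex.exp '' U) (Complex.exp '' S)ᶜ hV hcS.isClosed.isOpen_compl (by
      intro w hw
      by_cases h : w ∈ Complex.exp '' U
      · exact Or.inl h
      · right; rw [hSi]; exact fun h' => h h'.2) ⟨_, hζ2, hζ'.2⟩ ⟨0, h02, by
        rintro ⟨u, -, hu⟩; exact Complex.exp_ne_zero u hu⟩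
    rw [hSi] at hw2
    exact hw2 ⟨Or.inr hw, hw1⟩
  · intro ξ
    simp only [Set.mem_union, Set.mem_preimage, h1e, hi1, hi2]
  · intro ξ hξ
    have := hfix (Complex.exp ξ) (by rw [← h1e, hξ])
    exact this
  · rintro (h | h)
    · exact hzA h
    · exact hzB h
end SphRec

namespace SphRec

/-- `f` fixes `P` and is conjugate, off `P`, to the orientation-preserving plane homeomorphism `h` -/
structure Ch {X : Type*} [MetricSpace X] (f : X ≃ₜ X) (P : X) (ι : ℂ → X) (h : ℂ ≃ₜ ℂ) : Prop where
  emb : IsOpenEmbedding ι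
  rng : Set.range ι = {P}ᶜ
  fix : f P = P
  conj : ∀ z, ι (h z) = f (ι z)
  op : OP h

section
variable {X : Type*} [MetricSpace X] {f : X ≃ₜ X} {P : X} {ι : ℂ → X} {h : ℂ ≃ₜ ℂ}

lemma Ch.neP (c : Ch f P ι h) (z : ℂ) : ι z ≠ P := by
  have : ι z ∈ Set.range ι := ⟨z, rfl⟩
  rw [c.rng] at this
  exact this

lemma Ch.ex (c : Ch f P ι h) {x : X} (hx : x ≠ P) : ∃ z, ι z = x := by
  have : x ∈ Set.range ι := by rw [c.rng]; exact hx
  exact this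

lemma Ch.iter (c : Ch f P ι h) (n : ℕ) : ∀ z, ι (h^[n] z) = f^[n] (ι z) := by
  induction n with
  | zero => intro z; rfl
  | succ k ih => intro z; rw [Function.iterate_succ_apply, ih, Function.iterate_succ_apply, c.conj]

lemma Ch.fix_iff (c : Ch f P ι h) (z : ℂ) : f (ι z) = ι z ↔ h z = z := by
  rw [← c.conj]
  exact c.emb.injective.eq_iff

lemma Ch.recC (c : Ch f P ι h) (hf : Rec f) :
    ∀ R : ℝ, ∀ ε > 0, ∀ m : ℕ, ∃ n ≥ m, ∀ z, ‖z‖ ≤ R → ‖h^[n] z - z‖ < ε := by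
  intro R ε hε m
  obtain ⟨δ, hδ, hδ2⟩ := lebesgue_number_lemma_of_metric
    (s := ι '' closedBall 0 R) (c := fun z0 : ℂ => ι '' ball z0 (ε/2))
    ((isCompact_closedBall 0 R).image c.emb.continuous) (fun z0 => c.emb.isOpenMap _ isOpen_ball) (by
      rintro _ ⟨z, -, rfl⟩
      exact Set.mem_iUnion.2 ⟨z, z, mem_ball_self (by positivity), rfl⟩)
  obtain ⟨n, hn, hn2⟩ := hf δ hδ m
  refine ⟨n, hn, fun z hz => ?_⟩
  obtain ⟨z0, hz0⟩ := hδ2 (ι z) ⟨z, by simpa using hz, rfl⟩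
  obtain ⟨a, ha, ha'⟩ := hz0 (mem_ball_self hδ)
  have h2 : ι (h^[n] z) ∈ ball (ι z) δ := by
    rw [c.iter]; exact hn2 _
  obtain ⟨b, hb, hb'⟩ := hz0 h2
  rw [c.emb.injective ha'] at ha
  rw [c.emb.injective hb'] at hb
  rw [← dist_eq_norm]
  rw [mem_ball] at ha hb
  have := dist_triangle_right (h^[n] z) z z0
  linarith

lemma Ch.recP (c : Ch f P ι h) (hf : Rec f) (z : ℂ) :
    ∀ ε > 0, ∃ N : ℕ, 2 ≤ N ∧ dist (h^[N] z) z < ε := by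
  intro ε hε
  obtain ⟨n, hn, h2⟩ := c.recC hf ‖z‖ ε hε 2
  exact ⟨n, hn, by rw [dist_eq_norm]; exact h2 z le_rfl⟩

lemma Ch.translate (c : Ch f P ι h) (a : ℂ) :
    Ch f P (fun z => ι (z + a)) (((Homeomorph.addRight a).trans h).trans (Homeomorph.addRight (-a))) where
  emb := c.emb.comp (Homeomorph.addRight a).isOpenEmbedding
  rng := by
    rw [← c.rng]
    exact (Homeomorph.addRight a).surjective.range_comp ι
  fix := c.fix
  conj z := by
    simp [c.conj]
  op := by
    obtain ⟨L, hL, hL2⟩ := c.op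
    refine ⟨fun x y => L (x + a) (y + a), ?_, ?_⟩
    · exact hL.comp (f := fun p : ℂ × ℂ => (p.1 + a, p.2 + a)) (by fun_prop)
        (fun p hp h => hp (add_right_cancel h))
    · intro x y hxy
      have := hL2 (x + a) (y + a) (fun h => hxy (add_right_cancel h))
      simpa using this

lemma Ch.main_A (c : Ch f P ι h) (hf : Rec f) (h1 : ∀ x, f x = x → x = P) : False := by
  refine BL_lemma h c.op ∅ isClosed_empty ?_ (by simp) ?_ 0 (by simp) ?_ (c.recP hf 0)
  · intro S U _ hS _
    simpa using hS
  · intro z hz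
    exact absurd (h1 _ ((c.fix_iff z).2 hz)) (c.neP z)
  · rw [Set.compl_empty, connectedComponentIn_univ, PreconnectedSpace.connectedComponent_eq_univ]
    trivial

lemma Ch.pre_closed (c : Ch f P ι h) {C : Set X} (hC : IsClosed C) : IsClosed (ι ⁻¹' C) :=
  hC.preimage c.emb.continuous

lemma Ch.image_pre (c : Ch f P ι h) {C : Set X} (hP : P ∉ C) : ι '' (ι ⁻¹' C) = C := by
  rw [Set.image_preimage_eq_iff, c.rng]
  exact fun x hx h => hP (h ▸ hx)

lemma Ch.pre_compact [CompactSpace X] (c : Ch f P ι h) {C : Set X} (hC : IsClosed C) (hP : P ∉ C) :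
    IsCompact (ι ⁻¹' C) := by
  rw [c.emb.isInducing.isCompact_iff, c.image_pre hP]
  exact hC.isCompact

lemma Ch.pre_conn (c : Ch f P ι h) {C : Set X} (hC : IsPreconnected C) (hP : P ∉ C) :
    IsPreconnected (ι ⁻¹' C) := by
  rw [← c.emb.isInducing.isPreconnected_image, c.image_pre hP]
  exact hC

lemma Ch.pre_inv (c : Ch f P ι h) {C : Set X} (hC : ∀ z, f z ∈ C ↔ z ∈ C) (z : ℂ) :
    h z ∈ ι ⁻¹' C ↔ z ∈ ι ⁻¹' C := by
  rw [Set.mem_preimage, Set.mem_preimage, c.conj, hC]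

lemma ball_comp {K : Set ℂ} {y e : ℂ} {ρ : ℝ} (hρ : 0 < ρ) (he : ‖e - y‖ = ρ) (heK : e ∉ K)
    (hK : ∀ z ∈ K, ρ ≤ ‖z - y‖) : y ∈ connectedComponentIn Kᶜ e := by
  have h1 : IsPreconnected (insert e (ball y ρ)) := by
    refine (convex_ball y ρ).isPreconnected.subset_closure (Set.subset_insert _ _) ?_
    rw [closure_ball y hρ.ne']
    rintro z (rfl | hz)
    · rw [mem_closedBall, dist_eq_norm, he]
    · exact ball_subset_closedBall hz
  refine h1.subset_connectedComponentIn (Set.mem_insert _ _) ?_ (Set.mem_insert_of_mem _ (mem_ball_self hρ))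
  rintro z (rfl | hz)
  · exact heK
  · intro hzK
    have := hK z hzK
    rw [mem_ball, dist_eq_norm] at hz
    linarith

lemma Ch.two_abs0 [CompactSpace X] (c : Ch f P ι h) (hf : Rec f) {C1 C2 : Set X} (h1 : IsClosed C1) (h2 : IsClosed C2)
    (h1c : IsPreconnected C1) (h2c : IsPreconnected C2) (hi1 : ∀ z, f z ∈ C1 ↔ z ∈ C1)
    (hi2 : ∀ z, f z ∈ C2 ↔ z ∈ C2) (hd : Disjoint C1 C2) (hP : P ∈ C1) (h0 : ι 0 ∈ C2) (h00 : f (ι 0) = ι 0)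
    (hF : ∀ x, f x = x → x ∈ C1 ∪ C2) {r : X} (hr : f r = r) (hrP : r ≠ P) (hr0 : r ≠ ι 0)
    {y e1 e2 : ℂ} {ρ : ℝ} (hρ : 0 < ρ) (hB1 : ∀ z, ι z ∈ C1 → ρ ≤ ‖z - y‖) (hB2 : ∀ z, ι z ∈ C2 → ρ ≤ ‖z - y‖)
    (he1 : ι e1 ∈ C1) (he2 : ι e2 ∈ C2) (hn1 : ‖e1 - y‖ = ρ) (hn2 : ‖e2 - y‖ = ρ) : False := by
  have hP2 : P ∉ C2 := fun h => Set.disjoint_left.1 hd hP h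
  obtain ⟨r0, rfl⟩ := c.ex hrP
  have hr0' : r0 ≠ 0 := fun h => hr0 (by rw [h])
  refine two_classes h c.op ((c.fix_iff 0).1 h00) hr0' ((c.fix_iff r0).1 hr) (c.recC hf)
    (K1 := ι ⁻¹' C1) (K2 := ι ⁻¹' C2) (c.pre_closed h1) (NoCpt_of_continuum c.emb c.neP h1 h1c hP)
    (c.pre_compact h2 hP2) (c.pre_conn h2c hP2) h0 (hd.preimage ι) (c.pre_inv hi1) (c.pre_inv hi2)
    (fun z hz => hF _ ((c.fix_iff z).2 hz)) (y := y) (e1 := e1) (e2 := e2) ?_ ?_ he1 he2 ?_ ?_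
  · intro h; have := hB1 y h; simp at this; linarith
  · intro h; have := hB2 y h; simp at this; linarith
  · exact ball_comp hρ hn1 (fun h => Set.disjoint_left.1 hd he1 h) hB2
  · exact ball_comp hρ hn2 (fun h => Set.disjoint_left.1 hd h he2) hB1

lemma Ch.two_abs [CompactSpace X] (c : Ch f P ι h) (hf : Rec f) {C1 C2 : Set X} (h1 : IsClosed C1) (h2 : IsClosed C2)
    (h1c : IsPreconnected C1) (h2c : IsPreconnected C2) (hi1 : ∀ z, f z ∈ C1 ↔ z ∈ C1)
    (hi2 : ∀ z, f z ∈ C2 ↔ z ∈ C2) (hd : Disjoint C1 C2) (hP : P ∈ C1) {q : X} (h0 : q ∈ C2) (h00 : f q = q)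
    (hF : ∀ x, f x = x → x ∈ C1 ∪ C2) {r : X} (hr : f r = r) (hrP : r ≠ P) (hr0 : r ≠ q)
    {y e1 e2 : ℂ} {ρ : ℝ} (hρ : 0 < ρ) (hB1 : ∀ z, ι z ∈ C1 → ρ ≤ ‖z - y‖) (hB2 : ∀ z, ι z ∈ C2 → ρ ≤ ‖z - y‖)
    (he1 : ι e1 ∈ C1) (he2 : ι e2 ∈ C2) (hn1 : ‖e1 - y‖ = ρ) (hn2 : ‖e2 - y‖ = ρ) : False := by
  have hqP : q ≠ P := fun h => Set.disjoint_left.1 hd hP (h ▸ h0)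
  obtain ⟨q0, rfl⟩ := c.ex hqP
  refine (c.translate q0).two_abs0 hf h1 h2 h1c h2c hi1 hi2 hd hP (by simpa using h0) (by simpa using h00) hF hr hrP
    (by simpa using hr0) (y := y - q0) (e1 := e1 - q0) (e2 := e2 - q0) hρ ?_ ?_ (by simpa using he1)
    (by simpa using he2) (by simpa using hn1) (by simpa using hn2)
  · intro z hz
    have := hB1 _ hz
    rwa [show z + q0 - y = z - (y - q0) by ring] at this
  · intro z hz
    have := hB2 _ hz
    rwa [show z + q0 - y = z - (y - q0) by ring] at this

lemma Ch.main_B [CompactSpace X] [PreconnectedSpace X] (c : Ch f P ι h) (hf : Rec f) (hne : ∃ x, f x ≠ x)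
    (h3 : ∀ q, ∃ r, f r = r ∧ r ≠ P ∧ r ≠ q) : False := by
  classical
  set F : Set X := {x | f x = x} with hFd
  have hFc : IsClosed F := isClosed_eq f.continuous continuous_id
  set 𝒮 : Set (Set X) := {Z | IsClosed Z ∧ IsPreconnected Z ∧ F ⊆ Z ∧ ∀ z, f z ∈ Z ↔ z ∈ Z} with h𝒮
  obtain ⟨Z, -, hZm⟩ := zorn_superset_nonempty 𝒮 (by
    intro ch hch hchain hnon
    have : Nonempty ch := hnon.to_subtype
    refine ⟨⋂ i : ch, (i : Set X), ⟨?_, ?_, ?_, ?_⟩, ?_⟩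
    · exact isClosed_iInter fun i => (hch i.2).1
    · refine nested _ ?_ (fun i => (hch i.2).1) (fun i => (hch i.2).2.1)
      intro i j
      rcases hchain.total i.2 j.2 with hij | hij
      · exact ⟨i, subset_rfl, hij⟩
      · exact ⟨j, hij, subset_rfl⟩
    · exact Set.subset_iInter fun i => (hch i.2).2.2.1
    · intro z
      simp only [Set.mem_iInter]
      exact forall_congr' fun i => (hch i.2).2.2.2 z
    · intro s hs
      exact Set.iInter_subset (fun i : ch => (i : Set X)) ⟨s, hs⟩) Set.univ
    ⟨isClosed_univ, isPreconnected_univ, Set.subset_univ _, by simp⟩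
  obtain ⟨⟨hZ, hZc, hFZ, hZf⟩, hmin⟩ := hZm
  have hPF : P ∈ F := c.fix
  by_cases hZF : Z ⊆ F
  · have hZF' : Z = F := Set.Subset.antisymm hZF hFZ
    rw [hZF'] at hZc
    obtain ⟨x, hx⟩ := hne
    have hxP : x ≠ P := fun h => hx (by rw [h]; exact c.fix)
    obtain ⟨x0, rfl⟩ := c.ex hxP
    have hx0 : h x0 ≠ x0 := fun hh => hx ((c.fix_iff x0).2 hh)
    have hc : {z | h z ≠ z} = (ι ⁻¹' F)ᶜ := by
      ext z
      show h z ≠ z ↔ ¬ (f (ι z) = ι z)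
      rw [c.fix_iff]
    have hBK := BK_lemma h c.op hx0
    rw [hc] at hBK
    refine BL_lemma h c.op (ι ⁻¹' F) (c.pre_closed hFc) (NoCpt_of_continuum c.emb c.neP hFc hZc hPF)
      (c.pre_inv ?_) ?_ x0 hx hBK (c.recP hf x0)
    · intro z
      show f (f z) = f z ↔ f z = z
      exact f.injective.eq_iff
    · intro z hz
      exact (c.fix_iff z).2 hz
  · obtain ⟨y, hyZ, hyF⟩ := Set.not_subset.1 hZF
    have hyP : y ≠ P := fun h => hyF (h ▸ hPF)
    obtain ⟨y0, rfl⟩ := c.ex hyP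
    have hy0 : h y0 ≠ y0 := fun hh => hyF ((c.fix_iff y0).2 hh)
    -- small ball
    obtain ⟨ρ, hρ, hρB⟩ : ∃ ρ > 0, ∀ z w, ‖z - y0‖ ≤ ρ → ‖w - y0‖ ≤ ρ → z ≠ h w := by
      have hcont : ContinuousAt (fun p : ℂ × ℂ => p.1 - h p.2) (y0, y0) := by
        have := h.continuous
        fun_prop
      have hev := hcont.eventually_ne (sub_ne_zero.2 hy0.symm)
      obtain ⟨δ, hδ, hδ2⟩ := Metric.eventually_nhds_iff.1 hev
      refine ⟨δ/2, by positivity, fun z w hz hw => ?_⟩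
      have := @hδ2 (z, w) (by
        rw [Prod.dist_eq, max_lt_iff, dist_eq_norm, dist_eq_norm]
        constructor <;> simp only <;> linarith)
      exact sub_ne_zero.1 this
    set B := ι '' ball y0 ρ with hBd
    have hB : IsOpen B := c.emb.isOpenMap _ isOpen_ball
    have hBcl : closure B ⊆ ι '' closedBall y0 ρ :=
      closure_minimal (Set.image_mono ball_subset_closedBall)
        ((isCompact_closedBall y0 ρ).image c.emb.continuous).isClosed
    have hyB : ι y0 ∈ B := ⟨y0, mem_ball_self hρ, rfl⟩
    have hFB : ∀ u ∈ F, u ∉ B := by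
      rintro _ hu ⟨u, hu2, rfl⟩
      have hu3 := (c.fix_iff u).1 hu
      rw [mem_ball, dist_eq_norm] at hu2
      exact hρB u u hu2.le hu2.le hu3.symm
    set W := {z | z ∈ Z ∧ ∀ i : ℕ, f^[i] z ∉ B} with hW
    set C : X → Set X := fun u => connectedComponentIn W u with hCd
    have hCinv := fun u (hu : u ∈ F) => C_inv hf hZ hZf (hFZ hu) hu hB (hFB u hu)
    have hCW : ∀ u, C u ⊆ W := fun u => connectedComponentIn_subset _ _
    have hCc : ∀ u, IsPreconnected (C u) := fun u => isPreconnected_connectedComponentIn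
    have hCB : ∀ u z, ι z ∈ C u → ρ ≤ ‖z - y0‖ := by
      intro u z hz
      by_contra hcon
      push Not at hcon
      exact (hCW u hz).2 0 ⟨z, by rw [mem_ball, dist_eq_norm]; exact hcon, rfl⟩
    have hCe : ∀ u ∈ F, ∃ e, ι e ∈ C u ∧ ‖e - y0‖ = ρ := by
      intro u hu
      obtain ⟨x, hx1, hx2⟩ := C_lemma hf hZ hZc hZf (hFZ hu) hu hB ⟨_, hyZ, hyB⟩ (hFB u hu)
      obtain ⟨e, he, rfl⟩ := hBcl hx2
      rw [mem_closedBall, dist_eq_norm] at he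
      exact ⟨e, hx1, le_antisymm he (hCB u e hx1)⟩
    have hCd : ∀ u v, v ∈ F → v ∉ C u → Disjoint (C u) (C v) := by
      intro u v hv hvu
      rw [Set.disjoint_left]
      intro x hx1 hx2
      have e1 : C u = connectedComponentIn W x := connectedComponentIn_eq hx1
      have e2 : C v = connectedComponentIn W x := connectedComponentIn_eq hx2
      apply hvu
      rw [e1, ← e2]
      exact (hCinv v hv).2.1
    have hex : ∃ q ∈ F, q ∉ C P := by
      by_contra hcon
      push Not at hcon
      have : C P ∈ 𝒮 := ⟨(hCinv P hPF).1, hCc P, hcon, (hCinv P hPF).2.2⟩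
      have h2 := hmin this (fun x hx => (hCW P hx).1) hyZ
      have := hCB P y0 h2
      simp at this
      linarith
    obtain ⟨q, hq, hqP⟩ := hex
    have hd1 := hCd P q hq hqP
    have hPq : P ∉ C q := fun h => Set.disjoint_left.1 hd1 (hCinv P hPF).2.1 h
    obtain ⟨e1, he1, hn1⟩ := hCe P hPF
    obtain ⟨e2, he2, hn2⟩ := hCe q hq
    by_cases hthird : ∃ r ∈ F, r ∉ C P ∧ r ∉ C q
    · obtain ⟨r, hr, hrP, hrq⟩ := hthird
      have hd2 := hCd P r hr hrP
      have hd3 := hCd q r hr hrq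
      have hPr : P ∉ C r := fun h => Set.disjoint_left.1 hd2 (hCinv P hPF).2.1 h
      obtain ⟨e3, he3, hn3⟩ := hCe r hr
      refine three_classes c.op y0 ρ hρ hρB ![ι ⁻¹' C P, ι ⁻¹' C q, ι ⁻¹' C r] ?_
        (c.pre_compact (hCinv q hq).1 hPq) (c.pre_compact (hCinv r hr).1 hPr) ?_ ?_ ?_ ![e1, e2, e3] ?_ ?_
      · intro i
        fin_cases i
        · exact linked_of_NoCpt (c.pre_closed (hCinv P hPF).1)
            (NoCpt_of_continuum c.emb c.neP (hCinv P hPF).1 (hCc P) (hCinv P hPF).2.1)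
        · exact linked_of_preconn (c.pre_conn (hCc q) hPq)
        · exact linked_of_preconn (c.pre_conn (hCc r) hPr)
      · intro i j hij
        fin_cases i <;> fin_cases j <;> first | exact absurd rfl hij | skip
        · exact hd1.preimage ι
        · exact hd2.preimage ι
        · exact hd1.symm.preimage ι
        · exact hd3.preimage ι
        · exact hd2.symm.preimage ι
        · exact hd3.symm.preimage ι
      · intro i
        fin_cases i
        · exact c.pre_inv (hCinv P hPF).2.2
        · exact c.pre_inv (hCinv q hq).2.2
        · exact c.pre_inv (hCinv r hr).2.2
      · intro i
        fin_cases i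
        · exact hCB P
        · exact hCB q
        · exact hCB r
      · intro i
        fin_cases i
        · exact he1
        · exact he2
        · exact he3
      · intro i
        fin_cases i
        · exact hn1
        · exact hn2
        · exact hn3
    · push Not at hthird
      obtain ⟨r, hr, hrP, hrq⟩ := h3 q
      refine c.two_abs hf (hCinv P hPF).1 (hCinv q hq).1 (hCc P) (hCc q) (hCinv P hPF).2.2 (hCinv q hq).2.2 hd1
        (hCinv P hPF).2.1 (hCinv q hq).2.1 hq ?_ hr hrP hrq hρ (hCB P) (hCB q) he1 he2 hn1 hn2
      intro x hx
      by_cases hxP : x ∈ C P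
      · exact Or.inl hxP
      · exact Or.inr (hthird x hx hxP)

theorem Ch.main [CompactSpace X] [PreconnectedSpace X] (c : Ch f P ι h) (hf : Rec f) (hne : ∃ x, f x ≠ x) :
    ∃ a b : X, a ≠ b ∧ {x : X | f x = x} = {a, b} := by
  by_cases h1 : ∀ x, f x = x → x = P
  · exact (c.main_A hf h1).elim
  · by_cases h3 : ∀ q, ∃ r, f r = r ∧ r ≠ P ∧ r ≠ q
    · exact (c.main_B hf hne h3).elim
    · push Not at h1 h3
      obtain ⟨a, ha, haP⟩ := h1
      obtain ⟨q, hq⟩ := h3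
      have haq : a = q := hq a ha haP
      refine ⟨P, a, haP.symm, ?_⟩
      ext x
      constructor
      · intro hx
        by_cases hxP : x = P
        · exact Or.inl hxP
        · exact Or.inr ((hq x hx hxP).trans haq.symm)
      · rintro (rfl | rfl)
        · exact c.fix
        · exact ha
end
end SphRec

namespace SphRec

abbrev E3 := EuclideanSpace ℝ (Fin 3)

/-- the Bargmann invariant (times 4) of a triple of unit vectors -/
def T3 (a b c : E3) : ℂ :=
  ⟨1 + (a 0 * b 0 + a 1 * b 1 + a 2 * b 2) + (b 0 * c 0 + b 1 * c 1 + b 2 * c 2) +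
    (c 0 * a 0 + c 1 * a 1 + c 2 * a 2),
   a 0 * (b 1 * c 2 - b 2 * c 1) + a 1 * (b 2 * c 0 - b 0 * c 2) + a 2 * (b 0 * c 1 - b 1 * c 0)⟩

lemma hopf_surj {x y z : ℝ} (h : x ^ 2 + y ^ 2 + z ^ 2 = 1) : ∃ u1 u2 v1 v2 : ℝ,
    u1 ^ 2 + u2 ^ 2 + v1 ^ 2 + v2 ^ 2 = 1 ∧ x = 2 * (u1 * v1 + u2 * v2) ∧ y = 2 * (u1 * v2 - u2 * v1) ∧
    z = u1 ^ 2 + u2 ^ 2 - v1 ^ 2 - v2 ^ 2 := by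
  by_cases hz : z = -1
  · subst hz
    have hx : x = 0 := by nlinarith [sq_nonneg x, sq_nonneg y]
    have hy : y = 0 := by nlinarith [sq_nonneg x, sq_nonneg y]
    exact ⟨0, 0, 1, 0, by norm_num, by simp [hx], by simp [hy], by norm_num⟩
  · have hz1 : -1 ≤ z := by nlinarith [sq_nonneg x, sq_nonneg y]
    have hz2 : 0 < (1 + z) / 2 := by
      have := lt_of_le_of_ne hz1 (Ne.symm hz)
      linarith
    set u := Real.sqrt ((1 + z) / 2) with hu
    have hup : 0 < u := Real.sqrt_pos.2 hz2
    have hu2 : u ^ 2 = (1 + z) / 2 := Real.sq_sqrt hz2.le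
    have e : (x / (2 * u)) ^ 2 + (y / (2 * u)) ^ 2 = (1 - z) / 2 := by
      rw [div_pow, div_pow, ← add_div, mul_pow, hu2]
      rw [div_eq_iff (by positivity)]
      nlinarith
    refine ⟨u, 0, x / (2 * u), y / (2 * u), ?_, ?_, ?_, ?_⟩
    · linarith
    · field_simp; ring
    · field_simp; ring
    · linarith

/-- a spinor over each point, chosen arbitrarily -/
lemma exists_spinor : ∃ Ψ : E3 → ℂ × ℂ, ∀ a b c : E3,
    a 0 ^ 2 + a 1 ^ 2 + a 2 ^ 2 = 1 → b 0 ^ 2 + b 1 ^ 2 + b 2 ^ 2 = 1 → c 0 ^ 2 + c 1 ^ 2 + c 2 ^ 2 = 1 →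
    T3 a b c = 4 * ((starRingEnd ℂ (Ψ a).1 * (Ψ b).1 + starRingEnd ℂ (Ψ a).2 * (Ψ b).2) *
      (starRingEnd ℂ (Ψ b).1 * (Ψ c).1 + starRingEnd ℂ (Ψ b).2 * (Ψ c).2) *
      (starRingEnd ℂ (Ψ c).1 * (Ψ a).1 + starRingEnd ℂ (Ψ c).2 * (Ψ a).2)) := by
  have : ∀ a : E3, ∃ p : ℂ × ℂ, a 0 ^ 2 + a 1 ^ 2 + a 2 ^ 2 = 1 →
      p.1.re ^ 2 + p.1.im ^ 2 + p.2.re ^ 2 + p.2.im ^ 2 = 1 ∧ a 0 = 2 * (p.1.re * p.2.re + p.1.im * p.2.im) ∧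
      a 1 = 2 * (p.1.re * p.2.im - p.1.im * p.2.re) ∧
      a 2 = p.1.re ^ 2 + p.1.im ^ 2 - p.2.re ^ 2 - p.2.im ^ 2 := by
    intro a
    by_cases ha : a 0 ^ 2 + a 1 ^ 2 + a 2 ^ 2 = 1
    · obtain ⟨u1, u2, v1, v2, h1, h2, h3, h4⟩ := hopf_surj ha
      exact ⟨(⟨u1, u2⟩, ⟨v1, v2⟩), fun _ => ⟨h1, h2, h3, h4⟩⟩
    · exact ⟨0, fun h => absurd h ha⟩
  choose Ψ hΨ using this
  refine ⟨Ψ, fun a b c ha hb hc => ?_⟩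
  obtain ⟨a1, a2, a3, a4⟩ := hΨ a ha
  obtain ⟨b1, b2, b3, b4⟩ := hΨ b hb
  obtain ⟨c1, c2, c3, c4⟩ := hΨ c hc
  generalize Ψ a = A at *
  generalize Ψ b = B at *
  generalize Ψ c = C at *
  obtain ⟨⟨p1, p2⟩, ⟨p3, p4⟩⟩ := A
  obtain ⟨⟨q1, q2⟩, ⟨q3, q4⟩⟩ := B
  obtain ⟨⟨r1, r2⟩, ⟨r3, r4⟩⟩ := C
  simp only at *
  have e : (T3 a b c).re = (p1 ^ 2 + p2 ^ 2 + p3 ^ 2 + p4 ^ 2) * (q1 ^ 2 + q2 ^ 2 + q3 ^ 2 + q4 ^ 2) *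
      (r1 ^ 2 + r2 ^ 2 + r3 ^ 2 + r4 ^ 2) + (a 0 * b 0 + a 1 * b 1 + a 2 * b 2) * (r1 ^ 2 + r2 ^ 2 + r3 ^ 2 + r4 ^ 2) +
      (b 0 * c 0 + b 1 * c 1 + b 2 * c 2) * (p1 ^ 2 + p2 ^ 2 + p3 ^ 2 + p4 ^ 2) +
    (c 0 * a 0 + c 1 * a 1 + c 2 * a 2) * (q1 ^ 2 + q2 ^ 2 + q3 ^ 2 + q4 ^ 2) := by
    rw [a1, b1, c1]; simp only [T3]; ring
  apply Complex.ext
  · rw [e, a2, a3, a4, b2, b3, b4, c2, c3, c4]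
    simp [Complex.mul_re, Complex.mul_im]
    ring
  · simp only [T3]
    rw [a2, a3, a4, b2, b3, b4, c2, c3, c4]
    simp [Complex.mul_re, Complex.mul_im]
    ring

/-- total argument over the grid -/
noncomputable def N3 (n : ℕ) (x : ℕ → ℕ → E3) : ℝ :=
  ∑ i ∈ Finset.range n, ∑ j ∈ Finset.range n,
    ((T3 (x i j) (x (i+1) j) (x (i+1) (j+1))).arg + (T3 (x i j) (x (i+1) (j+1)) (x i (j+1))).arg)

lemma prod_shift {n : ℕ} {g : ℕ → ℂ} (h0 : g 0 ≠ 0) (h : g 0 = g n) :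
    ∏ i ∈ Finset.range n, g (i+1) = ∏ i ∈ Finset.range n, g i := by
  have h1 := Finset.prod_range_succ g n
  have h2 := Finset.prod_range_succ' g n
  rw [h1, ← h] at h2
  exact (mul_right_cancel₀ h0 h2).symm

noncomputable def sg (z : ℂ) : ℂ := z / ‖z‖

lemma sg_mul (z w : ℂ) : sg (z * w) = sg z * sg w := by
  simp only [sg, norm_mul, Complex.ofReal_mul, mul_div_mul_comm]

lemma sg_conj (z : ℂ) : sg (starRingEnd ℂ z) = starRingEnd ℂ (sg z) := by
  simp [sg]

lemma sg_norm {z : ℂ} (hz : z ≠ 0) : sg z * starRingEnd ℂ (sg z) = 1 := by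
  have h : (‖z‖ : ℂ) ≠ 0 := by simpa using hz
  simp only [sg, map_div₀, Complex.conj_ofReal]
  rw [div_mul_div_comm, Complex.mul_conj, Complex.normSq_eq_norm_sq]
  push_cast
  rw [sq]
  exact div_self (mul_ne_zero h h)

lemma sg_arg {z : ℂ} (hz : z ≠ 0) : Complex.exp (z.arg * Complex.I) = sg z := by
  have h : (‖z‖ : ℂ) ≠ 0 := by simpa using hz
  rw [sg, eq_div_iff h, mul_comm]
  exact Complex.norm_mul_exp_arg_mul_I z

lemma N3_int {n : ℕ} {x : ℕ → ℕ → E3} (hx : ∀ i j, x i j 0 ^ 2 + x i j 1 ^ 2 + x i j 2 ^ 2 = 1)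
    (hper : ∀ i, x i 0 = x i n) (h0 : ∀ j, x 0 j = x 0 0) (hn : ∀ j, x n j = x n 0)
    (h1 : ∀ i < n, ∀ j < n, T3 (x i j) (x (i+1) j) (x (i+1) (j+1)) ≠ 0)
    (h2 : ∀ i < n, ∀ j < n, T3 (x i j) (x (i+1) (j+1)) (x i (j+1)) ≠ 0) :
    Complex.exp (N3 n x * Complex.I) = 1 := by
  obtain ⟨Ψ, hΨ⟩ := exists_spinor
  set E : E3 → E3 → ℂ := fun a b => starRingEnd ℂ (Ψ a).1 * (Ψ b).1 + starRingEnd ℂ (Ψ a).2 * (Ψ b).2 with hE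
  have hT : ∀ i j k l p q, T3 (x i j) (x k l) (x p q) = 4 * (E (x i j) (x k l) * E (x k l) (x p q) * E (x p q) (x i j)) :=
    fun i j k l p q => hΨ _ _ _ (hx _ _) (hx _ _) (hx _ _)
  have hEc : ∀ a b, E b a = starRingEnd ℂ (E a b) := by
    intro a b
    simp only [hE, map_add, map_mul, Complex.conj_conj]
    ring
  have sg4 : sg 4 = 1 := by simp [sg]
  have hE1 : ∀ i j, E (x i j) (x i j) ≠ 0 := by
    intro i j h
    have e1 := hT i j i j i j
    rw [h] at e1
    have e2 := congrArg Complex.re e1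
    have := hx i j
    simp [T3] at e2
    nlinarith
  have sgE1 : ∀ i j, sg (E (x i j) (x i j)) = 1 := by
    intro i j
    have e1 := hT i j i j i j
    have e2 : T3 (x i j) (x i j) (x i j) = 4 := by
      apply Complex.ext
      · have := hx i j
        simp [T3]; nlinarith
      · simp [T3]; ring
    have e3 := hEc (x i j) (x i j)
    have e4 : E (x i j) (x i j) * E (x i j) (x i j) * E (x i j) (x i j) = 1 := by
      rw [e2] at e1
      have h4 : (4:ℂ) ≠ 0 := by norm_num
      exact mul_left_cancel₀ h4 (by rw [← e1, mul_one])
    have e5 := sg_norm (hE1 i j)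
    rw [← sg_conj, ← e3] at e5
    have e6 : sg (E (x i j) (x i j) * E (x i j) (x i j) * E (x i j) (x i j)) = 1 := by
      rw [e4]; simp [sg]
    rw [sg_mul, sg_mul, e5, one_mul] at e6
    exact e6
  set u : ℕ → ℕ → ℂ := fun i j => sg (E (x i j) (x (i+1) j)) with hu
  set v : ℕ → ℕ → ℂ := fun i j => sg (E (x i j) (x i (j+1))) with hv
  have hcell : ∀ i < n, ∀ j < n, sg (T3 (x i j) (x (i+1) j) (x (i+1) (j+1))) *
      sg (T3 (x i j) (x (i+1) (j+1)) (x i (j+1))) =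
      u i j * starRingEnd ℂ (u i (j+1)) * (v (i+1) j * starRingEnd ℂ (v i j)) := by
    intro i hi j hj
    have a1 := h1 i hi j hj
    rw [hT] at a1 ⊢
    rw [hT]
    have a2 : E (x (i+1) (j+1)) (x i j) ≠ 0 := right_ne_zero_of_mul (right_ne_zero_of_mul a1)
    have a3 := sg_norm a2
    rw [← sg_conj, ← hEc] at a3
    simp only [sg_mul, sg4, hu, hv, one_mul, ← sg_conj]
    rw [← hEc, ← hEc]
    linear_combination (sg (E (x i j) (x (i + 1) j)) * sg (E (x (i + 1) j) (x (i + 1) (j + 1))) *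
      sg (E (x (i + 1) (j + 1)) (x i (j + 1))) * sg (E (x i (j + 1)) (x i j))) * a3
  have hune : ∀ i < n, ∀ j < n, u i j * starRingEnd ℂ (u i j) = 1 := by
    intro i hi j hj
    have a1 := h1 i hi j hj
    rw [hT] at a1
    exact sg_norm (left_ne_zero_of_mul (left_ne_zero_of_mul (right_ne_zero_of_mul a1)))
  have hvne : ∀ i < n, ∀ j < n, v i j * starRingEnd ℂ (v i j) = 1 := by
    intro i hi j hj
    have a1 := h2 i hi j hj
    rw [hT] at a1
    refine sg_norm ?_
    rw [hEc]
    intro h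
    have h' : E (x i (j+1)) (x i j) = 0 := by simpa using h
    exact right_ne_zero_of_mul (right_ne_zero_of_mul a1) h'
  rw [N3]
  push_cast
  rw [Finset.sum_mul, Complex.exp_sum]
  have hstep : ∀ i ∈ Finset.range n, Complex.exp ((∑ j ∈ Finset.range n,
      (((T3 (x i j) (x (i+1) j) (x (i+1) (j+1))).arg : ℂ) + ((T3 (x i j) (x (i+1) (j+1)) (x i (j+1))).arg : ℂ))) *
      Complex.I) = ∏ j ∈ Finset.range n, (v (i+1) j * starRingEnd ℂ (v i j)) := by
    intro i hi
    rw [Finset.mem_range] at hi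
    rw [Finset.sum_mul, Complex.exp_sum]
    have : ∀ j ∈ Finset.range n, Complex.exp ((((T3 (x i j) (x (i+1) j) (x (i+1) (j+1))).arg : ℂ) +
        ((T3 (x i j) (x (i+1) (j+1)) (x i (j+1))).arg : ℂ)) * Complex.I) =
        u i j * starRingEnd ℂ (u i (j+1)) * (v (i+1) j * starRingEnd ℂ (v i j)) := by
      intro j hj
      rw [Finset.mem_range] at hj
      rw [← hcell i hi j hj, add_mul, Complex.exp_add, sg_arg (h1 i hi j hj), sg_arg (h2 i hi j hj)]
    rw [Finset.prod_congr rfl this, Finset.prod_mul_distrib, Finset.prod_mul_distrib (f := fun j => u i j)]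
    have hu0 : starRingEnd ℂ (u i 0) ≠ 0 := by
      intro h
      have := hune i hi 0 (by omega)
      rw [h] at this; simp at this
    have := prod_shift (n := n) (g := fun j => starRingEnd ℂ (u i j)) hu0 (by
      simp only [hu, hper])
    rw [this, ← Finset.prod_mul_distrib, Finset.prod_congr rfl (fun j hj => hune i hi j (Finset.mem_range.1 hj))]
    simp
  rw [Finset.prod_congr rfl hstep, Finset.prod_comm]
  apply Finset.prod_eq_one
  intro j hj
  rw [Finset.mem_range] at hj
  have v0 : v 0 j = 1 := by
    simp only [hv]; rw [h0 (j+1), h0 j]; exact sgE1 0 0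
  have vn : v n j = 1 := by
    simp only [hv]; rw [hn (j+1), hn j]; exact sgE1 n 0
  rw [Finset.prod_mul_distrib]
  rw [prod_shift (n := n) (g := fun i => v i j) (by rw [v0]; exact one_ne_zero) (by rw [v0, vn])]
  rw [← Finset.prod_mul_distrib]
  exact Finset.prod_eq_one (fun i hi => hvne i (Finset.mem_range.1 hi) j hj)
end SphRec

namespace SphRec

abbrev S2 : Set E3 := Metric.sphere 0 1

lemma unit_sq (a : S2) : (a : E3) 0 ^ 2 + (a : E3) 1 ^ 2 + (a : E3) 2 ^ 2 = 1 := by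
  have h : ‖(a : E3)‖ = 1 := by simp
  have h2 := EuclideanSpace.real_norm_sq_eq (a : E3)
  rw [h, Fin.sum_univ_three] at h2
  linarith

lemma mem_S2 {a : E3} (h : a 0 ^ 2 + a 1 ^ 2 + a 2 ^ 2 = 1) : a ∈ S2 := by
  have h2 := EuclideanSpace.real_norm_sq_eq a
  rw [Fin.sum_univ_three, h] at h2
  rw [mem_sphere_zero_iff_norm]
  nlinarith [norm_nonneg a]

lemma dot_close {a b : S2} (h : dist (a : E3) b < 1) :
    1 / 2 < (a : E3) 0 * (b : E3) 0 + (a : E3) 1 * (b : E3) 1 + (a : E3) 2 * (b : E3) 2 := by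
  rw [EuclideanSpace.dist_eq, Real.sqrt_lt' one_pos, Fin.sum_univ_three] at h
  simp only [Real.dist_eq, sq_abs] at h
  have := unit_sq a
  have := unit_sq b
  nlinarith

lemma T3_re {a b c : S2} (h1 : dist (a : E3) b < 1) (h2 : dist (b : E3) c < 1) (h3 : dist (c : E3) a < 1) :
    0 < (T3 a b c).re := by
  have := dot_close h1
  have := dot_close h2
  have := dot_close h3
  simp only [T3]
  linarith

lemma T3_cont {Y : Type*} [TopologicalSpace Y] {a b c : Y → E3} (ha : Continuous a) (hb : Continuous b)
    (hc : Continuous c) : Continuous fun y => T3 (a y) (b y) (c y) := by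
  have : (fun y => T3 (a y) (b y) (c y)) = fun y => (((T3 (a y) (b y) (c y)).re : ℝ) : ℂ) +
    (((T3 (a y) (b y) (c y)).im : ℝ) : ℂ) * Complex.I := by
    ext y; exact (Complex.re_add_im _).symm
  rw [this]
  simp only [T3]
  fun_prop

/-- spherical coordinates -/
noncomputable def sph (s t : ℝ) : S2 :=
  ⟨!₂[Real.sin (Real.pi * s) * Real.cos (2 * Real.pi * t), Real.sin (Real.pi * s) * Real.sin (2 * Real.pi * t),
    Real.cos (Real.pi * s)], by
    apply mem_S2
    simp
    nlinarith [Real.sin_sq_add_cos_sq (Real.pi * s), Real.sin_sq_add_cos_sq (2 * Real.pi * t)]⟩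

lemma sph0 (s t : ℝ) : (sph s t : E3) 0 = Real.sin (Real.pi * s) * Real.cos (2 * Real.pi * t) := by simp [sph]
lemma sph1 (s t : ℝ) : (sph s t : E3) 1 = Real.sin (Real.pi * s) * Real.sin (2 * Real.pi * t) := by simp [sph]
lemma sph2 (s t : ℝ) : (sph s t : E3) 2 = Real.cos (Real.pi * s) := by simp [sph]

lemma S2_ext {a b : S2} (h0 : (a : E3) 0 = (b : E3) 0) (h1 : (a : E3) 1 = (b : E3) 1)
    (h2 : (a : E3) 2 = (b : E3) 2) : a = b := by
  apply Subtype.ext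
  ext i
  fin_cases i
  · exact h0
  · exact h1
  · exact h2

lemma cont_S2 {Y : Type*} [TopologicalSpace Y] {g : Y → S2} (h0 : Continuous fun y => (g y : E3) 0)
    (h1 : Continuous fun y => (g y : E3) 1) (h2 : Continuous fun y => (g y : E3) 2) : Continuous g := by
  refine Continuous.subtype_mk (f := fun y => (g y : E3)) ?_ _
  have : Continuous fun y => (WithLp.toLp 2 (fun i => (g y : E3) i) : E3) := by
    refine (PiLp.continuous_toLp 2 _).comp (continuous_pi fun i => ?_)
    fin_cases i
    · exact h0
    · exact h1
    · exact h2
  exact this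

lemma sph_cont : Continuous fun p : ℝ × ℝ => sph p.1 p.2 := by
  apply cont_S2 <;> simp only [sph0, sph1, sph2] <;> fun_prop

lemma sph_im1 (s s' t t' : ℝ) : (T3 (sph s t) (sph s' t) (sph s' t')).im =
    Real.sin (Real.pi * (s' - s)) * Real.sin (Real.pi * s') * Real.sin (2 * Real.pi * (t' - t)) := by
  simp only [T3, sph0, sph1, sph2]
  rw [show Real.pi * (s' - s) = Real.pi * s' - Real.pi * s by ring,
    show 2 * Real.pi * (t' - t) = 2 * Real.pi * t' - 2 * Real.pi * t by ring, Real.sin_sub, Real.sin_sub]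
  ring

lemma sph_im2 (s s' t t' : ℝ) : (T3 (sph s t) (sph s' t') (sph s t')).im =
    Real.sin (Real.pi * (s' - s)) * Real.sin (Real.pi * s) * Real.sin (2 * Real.pi * (t' - t)) := by
  simp only [T3, sph0, sph1, sph2]
  rw [show Real.pi * (s' - s) = Real.pi * s' - Real.pi * s by ring,
    show 2 * Real.pi * (t' - t) = 2 * Real.pi * t' - 2 * Real.pi * t by ring, Real.sin_sub, Real.sin_sub]
  ring

theorem no_htpy (σ : C(S2, S2)) (hσ : ∀ a b c : S2, T3 (σ a) (σ b) (σ c) = starRingEnd ℂ (T3 a b c)) :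
    ¬ ContinuousMap.Homotopic (ContinuousMap.id S2) σ := by
  rintro ⟨H⟩
  set G : unitInterval × (ℝ × ℝ) → E3 := fun q => (H (q.1, sph q.2.1 q.2.2) : S2) with hG
  have hGc : Continuous G := by
    have := sph_cont.comp (continuous_snd (X := unitInterval) (Y := ℝ × ℝ))
    exact continuous_subtype_val.comp (H.continuous.comp (continuous_fst.prodMk this))
  have hK : IsCompact ((Set.univ : Set unitInterval) ×ˢ (Set.Icc (0:ℝ) 1 ×ˢ Set.Icc (0:ℝ) 1)) :=
    isCompact_univ.prod (isCompact_Icc.prod isCompact_Icc)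
  obtain ⟨δ, hδ, hδ2⟩ := Metric.uniformContinuousOn_iff.1
    (hK.uniformContinuousOn_of_continuous hGc.continuousOn) 1 one_pos
  obtain ⟨n0, hn0⟩ := exists_nat_one_div_lt hδ
  set n := n0 + 3 with hn
  have hnp : (0:ℝ) < n := by rw [hn]; positivity
  have hnδ : 1 / (n:ℝ) < δ := by
    refine lt_of_le_of_lt ?_ hn0
    apply one_div_le_one_div_of_le
    · positivity
    · rw [hn]; push_cast; linarith
  have hclose : ∀ τ : unitInterval, ∀ i j k l : ℕ, i ≤ n → j ≤ n → k ≤ n → l ≤ n → (i ≤ k + 1) → (k ≤ i + 1) →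
      (j ≤ l + 1) → (l ≤ j + 1) →
      dist (H (τ, sph (i/n) (j/n)) : E3) (H (τ, sph (k/n) (l/n)) : E3) < 1 := by
    intro τ i j k l hi hj hk hl h1 h2 h3 h4
    have mem : ∀ m : ℕ, m ≤ n → (m:ℝ)/n ∈ Set.Icc (0:ℝ) 1 := by
      intro m hm
      refine ⟨by positivity, ?_⟩
      rw [div_le_one hnp]; exact_mod_cast hm
    have dd : ∀ m m' : ℕ, m ≤ m' + 1 → m' ≤ m + 1 → dist ((m:ℝ)/n) ((m':ℝ)/n) < δ := by
      intro m m' a b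
      refine lt_of_le_of_lt ?_ hnδ
      rw [Real.dist_eq, ← sub_div, abs_div, abs_of_pos hnp]
      gcongr
      have a' : (m:ℝ) ≤ m' + 1 := by exact_mod_cast a
      have b' : (m':ℝ) ≤ m + 1 := by exact_mod_cast b
      rw [abs_le]
      constructor <;> linarith
    refine hδ2 (τ, ((i:ℝ)/n, (j:ℝ)/n)) ⟨trivial, mem i hi, mem j hj⟩ (τ, ((k:ℝ)/n, (l:ℝ)/n))
      ⟨trivial, mem k hk, mem l hl⟩ ?_
    rw [Prod.dist_eq, Prod.dist_eq, dist_self]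
    exact max_lt hδ (max_lt (dd _ _ h1 h2) (dd _ _ h3 h4))
  set x : unitInterval → ℕ → ℕ → E3 := fun τ i j => (H (τ, sph (i/n) (j/n)) : E3) with hx
  have hxc : ∀ i j, Continuous fun τ => x τ i j := by
    intro i j
    exact continuous_subtype_val.comp (H.continuous.comp (continuous_id.prodMk continuous_const))
  have re1 : ∀ τ, ∀ i < n, ∀ j < n, 0 < (T3 (x τ i j) (x τ (i+1) j) (x τ (i+1) (j+1))).re := by
    intro τ i hi j hj
    apply T3_re <;> apply hclose <;> omega
  have re2 : ∀ τ, ∀ i < n, ∀ j < n, 0 < (T3 (x τ i j) (x τ (i+1) (j+1)) (x τ i (j+1))).re := by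
    intro τ i hi j hj
    apply T3_re <;> apply hclose <;> omega
  have hnn : (n:ℝ)/n = 1 := div_self hnp.ne'
  have hintN : ∀ τ, Complex.exp (N3 n (x τ) * Complex.I) = 1 := by
    intro τ
    apply N3_int
    · intro i j; exact unit_sq _
    · intro i
      simp only [hx, hnn]
      congr 3
      apply S2_ext <;> simp [sph0, sph1, sph2]
    · intro j
      simp only [hx]
      congr 3
      apply S2_ext <;> simp [sph0, sph1, sph2]
    · intro j
      simp only [hx, hnn]
      congr 3
      apply S2_ext <;> simp [sph0, sph1, sph2]
    · intro i hi j hj h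
      have := re1 τ i hi j hj
      rw [h] at this; simp at this
    · intro i hi j hj h
      have := re2 τ i hi j hj
      rw [h] at this; simp at this
  have hNc : Continuous fun τ => (N3 n (x τ) * Complex.I : ℂ) := by
    refine (Complex.continuous_ofReal.comp ?_).mul continuous_const
    unfold N3
    refine continuous_finsetSum _ fun i hi => continuous_finsetSum _ fun j hj => ?_
    rw [Finset.mem_range] at hi hj
    refine Continuous.add ?_ ?_
    · rw [continuous_iff_continuousAt]
      intro τ
      exact (Complex.continuousAt_arg (Or.inl (re1 τ i hi j hj))).comp
        (f := fun τ => T3 (x τ i j) (x τ (i+1) j) (x τ (i+1) (j+1)))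
        (T3_cont (hxc _ _) (hxc _ _) (hxc _ _)).continuousAt
    · rw [continuous_iff_continuousAt]
      intro τ
      exact (Complex.continuousAt_arg (Or.inl (re2 τ i hi j hj))).comp
        (f := fun τ => T3 (x τ i j) (x τ (i+1) (j+1)) (x τ i (j+1)))
        (T3_cont (hxc _ _) (hxc _ _) (hxc _ _)).continuousAt
  have hconst := exp_one_const (s := (Set.univ : Set unitInterval)) isPreconnected_univ hNc.continuousOn
    (fun τ _ => hintN τ) (Set.mem_univ 0) (Set.mem_univ 1)
  have hN01 : N3 n (x 0) = N3 n (x 1) := by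
    have := mul_right_cancel₀ Complex.I_ne_zero hconst
    exact_mod_cast this
  have x0 : ∀ i j, x 0 i j = (sph (i/n) (j/n) : E3) := by
    intro i j; simp [hx]
  have x1 : ∀ i j, x 1 i j = (σ (sph (i/n) (j/n)) : E3) := by
    intro i j; simp [hx]
  have hneg : N3 n (x 1) = - N3 n (x 0) := by
    have hc : ∀ z : ℂ, 0 < z.re → (starRingEnd ℂ z).arg = - z.arg := by
      intro z hz
      rw [Complex.arg_conj, if_neg]
      intro h
      rw [Complex.arg_eq_pi_iff] at h
      linarith [h.1]
    unfold N3
    rw [← Finset.sum_neg_distrib]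
    refine Finset.sum_congr rfl fun i hi => ?_
    rw [← Finset.sum_neg_distrib]
    refine Finset.sum_congr rfl fun j hj => ?_
    rw [Finset.mem_range] at hi hj
    have r1 := re1 0 i hi j hj
    have r2 := re2 0 i hi j hj
    simp only [x0] at r1 r2
    simp only [x0, x1]
    rw [hσ, hσ, hc _ r1, hc _ r2]
    ring
  have hn3 : (3:ℝ) ≤ n := by rw [hn]; push_cast; linarith [n0.cast_nonneg (α := ℝ)]
  have pin : Real.pi * (1/n) ≤ Real.pi / 3 := by
    rw [mul_one_div]
    gcongr
  have pin0 : 0 < Real.pi * (1/n) := by positivity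
  have hpi := Real.pi_pos
  have s1 : 0 < Real.sin (Real.pi * (1/n)) := Real.sin_pos_of_pos_of_lt_pi pin0 (by linarith)
  have s2 : 0 < Real.sin (2 * Real.pi * (1/n)) := by
    rw [mul_assoc]
    exact Real.sin_pos_of_pos_of_lt_pi (by linarith) (by linarith)
  have sn : ∀ i ≤ n, 0 ≤ Real.sin (Real.pi * (i/n)) := by
    intro i hi
    have h1 : (i:ℝ)/n ≤ 1 := by rw [div_le_one hnp]; exact_mod_cast hi
    have h0 : (0:ℝ) ≤ (i:ℝ)/n := by positivity
    apply Real.sin_nonneg_of_nonneg_of_le_pi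
    · positivity
    · nlinarith
  have dif : ∀ i : ℕ, ((i+1 : ℕ):ℝ)/n - (i:ℝ)/n = 1/n := by
    intro i; rw [← sub_div]; push_cast; ring
  have im1 : ∀ i < n, ∀ j < n, 0 ≤ (T3 (x 0 i j) (x 0 (i+1) j) (x 0 (i+1) (j+1))).im := by
    intro i hi j hj
    simp only [x0]
    rw [sph_im1, dif, dif]
    have := sn (i+1) hi
    positivity
  have im2 : ∀ i < n, ∀ j < n, 0 ≤ (T3 (x 0 i j) (x 0 (i+1) (j+1)) (x 0 i (j+1))).im := by
    intro i hi j hj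
    simp only [x0]
    rw [sph_im2, dif, dif]
    have := sn i hi.le
    positivity
  have hpos : 0 < N3 n (x 0) := by
    unfold N3
    have hnn : ∀ i ∈ Finset.range n, ∀ j ∈ Finset.range n,
      0 ≤ (T3 (x 0 i j) (x 0 (i+1) j) (x 0 (i+1) (j+1))).arg + (T3 (x 0 i j) (x 0 (i+1) (j+1)) (x 0 i (j+1))).arg := by
      intro i hi j hj
      rw [Finset.mem_range] at hi hj
      exact add_nonneg (Complex.arg_nonneg_iff.2 (im1 i hi j hj)) (Complex.arg_nonneg_iff.2 (im2 i hi j hj))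
    have h0n : 0 < n := by omega
    refine Finset.sum_pos' (fun i hi => Finset.sum_nonneg (hnn i hi)) ⟨0, Finset.mem_range.2 h0n, ?_⟩
    refine Finset.sum_pos' (hnn 0 (Finset.mem_range.2 h0n)) ⟨0, Finset.mem_range.2 h0n, ?_⟩
    refine add_pos_of_pos_of_nonneg ?_ (Complex.arg_nonneg_iff.2 (im2 0 h0n 0 h0n))
    refine lt_of_le_of_ne (Complex.arg_nonneg_iff.2 (im1 0 h0n 0 h0n)) ?_
    intro h
    have h1 := (Complex.arg_eq_zero_iff.1 h.symm).2
    simp only [x0] at h1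
    rw [sph_im1, dif] at h1
    have e : ((0 + 1 : ℕ) : ℝ)/n = 1/n := by norm_num
    rw [e] at h1
    have : 0 < Real.sin (Real.pi * (1/n)) * Real.sin (Real.pi * (1/n)) * Real.sin (2 * Real.pi * (1/n)) := by positivity
    linarith
  linarith
end SphRec

namespace SphRec

/-- the orientation dichotomy for plane homeomorphisms -/
theorem OP_dich (h : ℂ ≃ₜ ℂ) : OP h ∨ OP (fun z => starRingEnd ℂ (h z)) := by
  obtain ⟨q, qc, qe, k, qk⟩ := wind h.continuous h.injective
  obtain ⟨p, pc, pe, m, pm⟩ := wind h.symm.continuous h.symm.injective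
  have p2 : (2 * Real.pi * Complex.I : ℂ) ≠ 0 := Complex.two_pi_I_ne_zero
  have pper : ∀ (j : ℤ) (w ζ : ℂ), p w (ζ + j * (2 * Real.pi * Complex.I)) = p w ζ + j * m * (2 * Real.pi * Complex.I) := by
    intro j w ζ
    have hP : Function.Periodic (fun ζ => p w ζ - m * ζ) (2 * Real.pi * Complex.I) := by
      intro ζ
      simp only [pm]
      ring
    have := hP.int_mul j ζ
    linear_combination this
  -- the composition has a constant logarithm
  have hcomp : ∀ x y : ℂ, (p (h 0) (q 0 x + x) + q 0 x) - (p (h 0) (q 0 y + y) + q 0 y) = 0 := by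
    intro x y
    have := log_sub_const (s := (Set.univ : Set ℂ)) isPreconnected_univ
      (d := fun ζ => p (h 0) (q 0 ζ + ζ) + q 0 ζ) (e := fun _ => 0)
      (by
        apply Continuous.continuousOn
        have c1 : Continuous fun ζ : ℂ => q 0 ζ := qc.comp (continuous_const.prodMk continuous_id)
        have c2 : Continuous fun ζ : ℂ => p (h 0) (q 0 ζ + ζ) :=
          pc.comp (continuous_const.prodMk (c1.add continuous_id))
        exact c2.add c1) (by fun_prop)
      (fun ζ _ => by
        have e1 := pe (h 0) (q 0 ζ + ζ)
        have e2 := qe 0 ζ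
        rw [Complex.exp_add] at e1
        rw [e2] at e1
        simp only [add_sub_cancel, Homeomorph.symm_apply_apply, zero_add, sub_zero] at e1
        rw [Complex.exp_add, Complex.exp_zero]
        have hz := Complex.exp_ne_zero ζ
        apply mul_right_cancel₀ hz
        rw [zero_add] at e2
        rw [mul_assoc, e2, e1, one_mul]) (x := x) (y := y) trivial trivial
    linear_combination this
  have hdd : (1 + k) * (1 + m) = 1 := by
    have e := hcomp (0 + 2 * Real.pi * Complex.I) 0
    rw [qk] at e
    have e2 := pper (k + 1) (h 0) (q 0 0 + 0)
    rw [show q 0 0 + k * (2 * Real.pi * Complex.I) + (0 + 2 * Real.pi * Complex.I) =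
      q 0 0 + 0 + ((k + 1 : ℤ) : ℂ) * (2 * Real.pi * Complex.I) by push_cast; ring, e2] at e
    push_cast at e
    have e3 : ((k:ℂ) + 1) * m + k = 0 := by
      have : (((k:ℂ) + 1) * m + k) * (2 * Real.pi * Complex.I) = 0 := by linear_combination e
      exact (mul_eq_zero.1 this).resolve_right p2
    have e4 : (k + 1) * m + k = 0 := by exact_mod_cast e3
    linarith
  rcases Int.eq_one_or_neg_one_of_mul_eq_one hdd with hd | hd
  · left
    have : k = 0 := by omega
    subst this
    exact OP_of_wind_zero qc qe (fun w ζ => by rw [qk]; simp)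
  · right
    have : k = -2 := by omega
    subst this
    refine OP_of_wind_zero (q := fun w ζ => starRingEnd ℂ (q w ζ + ζ) - ζ) ?_ ?_ ?_
    · have c : Continuous fun p : ℂ × ℂ => q p.1 p.2 + p.2 := qc.add continuous_snd
      exact (Complex.continuous_conj.comp c).sub continuous_snd
    · intro w ζ
      rw [← Complex.exp_add, sub_add_cancel, Complex.exp_conj, Complex.exp_add, qe, map_sub]
    · intro w ζ
      simp only [qk]
      simp only [map_add, map_mul, Complex.conj_I, Complex.conj_ofReal, Int.cast_neg, Int.cast_ofNat, map_neg]
      rw [show (starRingEnd ℂ) 2 = 2 from Complex.conj_ofReal 2]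
      ring

/-- a self-homeomorphism of the sphere homotopic to the identity has a fixed point -/
theorem exists_fixed (f : C(S2, S2)) (hf : ContinuousMap.Homotopic f (ContinuousMap.id S2)) :
    ∃ x, f x = x := by
  by_contra hno
  push Not at hno
  set σ : C(S2, S2) := ⟨fun x => -x, continuous_neg⟩ with hσ
  refine no_htpy σ ?_ (hf.symm.trans ?_)
  · intro a b c
    apply Complex.ext
    · simp [T3, hσ]
    · simp [T3, hσ]; ring
  · set v : unitInterval × S2 → E3 := fun p => (1 - (p.1:ℝ)) • (f p.2 : E3) - (p.1:ℝ) • (p.2 : E3) with hv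
    have hvc : Continuous v := by fun_prop
    have hn : ∀ x : S2, ‖(x : E3)‖ = 1 := fun x => by simp
    have hv0 : ∀ p, v p ≠ 0 := by
      rintro ⟨t, x⟩ h0
      simp only [hv] at h0
      have h1 := sub_eq_zero.1 h0
      have h2 := congrArg norm h1
      rw [norm_smul, norm_smul, hn, hn, mul_one, mul_one, Real.norm_of_nonneg t.2.1,
        Real.norm_of_nonneg (by linarith [t.2.2])] at h2
      rw [h2] at h1
      have ht : (t:ℝ) ≠ 0 := by linarith
      have := smul_right_injective E3 ht h1
      exact hno x (Subtype.ext this)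
    refine ⟨⟨⟨fun p => ⟨‖v p‖⁻¹ • v p, ?_⟩, ?_⟩, ?_, ?_⟩⟩
    · rw [mem_sphere_zero_iff_norm, norm_smul, norm_inv, norm_norm, inv_mul_cancel₀ (norm_ne_zero_iff.2 (hv0 p))]
    · refine Continuous.subtype_mk ?_ _
      exact (hvc.norm.inv₀ fun p => norm_ne_zero_iff.2 (hv0 p)).smul hvc
    · intro x
      apply Subtype.ext
      simp [hv]
    · intro x
      apply Subtype.ext
      simp [hv, hσ]

end SphRec

namespace SphRec

/-- the north pole -/
noncomputable def NP : S2 := ⟨!₂[0, 0, 1], by apply mem_S2; simp⟩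

lemma NP0 : (NP : E3) 0 = 0 := by simp [NP]
lemma NP1 : (NP : E3) 1 = 0 := by simp [NP]
lemma NP2 : (NP : E3) 2 = 1 := by simp [NP]

lemma den_pos (z : ℂ) : 0 < z.re ^ 2 + z.im ^ 2 + 1 := by positivity

/-- inverse stereographic projection -/
noncomputable def sn (z : ℂ) : S2 :=
  ⟨!₂[2 * z.re / (z.re ^ 2 + z.im ^ 2 + 1), 2 * z.im / (z.re ^ 2 + z.im ^ 2 + 1),
    (z.re ^ 2 + z.im ^ 2 - 1) / (z.re ^ 2 + z.im ^ 2 + 1)], by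
    apply mem_S2
    have := (den_pos z).ne'
    simp
    field_simp
    ring⟩

lemma sn0 (z : ℂ) : (sn z : E3) 0 = 2 * z.re / (z.re ^ 2 + z.im ^ 2 + 1) := by simp [sn]
lemma sn1 (z : ℂ) : (sn z : E3) 1 = 2 * z.im / (z.re ^ 2 + z.im ^ 2 + 1) := by simp [sn]
lemma sn2 (z : ℂ) : (sn z : E3) 2 = (z.re ^ 2 + z.im ^ 2 - 1) / (z.re ^ 2 + z.im ^ 2 + 1) := by simp [sn]

/-- stereographic projection -/
noncomputable def sp (x : S2) : ℂ := ⟨(x : E3) 0 / (1 - (x : E3) 2), (x : E3) 1 / (1 - (x : E3) 2)⟩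

lemma ne_NP {x : S2} (h : x ≠ NP) : 1 - (x : E3) 2 ≠ 0 := by
  intro h2
  apply h
  have := unit_sq x
  have e : (x : E3) 2 = 1 := by linarith
  rw [e] at this
  have a0 : (x : E3) 0 = 0 := by nlinarith [sq_nonneg ((x : E3) 0), sq_nonneg ((x : E3) 1)]
  have a1 : (x : E3) 1 = 0 := by nlinarith [sq_nonneg ((x : E3) 0), sq_nonneg ((x : E3) 1)]
  exact S2_ext (by rw [a0, NP0]) (by rw [a1, NP1]) (by rw [e, NP2])

lemma sn_ne (z : ℂ) : sn z ≠ NP := by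
  intro h
  have := congrArg (fun x : S2 => (x : E3) 2) h
  simp only [sn2, NP2] at this
  rw [div_eq_one_iff_eq (den_pos z).ne'] at this
  linarith

lemma sp_sn (z : ℂ) : sp (sn z) = z := by
  have h := (den_pos z).ne'
  have e : 1 - (z.re ^ 2 + z.im ^ 2 - 1) / (z.re ^ 2 + z.im ^ 2 + 1) = 2 / (z.re ^ 2 + z.im ^ 2 + 1) := by
    field_simp; ring
  apply Complex.ext
  · simp only [sp, sn0, sn2]
    rw [e]; field_simp
  · simp only [sp, sn1, sn2]
    rw [e]; field_simp

lemma sn_sp {x : S2} (hx : x ≠ NP) : sn (sp x) = x := by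
  have h := ne_NP hx
  have hu := unit_sq x
  have e : (sp x).re ^ 2 + (sp x).im ^ 2 = (1 + (x : E3) 2) / (1 - (x : E3) 2) := by
    simp only [sp]
    field_simp
    linarith
  have e1 : (1 + (x : E3) 2) / (1 - (x : E3) 2) + 1 = 2 / (1 - (x : E3) 2) := by
    field_simp; ring
  have e2 : (1 + (x : E3) 2) / (1 - (x : E3) 2) - 1 = 2 * (x : E3) 2 / (1 - (x : E3) 2) := by
    field_simp; ring
  apply S2_ext
  · rw [sn0, e, e1]; simp only [sp]; field_simp
  · rw [sn1, e, e1]; simp only [sp]; field_simp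
  · rw [sn2, e, e1, e2]; field_simp

lemma sn_cont : Continuous sn := by
  have h := fun z => (den_pos z).ne'
  have c : Continuous fun z : ℂ => z.re ^ 2 + z.im ^ 2 + 1 := by fun_prop
  apply cont_S2 <;> simp only [sn0, sn1, sn2]
  · exact Continuous.div (by fun_prop) c h
  · exact Continuous.div (by fun_prop) c h
  · exact Continuous.div (by fun_prop) c h

lemma sp_contAt {x : S2} (hx : x ≠ NP) : ContinuousAt sp x := by
  have h := ne_NP hx
  have e : sp = fun x : S2 => (((x : E3) 0 / (1 - (x : E3) 2) : ℝ) : ℂ) +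
      (((x : E3) 1 / (1 - (x : E3) 2) : ℝ) : ℂ) * Complex.I := by
    ext x; exact (Complex.re_add_im (sp x)).symm
  have c : ∀ i : Fin 3, ContinuousAt (fun x : S2 => (x : E3) i) x := fun i => by
    apply Continuous.continuousAt
    fun_prop
  rw [e]
  have c1 := (c 0).div (continuousAt_const.sub (c 2)) h
  have c2 := (c 1).div (continuousAt_const.sub (c 2)) h
  exact (Complex.continuous_ofReal.continuousAt.comp c1).add
    ((Complex.continuous_ofReal.continuousAt.comp c2).mul continuousAt_const)

lemma sn_range : Set.range sn = {NP}ᶜ := by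
  ext x
  constructor
  · rintro ⟨z, rfl⟩; exact sn_ne z
  · intro hx; exact ⟨sp x, sn_sp hx⟩

lemma sn_emb : IsOpenEmbedding sn := by
  refine ⟨⟨?_, ?_⟩, ?_⟩
  · rw [isInducing_iff_nhds]
    intro z
    apply le_antisymm
    · exact (sn_cont.continuousAt).le_comap
    · have := sp_contAt (sn_ne z)
      unfold ContinuousAt at this
      rw [sp_sn] at this
      have h2 := comap_mono (m := sn) this.le_comap
      rw [comap_comap] at h2
      have : sp ∘ sn = id := by ext z; exact sp_sn z
      rw [this, comap_id] at h2
      exact h2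
  · intro a b hab
    rw [← sp_sn a, hab, sp_sn]
  · rw [sn_range]; exact isOpen_compl_singleton

lemma sn_tendsto : Tendsto sn (cocompact ℂ) (𝓝 NP) := by
  intro U hU
  obtain ⟨V, hVU, hV, hN⟩ := _root_.mem_nhds_iff.1 hU
  rw [mem_map]
  have : IsCompact (sn ⁻¹' Vᶜ) := by
    rw [sn_emb.isInducing.isCompact_preimage_iff]
    · exact hV.isClosed_compl.isCompact
    · rw [sn_range]; rintro x hx rfl; exact hx hN
  filter_upwards [this.compl_mem_cocompact] with z hz
  apply hVU
  by_contra hc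
  exact hz hc

lemma sp_tendsto : Tendsto sp (𝓝[≠] NP) (cocompact ℂ) := by
  intro U hU
  obtain ⟨C, hC, hCU⟩ := mem_cocompact.1 hU
  rw [mem_map]
  have h1 : (sn '' C)ᶜ ∈ 𝓝 NP := by
    refine (hC.image sn_cont).isClosed.isOpen_compl.mem_nhds ?_
    rintro ⟨z, _, hz⟩
    exact sn_ne z hz
  filter_upwards [mem_nhdsWithin_of_mem_nhds h1, self_mem_nhdsWithin] with x hx hx2
  apply hCU
  intro hc
  exact hx ⟨sp x, hc, sn_sp hx2⟩

open Classical in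
/-- extension of a proper family of plane maps to the sphere -/
lemma ext_cont {K : unitInterval → ℂ → ℂ} (hK : Continuous fun p : unitInterval × ℂ => K p.1 p.2)
    (hp : Tendsto (fun p : unitInterval × ℂ => K p.1 p.2) (⊤ ×ˢ cocompact ℂ) (cocompact ℂ)) :
    Continuous fun p : unitInterval × S2 => if p.2 = NP then NP else sn (K p.1 (sp p.2)) := by
  rw [continuous_iff_continuousAt]
  rintro ⟨t, x⟩
  by_cases hx : x = NP
  · subst hx
    unfold ContinuousAt
    simp only [if_true]
    intro U hU
    have h1 : Tendsto (fun p : unitInterval × S2 => sn (K p.1 (sp p.2))) (⊤ ×ˢ 𝓝[≠] NP) (𝓝 NP) :=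
      sn_tendsto.comp (hp.comp (tendsto_id.prodMap sp_tendsto))
    have h2 := h1 hU
    rw [mem_map, mem_prod_iff] at h2
    obtain ⟨A, hA, B, hB, hAB⟩ := h2
    rw [mem_top] at hA
    subst hA
    rw [mem_map, nhds_prod_eq]
    have hB2 : {x | x ≠ NP → x ∈ B} ∈ 𝓝 NP := mem_nhdsWithin_iff_eventually.1 hB
    filter_upwards [prod_mem_prod (univ_mem : Set.univ ∈ 𝓝 t) hB2]
    rintro ⟨s, y⟩ ⟨_, hy⟩
    by_cases hyN : y = NP
    · simp only [hyN, Set.mem_preimage, if_true]; exact mem_of_mem_nhds hU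
    · simp only [Set.mem_preimage, if_neg hyN]
      exact hAB (show (s, y) ∈ Set.univ ×ˢ B from ⟨trivial, hy hyN⟩)
  · have ev : ∀ᶠ p : unitInterval × S2 in 𝓝 (t, x), p.2 ≠ NP := continuousAt_snd.eventually_ne hx
    have : (fun p : unitInterval × S2 => if p.2 = NP then NP else sn (K p.1 (sp p.2))) =ᶠ[𝓝 (t, x)]
        fun p => sn (K p.1 (sp p.2)) := by
      filter_upwards [ev] with p hp
      rw [if_neg hp]
    rw [continuousAt_congr this]
    have c1 : ContinuousAt (fun p : unitInterval × S2 => (p.1, sp p.2)) (t, x) :=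
      continuousAt_fst.prodMk (ContinuousAt.comp (g := sp) (sp_contAt hx) continuousAt_snd)
    exact sn_cont.continuousAt.comp (ContinuousAt.comp (g := fun p : unitInterval × ℂ => K p.1 p.2)
      hK.continuousAt c1)

/-- an orientation preserving proper plane map is properly homotopic to the identity -/
lemma OP_htpy {u : ℂ → ℂ} (hu : Continuous u) (hup : Tendsto (fun z => ‖u z‖) (cocompact ℂ) atTop) (ho : OP u) :
    ∃ K : unitInterval → ℂ → ℂ, Continuous (fun p : unitInterval × ℂ => K p.1 p.2) ∧
      Tendsto (fun p : unitInterval × ℂ => K p.1 p.2) (⊤ ×ˢ cocompact ℂ) (cocompact ℂ) ∧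
      (∀ z, K 0 z = z) ∧ ∀ z, K 1 z = u z := by
  obtain ⟨L, hL, hL2⟩ := ho
  have hLz : ∀ z : ℂ, z ≠ 0 → ‖z‖ * Real.exp (L z 0).re = ‖u z - u 0‖ := by
    intro z hz
    rw [← hL2 z 0 hz, norm_mul, Complex.norm_exp, sub_zero, mul_comm]
  have hnorm : ∀ (t : unitInterval) (z : ℂ), ‖z * Complex.exp ((t:ℝ) * L z 0)‖ = ‖z‖ * Real.exp (t * (L z 0).re) := by
    intro t z
    rw [norm_mul, Complex.norm_exp]
    simp
  have hup1 : ∀ (t : unitInterval) (z : ℂ), ‖z * Complex.exp ((t:ℝ) * L z 0)‖ ≤ ‖z‖ + ‖u z - u 0‖ := by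
    intro t z
    by_cases hz : z = 0
    · simp [hz]
    rw [hnorm, ← hLz z hz]
    have : Real.exp (t * (L z 0).re) ≤ 1 + Real.exp (L z 0).re := by
      rcases le_total 0 (L z 0).re with h | h
      · have : Real.exp (t * (L z 0).re) ≤ Real.exp (L z 0).re := Real.exp_le_exp.2 (by nlinarith [t.2.2])
        linarith
      · have : Real.exp (t * (L z 0).re) ≤ 1 := Real.exp_le_one_iff.2 (by nlinarith [t.2.1])
        linarith [Real.exp_pos (L z 0).re]
    nlinarith [norm_nonneg z]
  have hlow : ∀ (t : unitInterval) (z : ℂ), z ≠ 0 → min ‖z‖ ‖u z - u 0‖ ≤ ‖z * Complex.exp ((t:ℝ) * L z 0)‖ := by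
    intro t z hz
    rw [hnorm, ← hLz z hz]
    rcases le_total 0 (L z 0).re with h | h
    · have : 1 ≤ Real.exp (t * (L z 0).re) := Real.one_le_exp (mul_nonneg t.2.1 h)
      exact (min_le_left _ _).trans (by nlinarith [norm_nonneg z])
    · have : Real.exp (L z 0).re ≤ Real.exp (t * (L z 0).re) := Real.exp_le_exp.2 (by nlinarith [t.2.2])
      exact (min_le_right _ _).trans (by gcongr)
  refine ⟨fun t z => (t:ℝ) * u 0 + z * Complex.exp ((t:ℝ) * L z 0), ?_, ?_, ?_, ?_⟩
  · refine Continuous.add (by fun_prop) ?_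
    rw [continuous_iff_continuousAt]
    rintro ⟨t, z⟩
    by_cases hz : z = 0
    · subst hz
      unfold ContinuousAt
      simp only [zero_mul]
      apply squeeze_zero_norm (a := fun p : unitInterval × ℂ => ‖p.2‖ + ‖u p.2 - u 0‖) (fun p => hup1 p.1 p.2)
      have : Continuous fun p : unitInterval × ℂ => ‖p.2‖ + ‖u p.2 - u 0‖ := by fun_prop
      have := this.tendsto (t, 0)
      simpa using this
    · have c : ContinuousAt (fun p : unitInterval × ℂ => L p.2 0) (t, z) := by
        have o : IsOpen {p : ℂ × ℂ | p.1 ≠ p.2} := isOpen_ne_fun continuous_fst continuous_snd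
        have c0 : ContinuousAt (fun p : ℂ × ℂ => L p.1 p.2) (z, 0) := hL.continuousAt (o.mem_nhds hz)
        exact ContinuousAt.comp (g := fun p : ℂ × ℂ => L p.1 p.2) (f := fun p : unitInterval × ℂ => (p.2, (0:ℂ)))
          c0 (by fun_prop)
      have c2 : ContinuousAt (fun p : unitInterval × ℂ => ((p.1 : ℝ) : ℂ)) (t, z) := by fun_prop
      exact continuousAt_snd.mul (Complex.continuous_exp.continuousAt.comp (c2.mul c))
  · suffices hs : Tendsto (fun p : unitInterval × ℂ => ‖((p.1:ℝ):ℂ) * u 0 + p.2 * Complex.exp ((p.1:ℝ) * L p.2 0)‖)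
        (⊤ ×ˢ cocompact ℂ) atTop by
      have e : cocompact ℂ = comap norm atTop := by
        rw [comap_norm_atTop, Metric.cobounded_eq_cocompact]
      have := tendsto_comap_iff.2 (show Tendsto (norm ∘ fun p : unitInterval × ℂ =>
        ((p.1:ℝ):ℂ) * u 0 + p.2 * Complex.exp ((p.1:ℝ) * L p.2 0)) (⊤ ×ˢ cocompact ℂ) atTop from hs)
      rw [← e] at this
      exact this
    have e1 : Tendsto (fun z : ℂ => min ‖z‖ (‖u z‖ - ‖u 0‖)) (cocompact ℂ) atTop := by
      have a1 : Tendsto (fun z : ℂ => ‖u z‖ - ‖u 0‖) (cocompact ℂ) atTop := tendsto_atTop_add_const_right _ _ hup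
      have a2 : Tendsto (fun z : ℂ => ‖z‖) (cocompact ℂ) atTop := tendsto_norm_cocompact_atTop
      rw [Filter.tendsto_atTop] at a1 a2 ⊢
      intro b
      filter_upwards [a1 b, a2 b] with z h1 h2
      exact le_min h2 h1
    have e2 : Tendsto (fun p : unitInterval × ℂ => min ‖p.2‖ (‖u p.2‖ - ‖u 0‖) - ‖u 0‖) (⊤ ×ˢ cocompact ℂ) atTop := by
      have := e1.comp (tendsto_snd (f := (⊤ : Filter unitInterval)) (g := cocompact ℂ))
      exact tendsto_atTop_add_const_right _ (-‖u 0‖) this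
    apply tendsto_atTop_mono' _ _ e2
    have ev : ∀ᶠ p : unitInterval × ℂ in ⊤ ×ˢ cocompact ℂ, p.2 ≠ 0 := by
      have : ∀ᶠ z in cocompact ℂ, z ≠ 0 := (isCompact_singleton (x := (0:ℂ))).compl_mem_cocompact
      exact tendsto_snd.eventually this
    filter_upwards [ev] with p hp
    have h1 := hlow p.1 p.2 hp
    have h2 : ‖((p.1:ℝ):ℂ) * u 0‖ ≤ ‖u 0‖ := by
      rw [norm_mul, Complex.norm_real, Real.norm_of_nonneg p.1.2.1]
      nlinarith [norm_nonneg (u 0), p.1.2.2]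
    have h3 := norm_sub_le (((p.1:ℝ):ℂ) * u 0 + p.2 * Complex.exp ((p.1:ℝ) * L p.2 0)) (((p.1:ℝ):ℂ) * u 0)
    rw [add_sub_cancel_left] at h3
    have h4 : ‖u p.2‖ - ‖u 0‖ ≤ ‖u p.2 - u 0‖ := norm_sub_norm_le _ _
    have h5 := min_le_min_left ‖p.2‖ h4
    linarith
  · intro z; simp
  · intro z
    by_cases hz : z = 0
    · simp [hz]
    have := hL2 z 0 hz
    simp only [Set.Icc.coe_one, Complex.ofReal_one, one_mul]
    rw [sub_zero] at this
    rw [mul_comm z, this]; ring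

end SphRec

namespace SphRec

/-- reflection of the sphere in the second coordinate -/
noncomputable def rfl2 : C(S2, S2) :=
  ⟨fun x => ⟨!₂[(x : E3) 0, -(x : E3) 1, (x : E3) 2], by
    apply mem_S2
    have := unit_sq x
    simp
    linarith⟩, by
    apply cont_S2
    · simp; fun_prop
    · simp; fun_prop
    · simp; fun_prop⟩

lemma rfl2_0 (x : S2) : (rfl2 x : E3) 0 = (x : E3) 0 := by simp [rfl2]
lemma rfl2_1 (x : S2) : (rfl2 x : E3) 1 = -(x : E3) 1 := by simp [rfl2]
lemma rfl2_2 (x : S2) : (rfl2 x : E3) 2 = (x : E3) 2 := by simp [rfl2]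

lemma rfl2_NP : rfl2 NP = NP := by
  apply S2_ext
  · rw [rfl2_0]
  · rw [rfl2_1, NP1, neg_zero]
  · rw [rfl2_2]

lemma rfl2_sn (z : ℂ) : rfl2 (sn z) = sn (starRingEnd ℂ z) := by
  apply S2_ext
  · rw [rfl2_0, sn0, sn0]; simp
  · rw [rfl2_1, sn1, sn1]; simp [neg_div]
  · rw [rfl2_2, sn2, sn2]; simp

lemma rfl2_T3 (a b c : S2) : T3 (rfl2 a) (rfl2 b) (rfl2 c) = starRingEnd ℂ (T3 a b c) := by
  apply Complex.ext
  · simp only [T3, rfl2_0, rfl2_1, rfl2_2, Complex.conj_re]; ring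
  · simp only [T3, rfl2_0, rfl2_1, rfl2_2, Complex.conj_im]; ring

lemma map_ne_NP {f : S2 ≃ₜ S2} (hN : f NP = NP) {x : S2} (hx : x ≠ NP) : f x ≠ NP := fun h =>
  hx (f.injective (h.trans hN.symm))

/-- the plane homeomorphism induced by a sphere homeomorphism fixing the pole -/
noncomputable def pl (f : S2 ≃ₜ S2) (hN : f NP = NP) : ℂ ≃ₜ ℂ where
  toFun z := sp (f (sn z))
  invFun z := sp (f.symm (sn z))
  left_inv z := by
    show sp (f.symm (sn (sp (f (sn z))))) = z
    rw [sn_sp (map_ne_NP hN (sn_ne z)), f.symm_apply_apply, sp_sn]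
  right_inv z := by
    have hN2 : f.symm NP = NP := by rw [f.symm_apply_eq, hN]
    show sp (f (sn (sp (f.symm (sn z))))) = z
    rw [sn_sp (map_ne_NP hN2 (sn_ne z)), f.apply_symm_apply, sp_sn]
  continuous_toFun := by
    rw [continuous_iff_continuousAt]
    intro z
    exact ContinuousAt.comp (g := sp) (sp_contAt (map_ne_NP hN (sn_ne z)))
      (f.continuous.comp sn_cont).continuousAt
  continuous_invFun := by
    have hN2 : f.symm NP = NP := by rw [f.symm_apply_eq, hN]
    rw [continuous_iff_continuousAt]
    intro z
    exact ContinuousAt.comp (g := sp) (sp_contAt (map_ne_NP hN2 (sn_ne z)))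
      (f.symm.continuous.comp sn_cont).continuousAt

lemma pl_conj (f : S2 ≃ₜ S2) (hN : f NP = NP) (z : ℂ) : sn (pl f hN z) = f (sn z) :=
  sn_sp (map_ne_NP hN (sn_ne z))

lemma pl_OP (f : S2 ≃ₜ S2) (hN : f NP = NP)
    (hf : ContinuousMap.Homotopic ⟨f, f.continuous⟩ (ContinuousMap.id S2)) : OP (pl f hN) := by
  rcases OP_dich (pl f hN) with h | h
  · exact h
  exfalso
  have hc : Continuous fun z => starRingEnd ℂ (pl f hN z) := Complex.continuous_conj.comp (pl f hN).continuous
  obtain ⟨K, Kc, Kp, K0, K1⟩ := OP_htpy hc (by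
    simp only [RCLike.norm_conj]
    exact tendsto_norm_cocompact_atTop.comp (pl f hN).isClosedEmbedding.tendsto_cocompact) h
  have h1 : ContinuousMap.Homotopic (ContinuousMap.id S2) (rfl2.comp ⟨f, f.continuous⟩) := by
    classical
    refine ⟨⟨⟨fun p => if p.2 = NP then NP else sn (K p.1 (sp p.2)), by convert ext_cont Kc Kp⟩, ?_, ?_⟩⟩
    · intro x
      by_cases hx : x = NP
      · simp [hx]
      · simp [hx, K0, sn_sp hx]
    · intro x
      by_cases hx : x = NP
      · simp [hx, hN, rfl2_NP]
      · simp only [hx, if_false, K1, ← rfl2_sn, pl_conj, sn_sp hx, ContinuousMap.comp_apply,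
          ContinuousMap.coe_mk]
  have h2 : ContinuousMap.Homotopic (rfl2.comp ⟨f, f.continuous⟩) (rfl2.comp (ContinuousMap.id S2)) :=
    (ContinuousMap.Homotopic.refl rfl2).comp hf
  have h3 := h1.trans h2
  rw [ContinuousMap.comp_id] at h3
  exact no_htpy rfl2 rfl2_T3 h3

/-- the sphere homeomorphism induced by a linear isometry -/
noncomputable def isoS (A : E3 ≃ₗᵢ[ℝ] E3) : S2 ≃ₜ S2 where
  toFun x := ⟨A x, by rw [mem_sphere_zero_iff_norm, A.norm_map]; simp⟩
  invFun x := ⟨A.symm x, by rw [mem_sphere_zero_iff_norm, A.symm.norm_map]; simp⟩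
  left_inv x := by apply Subtype.ext; simp
  right_inv x := by apply Subtype.ext; simp
  continuous_toFun := Continuous.subtype_mk (A.continuous.comp continuous_subtype_val) _
  continuous_invFun := Continuous.subtype_mk (A.symm.continuous.comp continuous_subtype_val) _

lemma exists_iso (P : S2) : ∃ g : S2 ≃ₜ S2, g NP = P := by
  refine ⟨isoS (Submodule.reflection (Submodule.span ℝ {(NP : E3) - (P : E3)})ᗮ), ?_⟩
  apply Subtype.ext
  show Submodule.reflection (Submodule.span ℝ {(NP : E3) - (P : E3)})ᗮ (NP : E3) = P
  apply Submodule.reflection_sub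
  simp

theorem final_thm (f : S2 ≃ₜ S2) (hrec : Rec f)
    (hor : ContinuousMap.Homotopic ⟨f, f.continuous⟩ (ContinuousMap.id S2)) (hne : ∃ x, f x ≠ x) :
    ∃ a b : S2, a ≠ b ∧ {x : S2 | f x = x} = {a, b} := by
  obtain ⟨P, hP⟩ := exists_fixed _ hor
  have hP : f P = P := hP
  obtain ⟨g, hg⟩ := exists_iso P
  set f' : S2 ≃ₜ S2 := (g.trans f).trans g.symm with hf'
  have hf'a : ∀ x, f' x = g.symm (f (g x)) := fun x => rfl
  have hN : f' NP = NP := by rw [hf'a, hg, hP, ← hg, g.symm_apply_apply]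
  have hor' : ContinuousMap.Homotopic ⟨f', f'.continuous⟩ (ContinuousMap.id S2) := by
    have := (ContinuousMap.Homotopic.refl (⟨g.symm, g.symm.continuous⟩ : C(S2, S2))).comp
      (hor.comp (ContinuousMap.Homotopic.refl (⟨g, g.continuous⟩ : C(S2, S2))))
    convert this using 1
    · ext1 x
      exact hf'a x
    · ext1 x
      exact (g.symm_apply_apply x).symm
  have : CompactSpace S2 := inferInstance
  have : PreconnectedSpace S2 := by
    apply isPreconnected_iff_preconnectedSpace.1
    apply isPreconnected_sphere
    rw [← Module.finrank_eq_rank, finrank_euclideanSpace, Fintype.card_fin]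
    norm_num
  have c : Ch f P (g ∘ sn) (pl f' hN) :=
    { emb := g.isOpenEmbedding.comp sn_emb
      rng := by
        rw [Set.range_comp, sn_range, Set.image_compl_eq g.bijective, Set.image_singleton, hg]
      fix := hP
      conj := fun z => by
        simp only [Function.comp]
        rw [pl_conj, hf'a, g.apply_symm_apply]
      op := pl_OP f' hN hor' }
  exact c.main hrec hne

end SphRec

/-- A non-trivial, orientation-preserving, recurrent homeomorphism of the
2-sphere has exactly two fixed points. -/
theorem sphere_recurrent_two_fixed_points (f : Sphere2 ≃ₜ Sphere2)
    (hrec : IsRecurrent (f : Sphere2 → Sphere2))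
    (hor : SphereOrientationPreserving f)
    (hne : ∃ x, f x ≠ x) :
    ∃ a b : Sphere2, a ≠ b ∧ {x : Sphere2 | f x = x} = {a, b} := by
  refine SphRec.final_thm f ?_ hor hne
  obtain ⟨n, hn, hn2⟩ := hrec
  intro ε hε m
  obtain ⟨k, hk1, hk2⟩ := ((hn.eventually_ge_atTop m).and (hn2 ε hε)).exists
  exact ⟨n k, hk1, hk2⟩
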